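/- Let h be a smooth solution of the Hele-Shaw equation on [0,T], and suppose the Rayleigh–Taylor coefficient a is bounded below on [0,T]×𝕋ⁿ by a positive constant. Then at every (t,x) ∈ [0,T]×𝕋ⁿ one has the pointwise inequality (G(h)a)(t,x) ≤ a(t,x)·(G(h)(log a))(t,x). -/

import Mathlib

open MeasureTheory
open scoped Classical

noncomputable section

/-- ℤⁿ-periodicity for functions on ℝⁿ (model for functions on the torus 𝕋ⁿ = ℝⁿ/ℤⁿ). -/
def ZPeriodic (n : ℕ) (f : (Fin n → ℝ) → ℝ) : Prop :=
  ∀ (x : Fin n → ℝ) (k : Fin n → ℤ), f (x + fun i => (k i : ℝ)) = f x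

/-- ℤⁿ-periodicity in the horizontal variable for functions on ℝⁿ × ℝ. -/
def ZPeriodicE (n : ℕ) (φ : (Fin n → ℝ) × ℝ → ℝ) : Prop :=
  ∀ (x : Fin n → ℝ) (y : ℝ) (k : Fin n → ℤ), φ (x + fun i => (k i : ℝ), y) = φ (x, y)

/-- Fundamental cell of the torus 𝕋ⁿ. -/
def cell (n : ℕ) : Set (Fin n → ℝ) := Set.univ.pi fun _ => Set.Ico (0:ℝ) 1

/-- i-th partial derivative of a function on ℝⁿ. -/
def pdX (n : ℕ) (f : (Fin n → ℝ) → ℝ) (i : Fin n) (x : Fin n → ℝ) : ℝ :=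
  fderiv ℝ f x (Pi.single i 1)

/-- Directional derivative of a function on ℝⁿ × ℝ. -/
def pdE (n : ℕ) (φ : (Fin n → ℝ) × ℝ → ℝ) (v : (Fin n → ℝ) × ℝ)
    (p : (Fin n → ℝ) × ℝ) : ℝ := fderiv ℝ φ p v

def eX (n : ℕ) (i : Fin n) : (Fin n → ℝ) × ℝ := (Pi.single i 1, 0)
def eY (n : ℕ) : (Fin n → ℝ) × ℝ := (0, 1)

/-- Laplacian Δ_{x,y} on ℝⁿ × ℝ. -/
def lapE (n : ℕ) (φ : (Fin n → ℝ) × ℝ → ℝ) (p : (Fin n → ℝ) × ℝ) : ℝ :=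
  (∑ i, pdE n (pdE n φ (eX n i)) (eX n i) p) + pdE n (pdE n φ (eY n)) (eY n) p

/-- |∇_{x,y}φ|². -/
def gradSqE (n : ℕ) (φ : (Fin n → ℝ) × ℝ → ℝ) (p : (Fin n → ℝ) × ℝ) : ℝ :=
  (∑ i, (pdE n φ (eX n i) p)^2) + (pdE n φ (eY n) p)^2

/-- One periodic cell of the fluid domain Ω(h) = {y < h(x)}. -/
def fluidCell (n : ℕ) (h : (Fin n → ℝ) → ℝ) : Set ((Fin n → ℝ) × ℝ) :=
  {p | p.1 ∈ cell n ∧ p.2 < h p.1}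

/-- φ is the harmonic extension of ψ to Ω(h) = {y < h(x)}: it is harmonic in Ω(h),
has boundary value ψ, is periodic in x, and has square-integrable gradient. -/
structure IsHarmonicExt (n : ℕ) (h ψ : (Fin n → ℝ) → ℝ)
    (φ : (Fin n → ℝ) × ℝ → ℝ) : Prop where
  smooth : ContDiff ℝ (⊤ : ℕ∞) φ
  periodic : ZPeriodicE n φ
  harmonic : ∀ p : (Fin n → ℝ) × ℝ, p.2 < h p.1 → lapE n φ p = 0
  boundary : ∀ x, φ (x, h x) = ψ x
  gradL2 : IntegrableOn (gradSqE n φ) (fluidCell n h)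

/-- The Dirichlet-to-Neumann operator:
(G(h)ψ)(x) = ∂_yφ(x,h(x)) − ∇h(x)·∇_xφ(x,h(x)), where φ is the harmonic extension of ψ. -/
def DtN (n : ℕ) (h ψ : (Fin n → ℝ) → ℝ) : (Fin n → ℝ) → ℝ :=
  if H : ∃ φ, IsHarmonicExt n h ψ φ then
    fun x => pdE n H.choose (eY n) (x, h x)
      - ∑ i, pdX n h i x * pdE n H.choose (eX n i) (x, h x)
  else 0

/-- (B(h)ψ)(x) = ∂_yφ(x,h(x)). -/
def Bop (n : ℕ) (h ψ : (Fin n → ℝ) → ℝ) : (Fin n → ℝ) → ℝ :=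
  if H : ∃ φ, IsHarmonicExt n h ψ φ then
    fun x => pdE n H.choose (eY n) (x, h x)
  else 0

/-- (V(h)ψ)(x) = ∇_xφ(x,h(x)). -/
def Vop (n : ℕ) (h ψ : (Fin n → ℝ) → ℝ) : (Fin n → ℝ) → Fin n → ℝ :=
  if H : ∃ φ, IsHarmonicExt n h ψ φ then
    fun x i => pdE n H.choose (eX n i) (x, h x)
  else 0

/-- Divergence of a vector field on the torus. -/
def divX (n : ℕ) (W : (Fin n → ℝ) → Fin n → ℝ) (x : Fin n → ℝ) : ℝ :=
  ∑ i, pdX n (fun z => W z i) i x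

/-- h is a smooth solution of the Hele-Shaw equation ∂ₜh + G(h)h = 0 on [0,T]. -/
structure IsHeleShawSol (n : ℕ) (T : ℝ) (h : ℝ → (Fin n → ℝ) → ℝ) : Prop where
  smooth : ContDiff ℝ (⊤ : ℕ∞) (Function.uncurry h)
  periodic : ∀ t : ℝ, ZPeriodic n (h t)
  extension : ∀ t ∈ Set.Icc 0 T, ∃ φ, IsHarmonicExt n (h t) (h t) φ
  equation : ∀ t ∈ Set.Icc 0 T, ∀ x, deriv (fun s => h s x) t + DtN n (h t) (h t) x = 0

/-- B(t,x) = (B(h(t,·))h(t,·))(x). -/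
def HSB (n : ℕ) (h : ℝ → (Fin n → ℝ) → ℝ) (t : ℝ) (x : Fin n → ℝ) : ℝ :=
  Bop n (h t) (h t) x

/-- V(t,x) = (V(h(t,·))h(t,·))(x). -/
def HSV (n : ℕ) (h : ℝ → (Fin n → ℝ) → ℝ) (t : ℝ) (x : Fin n → ℝ) : Fin n → ℝ :=
  Vop n (h t) (h t) x

/-- The Rayleigh–Taylor coefficient a = 1 − B. -/
def HSa (n : ℕ) (h : ℝ → (Fin n → ℝ) → ℝ) (t : ℝ) (x : Fin n → ℝ) : ℝ :=
  1 - HSB n h t x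

/-- γ = (1+|∇h|²)⁻¹ ( G(h)(B²+|V|²) − 2B G(h)B − 2V·G(h)V ). -/
def HSgamma (n : ℕ) (h : ℝ → (Fin n → ℝ) → ℝ) (t : ℝ) (x : Fin n → ℝ) : ℝ :=
  (1 + ∑ i, (pdX n (h t) i x)^2)⁻¹ *
    ( DtN n (h t) (fun z => (HSB n h t z)^2 + ∑ i, (HSV n h t z i)^2) x
      - 2 * HSB n h t x * DtN n (h t) (fun z => HSB n h t z) x
      - 2 * ∑ i, HSV n h t x i * DtN n (h t) (fun z => HSV n h t z i) x )

/-- L(h)f = −V·∇f − ½(div V)f + √a G(h)(√a f). -/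
def Lop (n : ℕ) (h : ℝ → (Fin n → ℝ) → ℝ) (t : ℝ) (f : (Fin n → ℝ) → ℝ)
    (x : Fin n → ℝ) : ℝ :=
  - (∑ i, HSV n h t x i * pdX n f i x)
  - (1/2) * divX n (HSV n h t) x * f x
  + Real.sqrt (HSa n h t x) * DtN n (h t) (fun z => Real.sqrt (HSa n h t z) * f z) x


namespace HS
set_option linter.unusedSectionVars false

/-! ### Part A: operators on Hilbert sums -/

abbrev KK (n : ℕ) := Fin n → ℤ

section opS
variable {n : ℕ} {E : Type*} [NormedAddCommGroup E] [InnerProductSpace ℂ E]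

abbrev HH (n : ℕ) (E : Type*) [NormedAddCommGroup E] [InnerProductSpace ℂ E] :=
  lp (fun _ : KK n => E) 2

theorem summable_sq (f : HH n E) : Summable fun k => ‖f k‖ ^ 2 := by
  have := (lp.memℓp f).summable (by norm_num)
  simpa using this

theorem norm_sq_eq (f : HH n E) : ‖f‖ ^ 2 = ∑' k, ‖f k‖ ^ 2 := by
  have := lp.norm_rpow_eq_tsum (p := 2) (by norm_num) f
  simpa using this

theorem memlp_of_summable_sq (g : KK n → E) (hg : Summable fun k => ‖g k‖ ^ 2) :
    Memℓp g 2 := by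
  apply memℓp_gen
  simpa using hg

theorem opS_aux (σ : KK n ≃ KK n) (A : KK n → E →L[ℂ] E) (M : ℝ) (hA : ∀ k, ‖A k‖ ≤ M)
    (f : HH n E) : Summable (fun k => ‖A k (f (σ k))‖ ^ 2) ∧
      ∑' k, ‖A k (f (σ k))‖ ^ 2 ≤ M ^ 2 * ‖f‖ ^ 2 := by
  have h1 : Summable fun k => M ^ 2 * ‖f (σ k)‖ ^ 2 :=
    ((σ.summable_iff (f := fun k => ‖f k‖ ^ 2)).2 (summable_sq f)).mul_left _
  have h2 : ∀ k, ‖A k (f (σ k))‖ ^ 2 ≤ M ^ 2 * ‖f (σ k)‖ ^ 2 := by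
    intro k
    rw [← mul_pow]
    gcongr
    exact ((A k).le_opNorm _).trans (by gcongr; exact hA k)
  have h3 := Summable.of_nonneg_of_le (fun k => by positivity) h2 h1
  refine ⟨h3, (h3.tsum_le_tsum h2 h1).trans ?_⟩
  rw [tsum_mul_left, norm_sq_eq, σ.tsum_eq (fun k => ‖f k‖ ^ 2)]

def opS (σ : KK n ≃ KK n) (A : KK n → E →L[ℂ] E) (M : ℝ) (hA : ∀ k, ‖A k‖ ≤ M) :
    HH n E →L[ℂ] HH n E :=
  LinearMap.mkContinuous
    { toFun := fun f => ⟨fun k => A k (f (σ k)), memlp_of_summable_sq _ (opS_aux σ A M hA f).1⟩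
      map_add' := fun f g => by ext k; simp; rfl
      map_smul' := fun c f => by ext k; simp } M (by
    intro f
    have hM : 0 ≤ M := (norm_nonneg _).trans (hA 0)
    apply le_of_sq_le_sq _ (by positivity)
    rw [norm_sq_eq, mul_pow]
    exact (opS_aux σ A M hA f).2)

@[simp] theorem opS_apply (σ : KK n ≃ KK n) (A : KK n → E →L[ℂ] E) (M : ℝ) (hA : ∀ k, ‖A k‖ ≤ M)
    (f : HH n E) (k : KK n) : opS σ A M hA f k = A k (f (σ k)) := rfl

theorem opS_norm (σ : KK n ≃ KK n) (A : KK n → E →L[ℂ] E) (M : ℝ) (hA : ∀ k, ‖A k‖ ≤ M) :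
    ‖opS σ A M hA‖ ≤ M :=
  LinearMap.mkContinuous_norm_le _ ((norm_nonneg _).trans (hA 0)) _


theorem wsh_aux (r : KK n → ℝ) (b : ℝ) (h : ∀ k, |r k| ≤ b) (k : KK n) :
    ‖((r k : ℝ) : ℂ) • ContinuousLinearMap.id ℂ E‖ ≤ b := by
  rw [norm_smul]
  refine (mul_le_of_le_one_right (norm_nonneg _) ContinuousLinearMap.norm_id_le).trans ?_
  simpa using h k

/-- weighted shift operator -/
def wsh (m : KK n) (r : KK n → ℝ) (b : ℝ) (h : ∀ k, |r k| ≤ b) : HH n E →L[ℂ] HH n E :=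
  opS (Equiv.subRight m) (fun k => ((r k : ℝ) : ℂ) • ContinuousLinearMap.id ℂ E) b (wsh_aux r b h)

theorem wsh_norm (m : KK n) (r : KK n → ℝ) (b : ℝ) (h : ∀ k, |r k| ≤ b) :
    ‖wsh (E := E) m r b h‖ ≤ b := opS_norm _ _ _ _

theorem wsh_apply (m : KK n) (r : KK n → ℝ) (b : ℝ) (h : ∀ k, |r k| ≤ b) (f : HH n E) (k) :
    wsh (E := E) m r b h f k = ((r k : ℝ) : ℂ) • f (k - m) := rfl

/-- weighted convolution operator -/
def cop (c : KK n → ℂ) (ρ : KK n → KK n → ℝ) (B : KK n → ℝ) (hρ : ∀ m k, |ρ m k| ≤ B m) :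
    HH n E →L[ℂ] HH n E :=
  ∑' m, c m • wsh m (ρ m) (B m) (hρ m)

theorem cop_summable [CompleteSpace E] (c : KK n → ℂ) (ρ : KK n → KK n → ℝ) (B : KK n → ℝ)
    (hρ : ∀ m k, |ρ m k| ≤ B m) (hc : Summable fun m => ‖c m‖ * B m) :
    Summable (fun m => ‖c m • wsh (E := E) m (ρ m) (B m) (hρ m)‖) := by
  refine Summable.of_nonneg_of_le (fun m => norm_nonneg _) (fun m => ?_) hc
  rw [norm_smul]
  gcongr
  exact wsh_norm _ _ _ _

theorem cop_norm [CompleteSpace E] (c : KK n → ℂ) (ρ : KK n → KK n → ℝ) (B : KK n → ℝ)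
    (hρ : ∀ m k, |ρ m k| ≤ B m) (hc : Summable fun m => ‖c m‖ * B m) :
    ‖cop (E := E) c ρ B hρ‖ ≤ ∑' m, ‖c m‖ * B m := by
  unfold cop
  refine tsum_of_norm_bounded hc.hasSum (fun m => ?_)
  rw [norm_smul]
  gcongr
  exact wsh_norm _ _ _ _

theorem cop_apply [CompleteSpace E] (c : KK n → ℂ) (ρ : KK n → KK n → ℝ) (B : KK n → ℝ)
    (hρ : ∀ m k, |ρ m k| ≤ B m) (hc : Summable fun m => ‖c m‖ * B m) (f : HH n E) (k : KK n) :
    HasSum (fun m => c m • ((ρ m k : ℝ) : ℂ) • f (k - m)) (cop (E := E) c ρ B hρ f k) := by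
  have h1 := (cop_summable (E := E) c ρ B hρ hc).of_norm.hasSum
  have h2 := h1.mapL (ContinuousLinearMap.apply ℂ (HH n E) f)
  exact h2.mapL (lp.evalCLM ℂ (fun _ : KK n => E) 2 k)

theorem wsh_inner (m : KK n) (f g : HH n E) (h h') :
    inner ℂ g (wsh (E := E) m (fun _ => 1) 1 h f)
      = inner ℂ (wsh (E := E) (-m) (fun _ => 1) 1 h' g) f := by
  rw [lp.inner_eq_tsum, lp.inner_eq_tsum, ← (Equiv.addRight m).tsum_eq]
  simp [wsh_apply]

/-- self-adjointness of convolution by a conjugate-symmetric sequence -/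
theorem cop_selfadj [CompleteSpace E] (c : KK n → ℂ) (hsym : ∀ m, c (-m) = starRingEnd ℂ (c m))
    (hc : Summable fun m => ‖c m‖ * 1) (h) (f g : HH n E) :
    inner ℂ g (cop (E := E) c (fun _ _ => 1) (fun _ => 1) h f)
      = inner ℂ (cop (E := E) c (fun _ _ => 1) (fun _ => 1) h g) f := by
  have h1 := (cop_summable (E := E) c (fun _ _ => 1) (fun _ => 1) h hc).of_norm.hasSum
  have h2 := (h1.mapL (ContinuousLinearMap.apply ℂ (HH n E) f)).mapL (innerSL ℂ g)
  have h3 := ((h1.mapL (ContinuousLinearMap.apply ℂ (HH n E) g)).mapL (innerSL ℂ f)).star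
  rw [← (Equiv.neg (KK n)).hasSum_iff] at h3
  have h5 : (fun b => (innerSL ℂ g) (ContinuousLinearMap.apply ℂ (HH n E) f
      (c b • wsh (E := E) b (fun _ => 1) 1 (h b)))) = (fun b => star ((innerSL ℂ f)
      (ContinuousLinearMap.apply ℂ (HH n E) g (c b • wsh (E := E) b (fun _ => 1) 1 (h b)))))
      ∘ ⇑(Equiv.neg (KK n)) := by
    funext b
    simp only [Function.comp, Equiv.neg_apply, ContinuousLinearMap.apply_apply,
      ContinuousLinearMap.smul_apply, innerSL_apply_apply, inner_smul_right, hsym]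
    rw [wsh_inner b f g (h b) (h (-b))]
    simp [mul_comm]
  rw [h5] at h2
  have h4 := h2.unique h3
  simp only [innerSL_apply_apply, ContinuousLinearMap.apply_apply] at h4
  refine h4.trans ?_
  exact inner_conj_symm _ _

end opS
end HS

namespace HS
set_option linter.unusedSectionVars false

section coercive
variable {H : Type*} [NormedAddCommGroup H] [InnerProductSpace ℂ H] [CompleteSpace H] {n : ℕ}

def AA (Q P T : H →L[ℂ] H) (K C : Fin n → H →L[ℂ] H) : H →L[ℂ] H :=
  star Q * Q + star P * P + ∑ i, (star T * star (K i) - star P * C i) * (K i * T - C i * P)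

theorem AA_unit (Q P T : H →L[ℂ] H) (K C : Fin n → H →L[ℂ] H)
    (h1 : ∀ f, ‖f‖ ≤ ‖Q f‖ + ‖P f‖ + ‖T f‖) (h2 : ∀ f, ‖T f‖ ^ 2 ≤ ∑ i, ‖K i (T f)‖ ^ 2)
    (hC : ∀ i, star (C i) = C i) : IsUnit (AA Q P T K C) := by
  have hA : AA Q P T K C
      = star Q * Q + star P * P + ∑ i, star (K i * T - C i * P) * (K i * T - C i * P) := by
    simp [AA, hC]
  have hin : ∀ f, inner ℂ (AA Q P T K C f) f
      = ((‖Q f‖ ^ 2 + ‖P f‖ ^ 2 + ∑ i, ‖(K i * T - C i * P) f‖ ^ 2 : ℝ) : ℂ) := by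
    intro f
    have hX : ∀ X : H →L[ℂ] H, inner ℂ ((star X * X) f) f = ((‖X f‖ ^ 2 : ℝ) : ℂ) := by
      intro X
      rw [ContinuousLinearMap.mul_apply, ContinuousLinearMap.star_eq_adjoint,
        ContinuousLinearMap.adjoint_inner_left, inner_self_eq_norm_sq_to_K]
      simp
    rw [hA, add_apply, add_apply, ContinuousLinearMap.sum_apply, inner_add_left, inner_add_left,
      sum_inner]
    simp only [hX]
    push_cast
    rfl
  set M := 9 + 6 * ∑ i, ‖C i‖ ^ 2 with hM
  have hMpos : 0 < M := by positivity
  have key : ∀ f, ‖f‖ ^ 2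
      ≤ M * (‖Q f‖ ^ 2 + ‖P f‖ ^ 2 + ∑ i, ‖(K i * T - C i * P) f‖ ^ 2) := by
    intro f
    have e1 : ∀ i, ‖K i (T f)‖ ^ 2
        ≤ 2 * ‖(K i * T - C i * P) f‖ ^ 2 + 2 * (‖C i‖ ^ 2 * ‖P f‖ ^ 2) := by
      intro i
      have : K i (T f) = (K i * T - C i * P) f + C i (P f) := by simp
      have h3 : ‖K i (T f)‖ ≤ ‖(K i * T - C i * P) f‖ + ‖C i‖ * ‖P f‖ := by
        rw [this]
        exact (norm_add_le _ _).trans (by gcongr; exact (C i).le_opNorm _)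
      have h4 : 0 ≤ ‖K i (T f)‖ := norm_nonneg _
      nlinarith [sq_nonneg (‖(K i * T - C i * P) f‖ - ‖C i‖ * ‖P f‖)]
    have e2 := (h2 f).trans (Finset.sum_le_sum fun i _ => e1 i)
    rw [Finset.sum_add_distrib, ← Finset.mul_sum, ← Finset.mul_sum, ← Finset.sum_mul] at e2
    have e3 := h1 f
    have e4 : ‖f‖ ^ 2 ≤ 3 * ‖Q f‖ ^ 2 + 3 * ‖P f‖ ^ 2 + 3 * ‖T f‖ ^ 2 := by
      have := pow_le_pow_left₀ (norm_nonneg f) e3 2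
      nlinarith [sq_nonneg (‖P f‖ - ‖T f‖), sq_nonneg (‖P f‖ - ‖Q f‖), sq_nonneg (‖Q f‖ - ‖T f‖)]
    have e5 : 0 ≤ ∑ i, ‖C i‖ ^ 2 := by positivity
    have e6 : 0 ≤ ∑ i, ‖(K i * T - C i * P) f‖ ^ 2 := by positivity
    rw [hM]
    nlinarith [sq_nonneg (‖P f‖), sq_nonneg (‖Q f‖), mul_nonneg e5 e6,
      mul_nonneg e5 (sq_nonneg ‖Q f‖)]
  refine ContinuousLinearMap.isUnit_of_forall_le_norm_inner_map _ (c := Real.toNNReal M⁻¹)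
    (by rw [Real.toNNReal_pos]; positivity) ?_
  intro f
  rw [hin f, Complex.norm_real, Real.norm_of_nonneg (by positivity),
    Real.coe_toNNReal _ (by positivity)]
  rw [← div_eq_mul_inv, div_le_iff₀ hMpos, mul_comm]
  exact key f

theorem AA_unit_nhds (Q P T : H →L[ℂ] H) (K C : Fin n → H →L[ℂ] H)
    (hu : IsUnit (AA Q P T K C)) :
    ∃ δ > 0, ∀ C' : Fin n → H →L[ℂ] H, (∀ i, ‖C' i - C i‖ < δ) → IsUnit (AA Q P T K C') := by
  have hc : Continuous (fun C : Fin n → H →L[ℂ] H => AA Q P T K C) := by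
    unfold AA
    fun_prop
  have ho : IsOpen {C' | IsUnit (AA Q P T K C')} := Units.isOpen.preimage hc
  obtain ⟨δ, hδ, hb⟩ := Metric.isOpen_iff.1 ho C hu
  refine ⟨δ, hδ, fun C' h => hb ?_⟩
  rw [Metric.mem_ball, dist_pi_lt_iff hδ]
  intro i
  rw [dist_eq_norm]
  exact h i

end coercive

section RD
/-- rapid decay of sequences -/
def RD {n : ℕ} {E : Type*} [Norm E] (y : KK n → E) : Prop :=
  ∀ s : ℕ, ∃ C : ℝ, ∀ k, (1 + ‖k‖) ^ s * ‖y k‖ ≤ C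

theorem summable_int_base : Summable fun k : ℤ => ((1 + |(k:ℝ)|) ^ 2)⁻¹ := by
  have h : Summable fun k : ℕ => ((1 + |(k:ℝ)|) ^ 2)⁻¹ := by
    have := (summable_nat_add_iff 1).2 (Real.summable_nat_pow_inv (p := 2) |>.2 (by norm_num))
    refine this.congr (fun k => ?_)
    push_cast
    rw [abs_of_nonneg (by positivity), add_comm]
  refine Summable.of_nat_of_neg h ?_
  simpa using h

theorem summable_prod_base (n : ℕ) :
    Summable fun k : KK n => ∏ i, ((1 + |(k i:ℝ)|) ^ 2)⁻¹ := by
  induction n with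
  | zero => exact (hasSum_fintype _).summable
  | succ n ih =>
    have h := Summable.mul_of_nonneg summable_int_base ih (fun k => by simp; positivity)
      (fun k => by simp only [Pi.zero_apply]; positivity)
    rw [← (Fin.consEquiv (fun _ : Fin (n+1) => ℤ)).summable_iff]
    refine h.congr (fun p => ?_)
    simp [Fin.prod_univ_succ, Fin.consEquiv, mul_comm]

theorem summable_base (n : ℕ) : Summable fun k : KK n => ((1 + ‖k‖) ^ (2 * n))⁻¹ := by
  refine Summable.of_nonneg_of_le (fun k => by positivity) (fun k => ?_) (summable_prod_base n)
  rw [Finset.prod_inv_distrib]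
  apply inv_anti₀ (by positivity)
  calc ∏ i, (1 + |(k i:ℝ)|) ^ 2 ≤ ∏ i : Fin n, (1 + ‖k‖) ^ 2 := by
        gcongr with i
        have := norm_le_pi_norm k i
        simpa [Int.norm_eq_abs] using this
    _ = _ := by simp [pow_mul]

theorem RD.summable {n : ℕ} {E : Type*} [SeminormedAddCommGroup E] {y : KK n → E} (hy : RD y)
    (s : ℕ) : Summable fun k => (1 + ‖k‖) ^ s * ‖y k‖ := by
  obtain ⟨C, hC⟩ := hy (s + 2 * n)
  refine Summable.of_nonneg_of_le (fun k => by positivity) (fun k => ?_)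
    ((summable_base n).mul_left C)
  have h1 : 0 < (1 + ‖k‖) ^ (2 * n) := by positivity
  rw [← div_eq_mul_inv, le_div_iff₀ h1]
  refine le_trans (le_of_eq ?_) (hC k)
  rw [pow_add]; ring

theorem RD.summable_norm {n : ℕ} {E : Type*} [SeminormedAddCommGroup E] {y : KK n → E}
    (hy : RD y) : Summable fun k => ‖y k‖ := by
  simpa using hy.summable 0

theorem RD.nonneg_bound {n : ℕ} {E : Type*} [SeminormedAddCommGroup E] {y : KK n → E}
    (hy : RD y) (s : ℕ) : ∃ C : ℝ, 0 ≤ C ∧ ∀ k, (1 + ‖k‖) ^ s * ‖y k‖ ≤ C := by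
  obtain ⟨C, hC⟩ := hy s
  exact ⟨C, le_trans (by positivity) (hC 0), hC⟩

theorem RD.summable_wsq {n : ℕ} {E : Type*} [SeminormedAddCommGroup E] {y : KK n → E} (hy : RD y)
    (s : ℕ) : Summable fun k => ((1 + ‖k‖) ^ s * ‖y k‖) ^ 2 := by
  obtain ⟨C, hC⟩ := hy s
  refine Summable.of_nonneg_of_le (fun k => by positivity) (fun k => ?_)
    ((hy.summable s).mul_left C)
  rw [pow_two]
  gcongr
  exact hC k

end RD

section wt
variable {n : ℕ}
def wt (ε : ℝ) (s : ℕ) (k : KK n) : ℝ := (1 + ε * ‖k‖) ^ s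

theorem wt_pos {ε : ℝ} (hε : 0 ≤ ε) (s : ℕ) (k : KK n) : 0 < wt ε s k := by
  unfold wt; positivity

theorem one_le_wt {ε : ℝ} (hε : 0 ≤ ε) (s : ℕ) (k : KK n) : 1 ≤ wt ε s k :=
  one_le_pow₀ (by nlinarith [norm_nonneg k])

theorem wt_mul {ε : ℝ} (hε : 0 ≤ ε) (s : ℕ) (k m : KK n) :
    wt ε s (k + m) ≤ wt ε s k * wt ε s m := by
  unfold wt
  rw [← mul_pow]
  gcongr
  have := norm_add_le k m
  nlinarith [mul_nonneg (mul_nonneg hε (norm_nonneg k)) (mul_nonneg hε (norm_nonneg m)), mul_le_mul_of_nonneg_left this hε]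

theorem wt_sub_one {ε : ℝ} (hε : 0 ≤ ε) (hε1 : ε ≤ 1) (s : ℕ) (k : KK n) :
    wt ε s k - 1 ≤ ε * ((1 + ‖k‖) ^ s - 1) := by
  unfold wt
  induction s with
  | zero => simp
  | succ s ih =>
    have hA : 1 ≤ (1 + ‖k‖) ^ s := one_le_pow₀ (by simp)
    have hk := norm_nonneg k
    rw [pow_succ, pow_succ]
    set A := (1 + ‖k‖) ^ s
    set B := (1 + ε * ‖k‖) ^ s
    have h1 : 0 ≤ ε * ‖k‖ := by positivity
    have : B * (1 + ε * ‖k‖) ≤ (1 + ε * (A - 1)) * (1 + ε * ‖k‖) := by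
      gcongr; linarith
    nlinarith [mul_nonneg (mul_nonneg hε hk) (mul_nonneg (sub_nonneg.2 hA) (sub_nonneg.2 hε1))]

theorem wt_le {ε : ℝ} (hε : 0 ≤ ε) (hε1 : ε ≤ 1) (s : ℕ) (k : KK n) :
    wt ε s k ≤ (1 + ‖k‖) ^ s := by
  unfold wt
  gcongr
  nlinarith [norm_nonneg k]

theorem le_wt {ε : ℝ} (hε : 0 ≤ ε) (hε1 : ε ≤ 1) (s : ℕ) (k : KK n) :
    ε ^ s * (1 + ‖k‖) ^ s ≤ wt ε s k := by
  unfold wt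
  rw [← mul_pow]
  gcongr
  nlinarith [norm_nonneg k]

def rho (ε : ℝ) (s : ℕ) (m k : KK n) : ℝ := wt ε s k / wt ε s (k - m)

theorem rho_le {ε : ℝ} (hε : 0 ≤ ε) (s : ℕ) (m k : KK n) : rho ε s m k ≤ wt ε s m := by
  unfold rho
  rw [div_le_iff₀ (wt_pos hε _ _)]
  simpa using wt_mul hε s m (k - m)

theorem rho_pos {ε : ℝ} (hε : 0 ≤ ε) (s : ℕ) (m k : KK n) : 0 < rho ε s m k :=
  div_pos (wt_pos hε _ _) (wt_pos hε _ _)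

theorem rho_abs {ε : ℝ} (hε : 0 ≤ ε) (s : ℕ) (m k : KK n) : |rho ε s m k| ≤ wt ε s m := by
  rw [abs_of_pos (rho_pos hε s m k)]; exact rho_le hε s m k

theorem rho_sub_one {ε : ℝ} (hε : 0 ≤ ε) (s : ℕ) (m k : KK n) :
    |rho ε s m k - 1| ≤ wt ε s m - 1 := by
  have h1 := rho_le hε s m k
  have h2 : wt ε s (k - m) ≤ wt ε s k * wt ε s m := by
    have := wt_mul hε s k (-m)
    rw [← sub_eq_add_neg] at this
    simpa [wt] using this
  have h3 := wt_pos hε s (k - m)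
  have h4 : 1 ≤ rho ε s m k * wt ε s m := by
    unfold rho
    rw [div_mul_eq_mul_div, le_div_iff₀ h3]; linarith
  have h5 := one_le_wt hε s m
  have h6 := rho_pos hε s m k
  rw [abs_le]
  constructor
  · nlinarith [sq_nonneg (rho ε s m k - 1), sq_nonneg (wt ε s m - 1), sq_nonneg (rho ε s m k - wt ε s m)]
  · linarith
end wt

end HS

namespace HS
set_option linter.unusedSectionVars false

section abs
variable {n : ℕ} {E : Type*} [NormedAddCommGroup E] [InnerProductSpace ℂ E] [CompleteSpace E]

abbrev dg (A : KK n → E →L[ℂ] E) (M : ℝ) (hA : ∀ k, ‖A k‖ ≤ M) : HH n E →L[ℂ] HH n E :=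
  opS (Equiv.refl _) A M hA

theorem dg_star (A : KK n → E →L[ℂ] E) (M : ℝ) (hA : ∀ k, ‖A k‖ ≤ M) :
    star (dg A M hA) = dg (fun k => star (A k)) M (fun k => by rw [norm_star]; exact hA k) := by
  rw [ContinuousLinearMap.star_eq_adjoint]
  symm
  rw [ContinuousLinearMap.eq_adjoint_iff]
  intro f g
  rw [lp.inner_eq_tsum, lp.inner_eq_tsum]
  congr 1
  funext k
  simp [ContinuousLinearMap.star_eq_adjoint, ContinuousLinearMap.adjoint_inner_left]

theorem dg_star_inner (A : KK n → E →L[ℂ] E) (M : ℝ) (hA : ∀ k, ‖A k‖ ≤ M) (x : HH n E) (k : KK n)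
    (g : E) : inner ℂ (star (dg A M hA) x k) g = inner ℂ (x k) (A k g) := by
  rw [dg_star]
  simp [ContinuousLinearMap.star_eq_adjoint, ContinuousLinearMap.adjoint_inner_left]

def κ (i : Fin n) (k : KK n) : ℂ := 2 * Real.pi * Complex.I * (k i : ℂ)

theorem κ_norm (i : Fin n) (k : KK n) : ‖κ i k‖ = 2 * Real.pi * |(k i : ℝ)| := by
  simp [κ, abs_of_pos Real.pi_pos]

theorem abs_le_norm (i : Fin n) (k : KK n) : |(k i : ℝ)| ≤ ‖k‖ := by
  have := norm_le_pi_norm k i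
  simpa [Int.norm_eq_abs] using this

/-- κ_i(k)/‖k‖ -/
def kq (i : Fin n) (k : KK n) : ℂ := κ i k / (‖k‖ : ℂ)

theorem kq_norm_le (i : Fin n) (k : KK n) : ‖kq i k‖ ≤ 2 * Real.pi := by
  rw [kq, norm_div, κ_norm]
  rcases eq_or_ne k 0 with h | h
  · simp [h, Real.pi_pos.le]
  · have h' : 0 < ‖k‖ := norm_pos_iff.2 h
    rw [Complex.norm_real, norm_norm, div_le_iff₀ h']
    have := abs_le_norm i k
    have := Real.pi_pos
    gcongr

theorem kq_mul (i : Fin n) (k : KK n) : kq i k * (‖k‖ : ℂ) = κ i k := by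
  rcases eq_or_ne k 0 with h | h
  · simp [kq, h, κ]
  · have h' : (‖k‖ : ℂ) ≠ 0 := by exact_mod_cast (norm_pos_iff.2 h).ne'
    rw [kq, div_mul_cancel₀ _ h']

theorem kq_sum (k : KK n) (hk : k ≠ 0) : 1 ≤ ∑ i, ‖kq i k‖ ^ 2 := by
  have h' : 0 < ‖k‖ := norm_pos_iff.2 hk
  obtain ⟨i, hi⟩ : ∃ i, ‖k‖ = ‖k i‖ := by
    have hne : Nonempty (Fin n) := by
      by_contra h
      rw [not_nonempty_iff] at h
      exact hk (Subsingleton.elim _ _)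
    obtain ⟨i, -, hi⟩ := Finset.exists_mem_eq_sup Finset.univ Finset.univ_nonempty (fun b => ‖k b‖₊)
    refine ⟨i, ?_⟩
    rw [Pi.norm_def, hi]; rfl
  refine le_trans ?_ (Finset.single_le_sum (f := fun i => ‖kq i k‖ ^ 2) (fun i _ => by positivity)
    (Finset.mem_univ i))
  have : ‖kq i k‖ = 2 * Real.pi := by
    rw [kq, norm_div, κ_norm, Complex.norm_real, norm_norm, ← Int.norm_eq_abs, ← hi]
    field_simp
  rw [this]
  nlinarith [Real.pi_gt_three]

def KOp (i : Fin n) : HH n E →L[ℂ] HH n E :=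
  dg (fun k => kq i k • ContinuousLinearMap.id ℂ E) (2 * Real.pi) (fun k => by
    rw [norm_smul]
    exact (mul_le_of_le_one_right (norm_nonneg _) ContinuousLinearMap.norm_id_le).trans
      (kq_norm_le i k))

theorem KOp_apply (i : Fin n) (f : HH n E) (k) : KOp i f k = kq i k • f k := rfl

/-- inverse weight operator -/
def Winv (ε : ℝ) (hε : 0 ≤ ε) (s : ℕ) : HH n E →L[ℂ] HH n E :=
  dg (fun k => (((wt ε s k)⁻¹ : ℝ) : ℂ) • ContinuousLinearMap.id ℂ E) 1 (fun k => by
    rw [norm_smul]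
    refine (mul_le_of_le_one_right (norm_nonneg _) ContinuousLinearMap.norm_id_le).trans ?_
    rw [Complex.norm_real, Real.norm_of_nonneg (inv_nonneg.2 (wt_pos hε s k).le)]
    exact inv_le_one_of_one_le₀ (one_le_wt hε s k))

theorem Winv_apply (ε : ℝ) (hε : 0 ≤ ε) (s : ℕ) (f : HH n E) (k) :
    Winv ε hε s f k = (((wt ε s k)⁻¹ : ℝ) : ℂ) • f k := rfl

theorem Winv_dg (ε : ℝ) (hε : 0 ≤ ε) (s : ℕ) (A : KK n → E →L[ℂ] E) (M : ℝ)
    (hA : ∀ k, ‖A k‖ ≤ M) : Winv ε hε s * dg A M hA = dg A M hA * Winv ε hε s := by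
  ext f k
  simp [Winv_apply]

def CW (ε : ℝ) (hε : 0 ≤ ε) (s : ℕ) (c : KK n → ℂ) : HH n E →L[ℂ] HH n E :=
  cop c (rho ε s) (wt ε s) (rho_abs hε s)

def CC (c : KK n → ℂ) : HH n E →L[ℂ] HH n E :=
  cop c (fun _ _ => 1) (fun _ => 1) (fun _ _ => by simp)

theorem CC_apply (c : KK n → ℂ) (hc : RD c) (f : HH n E) (k : KK n) :
    HasSum (fun m => c m • f (k - m)) (CC (E := E) c f k) := by
  have := cop_apply (E := E) c (fun _ _ => 1) (fun _ => 1) (fun _ _ => by simp)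
    (by simpa using hc.summable_norm) f k
  unfold CC
  simpa using this

theorem CC_star (c : KK n → ℂ) (hsym : ∀ m, c (-m) = starRingEnd ℂ (c m)) (hc : RD c) :
    star (CC (E := E) c) = CC c := by
  rw [ContinuousLinearMap.star_eq_adjoint]
  symm
  rw [ContinuousLinearMap.eq_adjoint_iff]
  intro f g
  exact (cop_selfadj c hsym (by simpa using hc.summable_norm) (fun _ _ => by simp) g f).symm

theorem CW_summ (ε : ℝ) (hε : 0 ≤ ε) (hε1 : ε ≤ 1) (s : ℕ) (c : KK n → ℂ) (hc : RD c) :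
    Summable fun m => ‖c m‖ * wt ε s m := by
  refine Summable.of_nonneg_of_le (fun k => mul_nonneg (norm_nonneg _) (wt_pos hε s k).le)
    (fun k => ?_) (hc.summable s)
  rw [mul_comm]
  gcongr
  exact wt_le hε hε1 s k

theorem Winv_CW (ε : ℝ) (hε : 0 ≤ ε) (hε1 : ε ≤ 1) (s : ℕ) (c : KK n → ℂ) (hc : RD c) :
    Winv ε hε s * CW ε hε s c = CC (E := E) c * Winv ε hε s := by
  ext f k
  have h1 := (cop_apply (E := E) c (rho ε s) (wt ε s) (rho_abs hε s)
    (CW_summ ε hε hε1 s c hc) f k).const_smul ((((wt ε s k)⁻¹ : ℝ) : ℂ))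
  have h2 : HasSum _ ((CC (E := E) c * Winv ε hε s : HH n E →L[ℂ] HH n E) f k) := CC_apply c hc (Winv ε hε s f) k
  refine h1.unique ?_
  convert h2 using 2 with m
  rw [Winv_apply, smul_smul, smul_smul, smul_smul]
  congr 1
  unfold rho
  have := (wt_pos hε s k).ne'
  have := (wt_pos hε s (k - m)).ne'
  push_cast
  have : ((wt ε s k : ℝ) : ℂ) ≠ 0 := by exact_mod_cast (wt_pos hε s k).ne'
  field_simp

theorem CW_sub (ε : ℝ) (hε : 0 ≤ ε) (hε1 : ε ≤ 1) (s : ℕ) (c : KK n → ℂ) (hc : RD c) :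
    ‖CW (E := E) ε hε s c - CC c‖ ≤ ε * ∑' m, ‖c m‖ * (1 + ‖m‖) ^ s := by
  have hs0 : Summable fun m => ‖c m‖ * (1 + ‖m‖) ^ s := by
    simpa [mul_comm] using hc.summable s
  have hs : Summable fun m => ‖c m‖ * (wt ε s m - 1) := by
    have := (CW_summ ε hε hε1 s c hc).sub hc.summable_norm
    refine this.congr (fun m => by ring)
  have he : CW (E := E) ε hε s c - CC c
      = cop c (fun m k => rho ε s m k - 1) (fun m => wt ε s m - 1) (rho_sub_one hε s) := by
    ext f k
    have h1 := cop_apply (E := E) c (rho ε s) (wt ε s) (rho_abs hε s) (CW_summ ε hε hε1 s c hc) f k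
    have h2 := CC_apply c hc f k
    have h3 := cop_apply (E := E) c (fun m k => rho ε s m k - 1) (fun m => wt ε s m - 1)
      (rho_sub_one hε s) hs f k
    refine (h1.sub h2).unique ?_
    convert h3 using 2 with m
    rw [← smul_sub]
    congr 1
    push_cast
    rw [sub_smul, one_smul]
  rw [he]
  refine (cop_norm c _ _ _ hs).trans ?_
  rw [← tsum_mul_left]
  refine hs.tsum_le_tsum (fun m => ?_) (hs0.mul_left ε)
  have := wt_sub_one hε hε1 s m
  calc ‖c m‖ * (wt ε s m - 1) ≤ ‖c m‖ * (ε * ((1 + ‖m‖) ^ s - 1)) := by gcongr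
    _ ≤ ‖c m‖ * (ε * ((1 + ‖m‖) ^ s)) := by gcongr; linarith
    _ = _ := by ring

def mkHH (y : KK n → E) (hy : Summable fun k => ‖y k‖ ^ 2) : HH n E := ⟨y, memlp_of_summable_sq y hy⟩

def BB {H : Type*} [NormedAddCommGroup H] [InnerProductSpace ℂ H] [CompleteSpace H]
    (P T : H →L[ℂ] H) (K C : Fin n → H →L[ℂ] H) (y z : H) : H :=
  - (star P z + ∑ i, (star T * star (K i) - star P * C i) (K i y - C i z))

theorem abs_solve (c : Fin n → KK n → ℂ) (hc : ∀ i, RD (c i))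
    (hsym : ∀ i m, c i (-m) = starRingEnd ℂ (c i m))
    (Q P T : KK n → E →L[ℂ] E) (hQ : ∀ k, ‖Q k‖ ≤ 1) (hP : ∀ k, ‖P k‖ ≤ 1) (hT : ∀ k, ‖T k‖ ≤ 1)
    (hT0 : T 0 = 0)
    (hco : ∀ k f, ‖f‖ ^ 2 ≤ ‖Q k f‖ ^ 2 + ‖P k f‖ ^ 2 + ‖T k f‖ ^ 2)
    (Y0 Z0 : KK n → E) (hY0 : RD Y0) (hZ0 : RD Z0) :
    ∃ f : KK n → E, RD f ∧ ∃ X0 Y : KK n → E, ∃ X : Fin n → KK n → E, ∃ q : KK n → E,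
      (∀ k, X0 k = P k (f k) + Z0 k) ∧ (∀ k, Y k = T k (f k) + Y0 k) ∧
      (∀ i k, HasSum (fun m => c i m • X0 (k - m)) (kq i k • Y k - X i k)) ∧
      (∀ k, ∃ r : Fin n → E, (∀ i, HasSum (fun m => c i m • X i (k - m)) (r i)) ∧
        q k = X0 k - ∑ i, r i) ∧
      (∀ k g, Q k g = 0 → inner ℂ (q k) (P k g) + ∑ i, inner ℂ (X i k) (kq i k • T k g) = 0) := by
  set Q' : HH n E →L[ℂ] HH n E := dg Q 1 hQ
  set P' : HH n E →L[ℂ] HH n E := dg P 1 hP with hP'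
  set T' : HH n E →L[ℂ] HH n E := dg T 1 hT with hT'
  set K' : Fin n → HH n E →L[ℂ] HH n E := fun i => KOp i
  set C' : Fin n → HH n E →L[ℂ] HH n E := fun i => CC (c i)
  have hs : ∀ y : KK n → E, RD y → Summable fun k => ‖y k‖ ^ 2 := by
    intro y hy; simpa using hy.summable_wsq 0
  set y0 : HH n E := mkHH Y0 (hs _ hY0) with hy0
  set z0 : HH n E := mkHH Z0 (hs _ hZ0) with hz0
  have hu : IsUnit (AA Q' P' T' K' C') := by
    apply AA_unit
    · intro f
      have h1 : ‖f‖ ^ 2 ≤ ‖Q' f‖ ^ 2 + ‖P' f‖ ^ 2 + ‖T' f‖ ^ 2 := by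
        rw [norm_sq_eq, norm_sq_eq, norm_sq_eq, norm_sq_eq, ← (summable_sq _).tsum_add (summable_sq _),
          ← ((summable_sq _).add (summable_sq _)).tsum_add (summable_sq _)]
        exact (summable_sq f).tsum_le_tsum (fun k => hco k (f k))
          (((summable_sq _).add (summable_sq _)).add (summable_sq _))
      apply le_of_sq_le_sq _ (by positivity)
      nlinarith [norm_nonneg (Q' f), norm_nonneg (P' f), norm_nonneg (T' f),
        mul_nonneg (norm_nonneg (Q' f)) (norm_nonneg (P' f)),
        mul_nonneg (norm_nonneg (Q' f)) (norm_nonneg (T' f)),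
        mul_nonneg (norm_nonneg (P' f)) (norm_nonneg (T' f))]
    · intro f
      simp_rw [norm_sq_eq]
      rw [← Summable.tsum_finsetSum (fun i _ => summable_sq _)]
      refine (summable_sq _).tsum_le_tsum (fun k => ?_) (summable_sum fun i _ => summable_sq _)
      have : ∀ i, ‖K' i (T' f) k‖ ^ 2 = ‖kq i k‖ ^ 2 * ‖T' f k‖ ^ 2 := by
        intro i
        rw [← mul_pow, ← norm_smul]; rfl
      simp_rw [this]
      rw [← Finset.sum_mul]
      rcases eq_or_ne k 0 with rfl | hk
      · have : T' f 0 = 0 := by simp [hT', hT0]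
        simp [this]
      · exact le_mul_of_one_le_left (by positivity) (kq_sum k hk)
    · intro i
      exact CC_star _ (hsym i) (hc i)
  have hinj : ∀ x y, AA Q' P' T' K' C' x = AA Q' P' T' K' C' y → x = y := by
    obtain ⟨u, hu⟩ := hu
    intro x y h
    rw [← hu] at h
    have := congrArg (fun z => (↑u⁻¹ : HH n E →L[ℂ] HH n E) z) h
    simpa [← ContinuousLinearMap.mul_apply] using this
  have hsur : ∀ (C : Fin n → HH n E →L[ℂ] HH n E), IsUnit (AA Q' P' T' K' C) →
      ∀ b, ∃ x, AA Q' P' T' K' C x = b := by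
    rintro C ⟨u, hu⟩ b
    refine ⟨(↑u⁻¹ : HH n E →L[ℂ] HH n E) b, ?_⟩
    rw [← hu, ← ContinuousLinearMap.mul_apply]
    simp
  obtain ⟨δ, hδ, hnh⟩ := AA_unit_nhds Q' P' T' K' C' hu
  obtain ⟨f, hf⟩ := hsur C' hu (BB P' T' K' C' y0 z0)
  have hRD : RD (fun k => f k) := by
    intro s
    set S : ℝ := ∑ i, ∑' m, ‖c i m‖ * (1 + ‖m‖) ^ s
    have hSi : ∀ i, ∑' m, ‖c i m‖ * (1 + ‖m‖) ^ s ≤ S := fun i =>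
      Finset.single_le_sum (f := fun i => ∑' m, ‖c i m‖ * (1 + ‖m‖) ^ s)
        (fun i _ => tsum_nonneg fun m => by positivity) (Finset.mem_univ i)
    have hS : 0 ≤ S := Finset.sum_nonneg fun i _ => tsum_nonneg fun m => by positivity
    obtain ⟨ε, hε0, hε1, hεS⟩ : ∃ ε : ℝ, 0 < ε ∧ ε ≤ 1 ∧ ε * S < δ := by
      refine ⟨min 1 (δ / (2 * (S + 1))), by positivity, min_le_left _ _, ?_⟩
      calc min 1 (δ / (2 * (S + 1))) * S ≤ (δ / (2 * (S + 1))) * (S + 1) := by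
            gcongr
            · exact min_le_right _ _
            · linarith
        _ = δ / 2 := by field_simp
        _ < δ := by linarith
    have hε := hε0.le
    set Cw : Fin n → HH n E →L[ℂ] HH n E := fun i => CW ε hε s (c i)
    have huw : IsUnit (AA Q' P' T' K' Cw) := by
      apply hnh
      intro i
      refine lt_of_le_of_lt (CW_sub ε hε hε1 s (c i) (hc i)) (lt_of_le_of_lt ?_ hεS)
      gcongr
      exact hSi i
    have hws : ∀ y : KK n → E, RD y → Summable fun k => ‖((wt ε s k : ℝ) : ℂ) • y k‖ ^ 2 := by
      intro y hy
      refine Summable.of_nonneg_of_le (fun k => by positivity) (fun k => ?_) (hy.summable_wsq s)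
      rw [norm_smul, Complex.norm_real, Real.norm_of_nonneg (wt_pos hε s k).le]
      have := (wt_pos hε s k).le
      gcongr
      exact wt_le hε hε1 s k
    set yw : HH n E := mkHH _ (hws _ hY0) with hyw
    set zw : HH n E := mkHH _ (hws _ hZ0) with hzw
    have hWm : ∀ (y : KK n → E) (hy : RD y), Winv ε hε s (mkHH _ (hws y hy)) = mkHH y (hs y hy) := by
      intro y hy
      ext k
      have : ((wt ε s k : ℝ) : ℂ) ≠ 0 := by exact_mod_cast (wt_pos hε s k).ne'
      change (((wt ε s k)⁻¹ : ℝ) : ℂ) • ((wt ε s k : ℝ) : ℂ) • y k = y k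
      rw [smul_smul]
      push_cast
      rw [inv_mul_cancel₀ this, one_smul]
    obtain ⟨g, hg⟩ := hsur Cw huw (BB P' T' K' Cw yw zw)
    set W := Winv (n := n) (E := E) ε hε s with hW
    have cQ : Commute W Q' := Winv_dg ε hε s _ _ _
    have cP : Commute W P' := Winv_dg ε hε s _ _ _
    have cT : Commute W T' := Winv_dg ε hε s _ _ _
    have cK : ∀ i, Commute W (K' i) := fun i => by
      change Commute W (KOp i); unfold KOp; exact Winv_dg ε hε s _ _ _
    have cQs : Commute W (star Q') := by rw [dg_star]; exact Winv_dg ε hε s _ _ _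
    have cPs : Commute W (star P') := by rw [hP', dg_star]; exact Winv_dg ε hε s _ _ _
    have cTs : Commute W (star T') := by rw [hT', dg_star]; exact Winv_dg ε hε s _ _ _
    have cKs : ∀ i, Commute W (star (K' i)) := fun i => by
      change Commute W (star (KOp i)); unfold KOp; rw [dg_star]; exact Winv_dg ε hε s _ _ _
    have cC : ∀ i, SemiconjBy W (Cw i) (C' i) := fun i => Winv_CW ε hε hε1 s (c i) (hc i)
    have cL : ∀ i, SemiconjBy W (star T' * star (K' i) - star P' * Cw i)
        (star T' * star (K' i) - star P' * C' i) := fun i =>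
      SemiconjBy.sub_right (SemiconjBy.mul_right cTs (cKs i)) (SemiconjBy.mul_right cPs (cC i))
    have cR : ∀ i, SemiconjBy W (K' i * T' - Cw i * P') (K' i * T' - C' i * P') := fun i =>
      SemiconjBy.sub_right (SemiconjBy.mul_right (cK i) cT) (SemiconjBy.mul_right (cC i) cP)
    have cA : SemiconjBy W (AA Q' P' T' K' Cw) (AA Q' P' T' K' C') := by
      unfold AA
      refine SemiconjBy.add_right (SemiconjBy.add_right (SemiconjBy.mul_right cQs cQ)
        (SemiconjBy.mul_right cPs cP)) ?_
      unfold SemiconjBy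
      rw [Finset.mul_sum, Finset.sum_mul]
      exact Finset.sum_congr rfl fun i _ => (SemiconjBy.mul_right (cL i) (cR i))
    have ap : ∀ {A B : HH n E →L[ℂ] HH n E}, SemiconjBy W A B → ∀ x, W (A x) = B (W x) := by
      intro A B h x
      exact congrArg (fun Z : HH n E →L[ℂ] HH n E => Z x) h
    have hb : W (BB P' T' K' Cw yw zw) = BB P' T' K' C' y0 z0 := by
      unfold BB
      rw [map_neg, map_add, map_sum, ap cPs, hzw, hWm _ hZ0]
      congr 2
      refine Finset.sum_congr rfl fun i _ => ?_
      rw [ap (cL i), map_sub, ap (cK i), ap (cC i), hWm _ hZ0, hyw, hWm _ hY0]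
    have hWg : W g = f := by
      apply hinj
      rw [← ap cA, hg, hb, hf]
    refine ⟨‖g‖ / ε ^ s, fun k => ?_⟩
    have h1 : ‖f k‖ = (wt ε s k)⁻¹ * ‖g k‖ := by
      rw [← hWg, hW, Winv_apply, norm_smul, Complex.norm_real,
        Real.norm_of_nonneg (inv_nonneg.2 (wt_pos hε s k).le)]
    have h2 : ‖g k‖ ≤ ‖g‖ := lp.norm_apply_le_norm (by norm_num) g k
    have h3 := le_wt hε hε1 s k
    have h4 := wt_pos hε s k
    rw [h1, le_div_iff₀ (by positivity)]
    calc (1 + ‖k‖) ^ s * ((wt ε s k)⁻¹ * ‖g k‖) * ε ^ s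
        = (ε ^ s * (1 + ‖k‖) ^ s) * (wt ε s k)⁻¹ * ‖g k‖ := by ring
      _ ≤ wt ε s k * (wt ε s k)⁻¹ * ‖g‖ := by gcongr
      _ = ‖g‖ := by rw [mul_inv_cancel₀ h4.ne', one_mul]
  set X0 : HH n E := P' f + z0
  set Y : HH n E := T' f + y0
  set X : Fin n → HH n E := fun i => K' i Y - C' i X0
  have heq : star P' (X0 - ∑ i, C' i (X i)) + ∑ i, star T' (star (K' i) (X i)) + star Q' (Q' f) = 0 := by
    have h1 : star P' (X0 - ∑ i, C' i (X i)) + ∑ i, star T' (star (K' i) (X i)) + star Q' (Q' f)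
        = AA Q' P' T' K' C' f - BB P' T' K' C' y0 z0 := by
      have e1 : ∀ i, X i = (K' i * T' - C' i * P') f + (K' i y0 - C' i z0) := by
        intro i
        simp only [X, Y, X0, map_add, ContinuousLinearMap.sub_apply, ContinuousLinearMap.mul_apply]
        abel
      have e2 : ∀ i, star T' (star (K' i) (X i)) - star P' (C' i (X i))
          = ((star T' * star (K' i) - star P' * C' i) * (K' i * T' - C' i * P')) f
            + (star T' * star (K' i) - star P' * C' i) (K' i y0 - C' i z0) := by
        intro i
        rw [e1 i, ContinuousLinearMap.mul_apply, ← map_add]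
        simp only [ContinuousLinearMap.sub_apply, ContinuousLinearMap.mul_apply]
      unfold AA BB
      rw [ContinuousLinearMap.add_apply, ContinuousLinearMap.add_apply, ContinuousLinearMap.sum_apply,
        sub_neg_eq_add]
      have e3 := Finset.sum_congr (s₁ := Finset.univ) rfl fun i (_ : i ∈ Finset.univ) => e2 i
      rw [Finset.sum_add_distrib, Finset.sum_sub_distrib] at e3
      rw [map_sub, map_sum, map_add, ContinuousLinearMap.mul_apply, ContinuousLinearMap.mul_apply]
      rw [← sub_eq_zero] at e3 ⊢
      rw [← e3]
      abel
    rw [h1, hf, sub_self]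
  refine ⟨fun k => f k, hRD, fun k => X0 k, fun k => Y k, fun i k => X i k,
    fun k => (X0 - ∑ i, C' i (X i)) k, fun k => rfl, fun k => rfl, ?_, ?_, ?_⟩
  · intro i k
    have h1 := CC_apply (c i) (hc i) X0 k
    convert h1 using 1
    change kq i k • Y k - (kq i k • Y k - C' i X0 k) = _
    rw [sub_sub_cancel]
  · intro k
    refine ⟨fun i => C' i (X i) k, fun i => CC_apply (c i) (hc i) (X i) k, ?_⟩
    simp only [lp.coeFn_sub, lp.coeFn_sum, Pi.sub_apply]
    congr 1
    exact Finset.sum_apply k _ _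
  · intro k g hg
    have h1 := congrArg (fun z : HH n E => inner ℂ (z k) g) heq
    simp only [lp.coeFn_add, Pi.add_apply, inner_add_left, lp.coeFn_zero,
      Pi.zero_apply, inner_zero_left, lp.coeFn_sum, Finset.sum_apply, sum_inner] at h1
    rw [dg_star_inner, dg_star_inner, hg, inner_zero_right, add_zero] at h1
    rw [← h1]
    congr 1
    refine Finset.sum_congr rfl fun i _ => ?_
    rw [dg_star_inner]
    change _ = inner ℂ (star (KOp i) (X i) k) _
    unfold KOp
    rw [dg_star_inner]
    rfl
end abs
end HS

namespace HS
set_option linter.unusedSectionVars false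

/-! ### Part D: the half line L² space -/

abbrev μ0 : Measure ℝ := volume.restrict (Set.Iic (0:ℝ))
abbrev EE := Lp ℂ 2 μ0

theorem ind_fin (a b : ℝ) : μ0 (Set.Ioc a b) ≠ ⊤ := by
  have : μ0 (Set.Ioc a b) ≤ volume (Set.Ioc a b) := Measure.restrict_apply_le _ _
  exact ne_top_of_le_ne_top (by simp) this

def ind (a b : ℝ) : EE := indicatorConstLp 2 (measurableSet_Ioc (a := a) (b := b)) (ind_fin a b) (1:ℂ)

def J (a b : ℝ) (f : EE) : ℂ := inner ℂ (ind a b) f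

theorem J_eq {a b : ℝ} (hab : a ≤ b) (hb : b ≤ 0) (f : EE) : J a b f = ∫ z in a..b, f z := by
  unfold J ind
  rw [L2.inner_indicatorConstLp_one, intervalIntegral.integral_of_le hab,
    Measure.restrict_restrict measurableSet_Ioc]
  congr 2
  ext z; simp only [Set.mem_inter_iff, Set.mem_Ioc, Set.mem_Iic]
  constructor
  · exact fun h => h.1
  · exact fun h => ⟨h, h.2.trans hb⟩

theorem ind_add {a b c : ℝ} (hab : a ≤ b) (hbc : b ≤ c) : ind a b + ind b c = ind a c := by
  unfold ind
  have h := indicatorConstLp_disjoint_union (p := 2) (μ := μ0) (measurableSet_Ioc (a := a) (b := b))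
    (measurableSet_Ioc (a := b) (b := c)) (ind_fin a b) (ind_fin b c)
    (Set.Ioc_disjoint_Ioc_of_le le_rfl) (1:ℂ)
  rw [← h]
  congr 1
  exact Set.Ioc_union_Ioc_eq_Ioc hab hbc

theorem ind_pos {z : ℝ} (hz : 0 ≤ z) : ind z 0 = 0 := by
  have h1 : ‖ind z 0‖ = 0 := by
    unfold ind
    rw [norm_indicatorConstLp (by norm_num) (by norm_num)]
    rw [Set.Ioc_eq_empty (by simpa using hz)]
    simp
  exact norm_eq_zero.1 h1

theorem ind_norm_sq {a b : ℝ} (hab : a ≤ b) (hb : b ≤ 0) : ‖ind a b‖ = Real.sqrt (b - a) := by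
  unfold ind
  rw [norm_indicatorConstLp (by norm_num) (by norm_num), Real.sqrt_eq_rpow]
  rw [measureReal_restrict_apply measurableSet_Ioc,
    Set.inter_eq_left.2 (fun z hz => hz.2.trans hb), Real.volume_real_Ioc_of_le hab]
  simp

theorem ind_dist (z z' : ℝ) (h : z ≤ z') : ‖ind z 0 - ind z' 0‖ ≤ Real.sqrt |z' - z| := by
  rcases le_total 0 z with hz | hz
  · rw [ind_pos hz, ind_pos (hz.trans h)]; simp
  rcases le_total 0 z' with hz' | hz'
  · rw [ind_pos hz', sub_zero, ind_norm_sq hz le_rfl]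
    apply Real.sqrt_le_sqrt
    rw [abs_of_nonneg (by linarith)]; linarith
  · rw [← ind_add h hz', add_sub_cancel_right, ind_norm_sq h hz']
    exact Real.sqrt_le_sqrt (le_abs_self _)

theorem ind_cont : Continuous fun z => ind z 0 := by
  rw [continuous_iff_continuousAt]
  intro z
  rw [ContinuousAt, tendsto_iff_norm_sub_tendsto_zero]
  have h1 : Filter.Tendsto (fun x : ℝ => Real.sqrt |x - z|) (nhds z) (nhds 0) := by
    have : Continuous fun x : ℝ => Real.sqrt |x - z| := by fun_prop
    simpa using this.tendsto z
  refine squeeze_zero (fun _ => norm_nonneg _) (fun x => ?_) h1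
  rcases le_total z x with h | h
  · rw [norm_sub_rev]; exact ind_dist z x h
  · rw [abs_sub_comm]; exact ind_dist x z h

theorem J_cont (f : EE) : Continuous fun z => J z 0 f := by
  unfold J
  exact ind_cont.inner continuous_const

theorem J_pos (f : EE) {z : ℝ} (hz : 0 ≤ z) : J z 0 f = 0 := by simp [J, ind_pos hz]

theorem J_norm_le {a b : ℝ} (hab : a ≤ b) (hb : b ≤ 0) (f : EE) :
    ‖J a b f‖ ≤ Real.sqrt (b - a) * ‖f‖ := by
  rw [← ind_norm_sq hab hb]; exact norm_inner_le_norm _ _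

theorem J_add {a b c : ℝ} (hab : a ≤ b) (hbc : b ≤ c) (f : EE) : J a b f + J b c f = J a c f := by
  unfold J; rw [← inner_add_left, ind_add hab hbc]

def ω (a b : ℝ) : EE := ∫ z in a..b, ind z 0

theorem inner_ω (a b : ℝ) (f : EE) : inner ℂ f (ω a b) = ∫ z in a..b, inner ℂ f (ind z 0) := by
  have := (innerSL ℂ f).intervalIntegral_comp_comm (ind_cont.intervalIntegrable (μ := volume) a b)
  unfold ω
  simpa using this.symm

theorem ω_inner (a b : ℝ) (f : EE) : inner ℂ (ω a b) f = ∫ z in a..b, J z 0 f := by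
  rw [← inner_conj_symm, inner_ω]
  have h := Complex.conjLIE.toLinearIsometry.intervalIntegral_comp_comm (μ := volume) (a := a) (b := b)
    (fun z => inner ℂ f (ind z 0))
  refine h.symm.trans ?_
  change ∫ z in a..b, starRingEnd ℂ (inner ℂ f (ind z 0)) = _
  simp only [J, inner_conj_symm]

theorem J_ind {a b z : ℝ} (hab : a ≤ b) (hb : b ≤ 0) :
    J a b (ind z 0) = ((max (b - z) 0 - max (a - z) 0 : ℝ) : ℂ) := by
  unfold J ind
  rw [L2.inner_indicatorConstLp_one_indicatorConstLp_one (hμs := ind_fin _ _) (hμt := ind_fin _ _)]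
  rw [measureReal_restrict_apply (measurableSet_Ioc.inter measurableSet_Ioc)]
  have : (Set.Ioc a b ∩ Set.Ioc z 0) ∩ Set.Iic 0 = Set.Ioc (max a z) b := by
    ext w; simp only [Set.mem_inter_iff, Set.mem_Ioc, Set.mem_Iic, max_lt_iff]
    constructor
    · rintro ⟨⟨h1, h2⟩, h3⟩; exact ⟨⟨h1.1, h2.1⟩, h1.2⟩
    · rintro ⟨h1, h2⟩; exact ⟨⟨⟨h1.1, h2⟩, h1.2, h2.trans hb⟩, h2.trans hb⟩
  rw [this, Real.volume_real_Ioc]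
  have e : max (b - max a z) 0 = max (b - z) 0 - max (a - z) 0 := by
    rcases le_total a z with h1 | h1
    · rw [max_eq_right h1, max_eq_right (show a - z ≤ 0 by linarith), sub_zero]
    · rw [max_eq_left h1, max_eq_left (show 0 ≤ a - z by linarith),
        max_eq_left (show 0 ≤ b - z by linarith), max_eq_left (show 0 ≤ b - a by linarith)]
      ring
  rw [e]; rfl

theorem hasDeriv_sq (c z : ℝ) :
    HasDerivAt (fun z => -(max (c - z) 0)^2/2) (max (c - z) 0) z := by
  rcases lt_trichotomy z c with h | h | h
  · have h1 : HasDerivAt (fun z => -(c - z)^2/2) (c - z) z := by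
      have := ((((hasDerivAt_id z).const_sub c).pow 2).neg).div_const 2
      refine this.congr_deriv ?_
      change -(((2:ℕ):ℝ) * (c - z) ^ (2 - 1) * -1) / 2 = c - z
      norm_num
    rw [max_eq_left (by linarith)]
    refine h1.congr_of_eventuallyEq ?_
    filter_upwards [Iio_mem_nhds h] with w hw
    rw [max_eq_left (by linarith [show w < c from hw])]
  · subst h
    simp only [sub_self, max_self]
    rw [hasDerivAt_iff_isLittleO]
    have : (fun x' : ℝ => -(max (z - x') 0)^2/2 - -(max (z - z) 0)^2/2 - (x' - z) • (0:ℝ))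
        =O[nhds z] fun x' => (x' - z) ^ 2 := by
      apply Asymptotics.IsBigO.of_bound 1
      filter_upwards with w
      simp only [sub_self, max_self, smul_zero, sub_zero]
      rw [Real.norm_eq_abs, Real.norm_eq_abs, abs_of_nonneg (sq_nonneg (w - z))]
      rcases le_total (z - w) 0 with h1 | h1
      · rw [max_eq_right h1]; simp; positivity
      · rw [max_eq_left h1]
        rw [abs_le]; constructor <;> nlinarith [sq_nonneg (z - w)]
    refine this.trans_isLittleO ?_
    have h2 := Asymptotics.isLittleO_pow_sub_sub z (m := 2) (by norm_num)
    simpa using h2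
  · rw [max_eq_right (by linarith)]
    refine (hasDerivAt_const z (0:ℝ)).congr_of_eventuallyEq ?_
    filter_upwards [Ioi_mem_nhds h] with w hw
    rw [max_eq_right (by linarith [show c < w from hw])]
    simp

def ZZ (a' b' a b : ℝ) : ℝ :=
  ((max (b' - a) 0)^2 - (max (b' - b) 0)^2 - (max (a' - a) 0)^2 + (max (a' - b) 0)^2)/2

theorem ZZ_symm (a' b' a b : ℝ) : ZZ a' b' a b + ZZ a b a' b' = (b - a) * (b' - a') := by
  have h : ∀ t s : ℝ, (max (t - s) 0)^2 + (max (s - t) 0)^2 = (t - s)^2 := by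
    intro t s
    rcases le_total t s with h | h
    · rw [max_eq_right (by linarith), max_eq_left (by linarith)]; ring
    · rw [max_eq_left (by linarith), max_eq_right (by linarith)]; ring
  unfold ZZ
  linear_combination (h b' a)/2 - (h b' b)/2 - (h a' a)/2 + (h a' b)/2

theorem J_ω {a' b' a b : ℝ} (hab' : a' ≤ b') (hb' : b' ≤ 0) :
    J a' b' (ω a b) = (ZZ a' b' a b : ℂ) := by
  unfold J
  rw [inner_ω]
  have h1 : ∀ z, inner ℂ (ind a' b') (ind z 0) = ((max (b' - z) 0 - max (a' - z) 0 : ℝ) : ℂ) :=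
    fun z => J_ind hab' hb'
  simp only [h1]
  rw [intervalIntegral.integral_ofReal]
  congr 1
  rw [intervalIntegral.integral_eq_sub_of_hasDerivAt
    (f := fun z => -(max (b' - z) 0)^2/2 - -(max (a' - z) 0)^2/2)]
  · unfold ZZ; ring
  · intro z _
    exact (hasDeriv_sq b' z).sub (hasDeriv_sq a' z)
  · apply Continuous.intervalIntegrable; fun_prop

theorem ω_ind {a' b' a b : ℝ} (hab : a ≤ b) (hb : b ≤ 0) :
    inner ℂ (ω a' b') (ind a b) = (ZZ a b a' b' : ℂ) := by
  rw [← inner_conj_symm]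
  have := J_ω (a := a') (b := b') hab hb
  unfold J at this
  rw [this, Complex.conj_ofReal]

/-- identification of an L² class by its integrals -/
theorem ae_of_J (f : EE) (g : ℝ → ℂ) (hg : Continuous g)
    (h : ∀ a b, a ≤ b → b ≤ 0 → J a b f = ∫ z in a..b, g z) : f =ᵐ[μ0] g := by
  have hf1 : LocallyIntegrable ((Set.Iic (0:ℝ)).indicator f) volume := by
    have h1 : MemLp ((Set.Iic (0:ℝ)).indicator f) 2 volume :=
      (memLp_indicator_iff_restrict measurableSet_Iic).2 (Lp.memLp f)
    exact h1.locallyIntegrable (by norm_num)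
  have hd := LocallyIntegrable.ae_hasDerivAt_integral hf1
  have h0 : ∀ᵐ z : ℝ, z ≠ 0 := by simp [ae_iff, measure_singleton]
  rw [Filter.EventuallyEq, ae_restrict_iff' measurableSet_Iic]
  filter_upwards [hd, h0] with z hz hz0 hz1
  have hz2 : z < 0 := lt_of_le_of_ne hz1 hz0
  have e1 : (Set.Iic (0:ℝ)).indicator f z = f z := Set.indicator_of_mem hz1 _
  have d1 := hz (z - 1)
  rw [e1] at d1
  have d2 : HasDerivAt (fun x => ∫ t in (z-1)..x, g t) (g z) z :=
    intervalIntegral.integral_hasDerivAt_right (hg.intervalIntegrable _ _)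
      (hg.stronglyMeasurableAtFilter _ _) hg.continuousAt
  have e2 : (fun x => ∫ t in (z-1)..x, (Set.Iic (0:ℝ)).indicator f t) =ᶠ[nhds z]
      fun x => ∫ t in (z-1)..x, g t := by
    filter_upwards [Ioo_mem_nhds (show z - 1 < z by linarith) hz2] with x hx
    rw [← h _ _ hx.1.le hx.2.le, J_eq hx.1.le hx.2.le]
    apply intervalIntegral.integral_congr
    intro t ht
    rw [Set.uIcc_of_le hx.1.le] at ht
    exact Set.indicator_of_mem (show t ∈ Set.Iic (0:ℝ) from ht.2.trans hx.2.le) _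
  exact (d1.congr_of_eventuallyEq e2.symm).unique d2

theorem J_ext (f : EE) (h : ∀ a b, a ≤ b → b ≤ 0 → J a b f = 0) : f = 0 := by
  have := ae_of_J f (fun _ => 0) continuous_const (fun a b h1 h2 => by simp [h a b h1 h2])
  exact Lp.eq_zero_iff_ae_eq_zero.2 this

end HS

namespace HS
set_option linter.unusedSectionVars false

/-! ### Part E: convolutions and the L² solution -/

section conv
variable {n : ℕ} {E : Type*} [NormedAddCommGroup E] [NormedSpace ℂ E] [CompleteSpace E]

def cM (c : KK n → ℂ) (s : ℕ) : ℝ := ∑' m, (1 + ‖m‖) ^ s * ‖c m‖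

theorem cM_nonneg (c : KK n → ℂ) (s : ℕ) : 0 ≤ cM c s := tsum_nonneg fun m => by positivity

/-- bound -/
def bd (s : ℕ) (B : ℝ) (y : KK n → E) : Prop := ∀ k, (1 + ‖k‖) ^ s * ‖y k‖ ≤ B

def cv (c : KK n → ℂ) (y : KK n → E) (k : KK n) : E := ∑' m, c m • y (k - m)

theorem conv_term (c : KK n → ℂ) (s : ℕ) {B : ℝ} {y : KK n → E} (hy : bd s B y) (k m : KK n) :
    (1 + ‖k‖) ^ s * ‖c m • y (k - m)‖ ≤ ((1 + ‖m‖) ^ s * ‖c m‖) * B := by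
  have h1 := wt_mul (ε := 1) zero_le_one s m (k - m)
  simp only [wt, one_mul, add_sub_cancel] at h1
  have h2 := hy (k - m)
  rw [norm_smul]
  calc (1 + ‖k‖) ^ s * (‖c m‖ * ‖y (k - m)‖)
      ≤ ((1 + ‖m‖) ^ s * (1 + ‖k - m‖) ^ s) * (‖c m‖ * ‖y (k - m)‖) := by gcongr
    _ = ((1 + ‖m‖) ^ s * ‖c m‖) * ((1 + ‖k - m‖) ^ s * ‖y (k - m)‖) := by ring
    _ ≤ _ := by gcongr

theorem cv_summable {c : KK n → ℂ} (hc : RD c) {B : ℝ} {y : KK n → E} (hy : ∀ k, ‖y k‖ ≤ B)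
    (k : KK n) : Summable fun m => c m • y (k - m) := by
  apply Summable.of_norm_bounded (hc.summable_norm.mul_right B)
  intro m
  rw [norm_smul]; gcongr; exact hy _

theorem cv_hasSum {c : KK n → ℂ} (hc : RD c) {B : ℝ} {y : KK n → E} (hy : ∀ k, ‖y k‖ ≤ B)
    (k : KK n) : HasSum (fun m => c m • y (k - m)) (cv c y k) := (cv_summable hc hy k).hasSum

theorem bd.le {s : ℕ} {B : ℝ} {y : KK n → E} (hy : bd s B y) (k : KK n) : ‖y k‖ ≤ B := by
  refine le_trans ?_ (hy k)
  have : (1:ℝ) ≤ (1 + ‖k‖) ^ s := one_le_pow₀ (by linarith [norm_nonneg k])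
  nlinarith [norm_nonneg (y k)]

theorem cv_bd {c : KK n → ℂ} (hc : RD c) {s : ℕ} {B : ℝ} {y : KK n → E} (hy : bd s B y) :
    bd s (cM c s * B) (cv c y) := by
  intro k
  have hs := hc.summable s
  have h1 : ‖cv c y k‖ ≤ ∑' m, ((1 + ‖k‖) ^ s)⁻¹ * (((1 + ‖m‖) ^ s * ‖c m‖) * B) := by
    refine tsum_of_norm_bounded ((hs.mul_right B).mul_left _).hasSum fun m => ?_
    rw [← div_eq_inv_mul, le_div_iff₀ (by positivity), mul_comm]
    exact conv_term c s hy k m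
  rw [tsum_mul_left, tsum_mul_right, ← div_eq_inv_mul, le_div_iff₀ (by positivity), mul_comm] at h1
  exact h1

theorem RD_iff (y : KK n → E) : RD y ↔ ∀ s, ∃ B, bd s B y := Iff.rfl

theorem RD.cv {c : KK n → ℂ} (hc : RD c) {y : KK n → E} (hy : RD y) : RD (cv c y) := by
  intro s
  obtain ⟨B, hB⟩ := hy s
  exact ⟨_, cv_bd hc hB⟩

theorem RD.bdd {y : KK n → E} (hy : RD y) : ∃ B, ∀ k, ‖y k‖ ≤ B := by
  obtain ⟨B, hB⟩ := hy 0
  exact ⟨B, fun k => by simpa using hB k⟩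

theorem RD.hasSum_cv {c : KK n → ℂ} (hc : RD c) {y w : KK n → E} (hy : RD y)
    (h : ∀ k, HasSum (fun m => c m • y (k - m)) (w k)) : w = HS.cv c y := by
  funext k
  exact (h k).tsum_eq.symm

theorem bd.add {s : ℕ} {B B' : ℝ} {y w : KK n → E} (hy : bd s B y) (hw : bd s B' w) :
    bd s (B + B') (fun k => y k + w k) := by
  intro k
  have := norm_add_le (y k) (w k)
  calc (1 + ‖k‖) ^ s * ‖y k + w k‖ ≤ (1 + ‖k‖) ^ s * (‖y k‖ + ‖w k‖) := by gcongr
    _ ≤ _ := by rw [mul_add]; exact add_le_add (hy k) (hw k)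

theorem bd.neg {s : ℕ} {B : ℝ} {y : KK n → E} (hy : bd s B y) : bd s B (fun k => - y k) := by
  intro k; rw [norm_neg]; exact hy k

theorem bd.smul {s p : ℕ} {B A : ℝ} {y : KK n → E} {a : KK n → ℂ}
    (ha : ∀ k, ‖a k‖ ≤ A * (1 + ‖k‖) ^ p) (hA : 0 ≤ A) (hy : bd (p + s) B y) :
    bd s (A * B) (fun k => a k • y k) := by
  intro k
  rw [norm_smul]
  calc (1 + ‖k‖) ^ s * (‖a k‖ * ‖y k‖) ≤ (1 + ‖k‖) ^ s * ((A * (1 + ‖k‖) ^ p) * ‖y k‖) := by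
        gcongr; exact ha k
    _ = A * ((1 + ‖k‖) ^ (p + s) * ‖y k‖) := by rw [pow_add]; ring
    _ ≤ _ := by gcongr; exact hy k

theorem RD.add {y w : KK n → E} (hy : RD y) (hw : RD w) : RD (fun k => y k + w k) := by
  intro s
  obtain ⟨B, hB⟩ := hy s
  obtain ⟨B', hB'⟩ := hw s
  exact ⟨_, bd.add hB hB'⟩

theorem RD.neg {y : KK n → E} (hy : RD y) : RD (fun k => - y k) := by
  intro s
  obtain ⟨B, hB⟩ := hy s
  exact ⟨_, bd.neg hB⟩

theorem RD.sub {y w : KK n → E} (hy : RD y) (hw : RD w) : RD (fun k => y k - w k) := by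
  simpa [sub_eq_add_neg] using hy.add hw.neg

theorem RD.smul {y : KK n → E} (hy : RD y) {p : ℕ} {A : ℝ} {a : KK n → ℂ}
    (ha : ∀ k, ‖a k‖ ≤ A * (1 + ‖k‖) ^ p) (hA : 0 ≤ A) : RD (fun k => a k • y k) := by
  intro s
  obtain ⟨B, hB⟩ := hy (p + s)
  exact ⟨_, bd.smul ha hA hB⟩

theorem RD.sum {ι : Type*} {t : Finset ι} {y : ι → KK n → E} (hy : ∀ i, RD (y i)) :
    RD (fun k => ∑ i ∈ t, y i k) := by
  induction t using Finset.induction_on with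
  | empty => intro s; exact ⟨0, fun k => by simp⟩
  | insert i t hi ih => simp only [Finset.sum_insert hi]; exact (hy i).add ih

theorem RD.of_le {E' : Type*} [NormedAddCommGroup E'] {y : KK n → E} (hy : RD y) {w : KK n → E'}
    {A : ℝ} (hA : 0 ≤ A) (h : ∀ k, ‖w k‖ ≤ A * ‖y k‖) : RD w := by
  intro s
  obtain ⟨B, hB⟩ := hy s
  refine ⟨A * B, fun k => ?_⟩
  calc (1 + ‖k‖) ^ s * ‖w k‖ ≤ (1 + ‖k‖) ^ s * (A * ‖y k‖) := by gcongr; exact h k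
    _ = A * ((1 + ‖k‖) ^ s * ‖y k‖) := by ring
    _ ≤ _ := by gcongr; exact hB k

theorem kq_poly (i : Fin n) (k : KK n) : ‖kq i k‖ ≤ 2 * Real.pi * (1 + ‖k‖) ^ 0 := by
  simpa using kq_norm_le i k

theorem κ_poly (i : Fin n) (k : KK n) : ‖κ i k‖ ≤ 2 * Real.pi * (1 + ‖k‖) ^ 1 := by
  rw [κ_norm, pow_one]
  have := abs_le_norm i k
  have := Real.pi_pos
  gcongr; linarith

theorem lam_poly (k : KK n) : ‖((‖k‖ : ℝ) : ℂ)‖ ≤ 1 * (1 + ‖k‖) ^ 1 := by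
  simp
end conv

/-! the energy space -/

abbrev E2 := WithLp 2 (EE × EE)

def VV (l : ℝ) : Submodule ℂ E2 where
  carrier := {p | ∀ a b, a ≤ b → b ≤ 0 → J a b p.snd + l * inner ℂ (ω a b) p.fst = 0}
  add_mem' := by
    intro p q hp hq a b hab hb
    have h1 := hp a b hab hb
    have h2 := hq a b hab hb
    simp only [J, WithLp.add_fst, WithLp.add_snd, inner_add_right] at h1 h2 ⊢
    linear_combination h1 + h2
  zero_mem' := by intro a b _ _; simp [J]
  smul_mem' := by
    intro c p hp a b hab hb
    have h1 := hp a b hab hb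
    simp only [J, WithLp.smul_fst, WithLp.smul_snd, inner_smul_right] at h1 ⊢
    linear_combination c * h1

theorem VV_closed (l : ℝ) : IsClosed (VV l : Set E2) := by
  have : (VV l : Set E2) = ⋂ a, ⋂ b, ⋂ (_ : a ≤ b), ⋂ (_ : b ≤ 0),
      {p : E2 | J a b p.snd + l * inner ℂ (ω a b) p.fst = 0} := by
    ext p; simp only [Set.mem_iInter]; rfl
  rw [this]
  refine isClosed_iInter fun a => isClosed_iInter fun b => isClosed_iInter fun _ =>
    isClosed_iInter fun _ => isClosed_eq ?_ continuous_const
  unfold J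
  have h1 : Continuous fun p : E2 => p.fst := (WithLp.fstL 2 ℂ EE EE).continuous
  have h2 : Continuous fun p : E2 => p.snd := (WithLp.sndL 2 ℂ EE EE).continuous
  exact (continuous_const.inner h2).add (continuous_const.mul (continuous_const.inner h1))

instance (l : ℝ) : CompleteSpace (VV l) := (VV_closed l).completeSpace_coe

def inl : EE →L[ℂ] E2 :=
  LinearMap.mkContinuous
    { toFun := fun x => WithLp.toLp 2 (x, 0)
      map_add' := fun x y => by
        rw [← WithLp.toLp_add]; simp
      map_smul' := fun c x => by
        rw [RingHom.id_apply, ← WithLp.toLp_smul]; simp } 1 (by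
    intro x
    rw [one_mul]
    apply le_of_sq_le_sq _ (norm_nonneg _)
    rw [WithLp.prod_norm_sq_eq_of_L2]; simp)

@[simp] theorem inl_fst (x : EE) : (inl x).fst = x := rfl
@[simp] theorem inl_snd (x : EE) : (inl x).snd = 0 := rfl
theorem inl_norm (x : EE) : ‖inl x‖ = ‖x‖ := by
  have : ‖inl x‖^2 = ‖x‖^2 := by rw [WithLp.prod_norm_sq_eq_of_L2]; simp
  exact (sq_eq_sq₀ (norm_nonneg _) (norm_nonneg _)).1 this

theorem inner_inl (x : E2) (y : EE) : inner ℂ x (inl y) = inner ℂ x.fst y := by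
  rw [WithLp.prod_inner_apply]
  have : (inl y).ofLp.2 = 0 := rfl
  rw [this, inner_zero_right, add_zero]
  rfl

def PP (l : ℝ) : E2 →L[ℂ] E2 := inl ∘L WithLp.fstL 2 ℂ EE EE ∘L (VV l).starProjection
def TT (l : ℝ) : E2 →L[ℂ] E2 := inl ∘L WithLp.sndL 2 ℂ EE EE ∘L (VV l).starProjection
def QQ (l : ℝ) : E2 →L[ℂ] E2 := (VV l)ᗮ.starProjection

theorem PP_apply (l : ℝ) (f : E2) : PP l f = inl ((VV l).starProjection f).fst := rfl
theorem TT_apply (l : ℝ) (f : E2) : TT l f = inl ((VV l).starProjection f).snd := rfl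

theorem E2_eq (l : ℝ) (f : E2) : ‖f‖^2 = ‖QQ l f‖^2 + ‖PP l f‖^2 + ‖TT l f‖^2 := by
  rw [Submodule.norm_sq_eq_add_norm_sq_starProjection f (VV l), PP_apply, TT_apply, inl_norm, inl_norm]
  rw [WithLp.prod_norm_sq_eq_of_L2 ((VV l).starProjection f)]
  unfold QQ
  ring

theorem PP_norm (l : ℝ) : ‖PP l‖ ≤ 1 := by
  refine ContinuousLinearMap.opNorm_le_bound _ zero_le_one fun f => ?_
  rw [one_mul]
  apply le_of_sq_le_sq _ (norm_nonneg _)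
  rw [E2_eq l f]; nlinarith [sq_nonneg ‖QQ l f‖, sq_nonneg ‖TT l f‖]
theorem TT_norm (l : ℝ) : ‖TT l‖ ≤ 1 := by
  refine ContinuousLinearMap.opNorm_le_bound _ zero_le_one fun f => ?_
  rw [one_mul]
  apply le_of_sq_le_sq _ (norm_nonneg _)
  rw [E2_eq l f]; nlinarith [sq_nonneg ‖QQ l f‖, sq_nonneg ‖PP l f‖]
theorem QQ_norm (l : ℝ) : ‖QQ l‖ ≤ 1 := Submodule.starProjection_norm_le _

theorem VV_mem (l : ℝ) (p : E2) (hp : p ∈ VV l) (a b : ℝ) (hab : a ≤ b) (hb : b ≤ 0) :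
   J a b p.snd + l * inner ℂ (ω a b) p.fst = 0 := hp a b hab hb

theorem TT_zero : TT 0 = 0 := by
  ext1 f
  rw [TT_apply]
  have h := VV_mem 0 _ ((VV 0).starProjection_apply_mem f)
  have : ((VV 0).starProjection f).snd = 0 := by
    apply J_ext
    intro a b hab hb
    simpa using h a b hab hb
  rw [this, map_zero]; rfl

/-- test vectors -/
theorem test_mem (l : ℝ) {a b c d : ℝ} (hab : a ≤ b) (hb : b ≤ 0) (hcd : c ≤ d) (hd : d ≤ 0) :
    (WithLp.toLp 2 (((d - c : ℝ) : ℂ) • ind a b - ((b - a : ℝ) : ℂ) • ind c d,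
      (l : ℂ) • (((d - c : ℝ) : ℂ) • ω a b - ((b - a : ℝ) : ℂ) • ω c d)) : E2) ∈ VV l := by
  intro a' b' hab' hb'
  change J a' b' ((l : ℂ) • (((d - c : ℝ) : ℂ) • ω a b - ((b - a : ℝ) : ℂ) • ω c d)) + l * inner ℂ (ω a' b') (((d - c : ℝ) : ℂ) • ind a b - ((b - a : ℝ) : ℂ) • ind c d) = 0
  have e1 := J_ω (a := a) (b := b) hab' hb'
  have e2 := J_ω (a := c) (b := d) hab' hb'
  have e3 := ω_ind (a' := a') (b' := b') hab hb
  have e4 := ω_ind (a' := a') (b' := b') hcd hd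
  unfold J at *
  rw [inner_smul_right, inner_sub_right, inner_smul_right, inner_smul_right, e1, e2,
    inner_sub_right, inner_smul_right, inner_smul_right, e3, e4]
  have h1 := ZZ_symm a' b' a b
  have h2 := ZZ_symm a' b' c d
  norm_cast
  linear_combination l * (d - c) * h1 - l * (b - a) * h2

theorem kq_conj {n : ℕ} (i : Fin n) (k : KK n) : starRingEnd ℂ (kq i k) = - kq i k := by
  unfold kq κ
  simp only [map_div₀, map_mul, Complex.conj_ofReal, Complex.conj_I, map_intCast, map_ofNat]
  ring

theorem l2_solve {n : ℕ} (c : Fin n → KK n → ℂ) (hc : ∀ i, RD (c i))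
    (hsym : ∀ i m, c i (-m) = starRingEnd ℂ (c i m)) (ψ : KK n → ℂ) (hψ : RD ψ) :
    ∃ (X0 Y q : KK n → EE) (X : Fin n → KK n → EE) (r : KK n → ℂ),
      RD X0 ∧ RD Y ∧ RD q ∧ (∀ i, RD (X i)) ∧
      (∀ i k, X i k = kq i k • Y k - cv (c i) X0 k) ∧
      (∀ k, q k = X0 k - ∑ i, cv (c i) (X i) k) ∧
      (∀ k a b, a ≤ b → b ≤ 0 → J a b (Y k) = ‖k‖ * ∫ z in a..b, (ψ k - J z 0 (X0 k))) ∧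
      (∀ k a b, a ≤ b → b ≤ 0 → J a b (q k) = ∫ z in a..b, (r k + J z 0 (∑ i, κ i k • X i k))) := by
  set Z0 : KK n → EE := fun k => ψ k • ind (-1) 0 with hZ0
  set Y0 : KK n → EE := fun k => (‖k‖ : ℂ) • ψ k • ω (-1) 0 with hY0
  have rZ0 : RD Z0 := hψ.of_le (norm_nonneg (ind (-1) 0)) fun k => by
    rw [norm_smul, mul_comm]
  have rψω : RD fun k => ψ k • ω (-1) 0 := hψ.of_le (norm_nonneg (ω (-1) 0)) fun k => by
    rw [norm_smul, mul_comm]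
  have rY0 : RD Y0 := rψω.smul lam_poly zero_le_one
  have rinl : ∀ {y : KK n → EE}, RD y → RD fun k => inl (y k) := fun hy =>
    hy.of_le zero_le_one fun k => by rw [inl_norm, one_mul]
  have hT0 : TT ‖(0 : KK n)‖ = 0 := by rw [norm_zero]; exact TT_zero
  obtain ⟨f, hf, X0, Y, X, q, h1, h2, h3, h4, h5⟩ := abs_solve c hc hsym (fun k => QQ ‖k‖)
    (fun k => PP ‖k‖) (fun k => TT ‖k‖) (fun k => QQ_norm _) (fun k => PP_norm _)
    (fun k => TT_norm _) hT0 (fun k f => (E2_eq _ _).le)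
    (fun k => inl (Y0 k)) (fun k => inl (Z0 k)) (rinl rY0) (rinl rZ0)
  have rX0 : RD X0 := by
    have : RD fun k => PP ‖k‖ (f k) := hf.of_le zero_le_one fun k => (PP ‖k‖).le_of_opNorm_le (PP_norm _) _
    have h := this.add (rinl rZ0)
    have e : X0 = fun k => PP ‖k‖ (f k) + inl (Z0 k) := funext h1
    rw [e]; exact h
  have rY : RD Y := by
    have : RD fun k => TT ‖k‖ (f k) := hf.of_le zero_le_one fun k => (TT ‖k‖).le_of_opNorm_le (TT_norm _) _
    have h := this.add (rinl rY0)
    have e : Y = fun k => TT ‖k‖ (f k) + inl (Y0 k) := funext h2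
    rw [e]; exact h
  have fstL_le : ∀ x : E2, ‖x.fst‖ ≤ 1 * ‖x‖ := fun x => by
    rw [one_mul]
    apply le_of_sq_le_sq _ (norm_nonneg _)
    rw [WithLp.prod_norm_sq_eq_of_L2]; nlinarith [sq_nonneg ‖x.snd‖]
  have rfst : ∀ {y : KK n → E2}, RD y → RD fun k => (y k).fst := fun hy =>
    hy.of_le zero_le_one fun k => fstL_le _
  have pi2 : (0:ℝ) ≤ 2 * Real.pi := by have := Real.pi_pos; positivity
  have eX : ∀ i k, (X i k).fst = kq i k • (Y k).fst - cv (c i) (fun k => (X0 k).fst) k := by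
    intro i k
    have h := (h3 i k).mapL (WithLp.fstL 2 ℂ EE EE)
    have h' : HasSum (fun m => c i m • (X0 (k - m)).fst) (kq i k • (Y k).fst - (X i k).fst) := h
    unfold cv
    rw [h'.tsum_eq, sub_sub_cancel]
  have rXi : ∀ i, RD fun k => (X i k).fst := by
    intro i
    have h := ((rfst rY).smul (kq_poly i) pi2).sub ((hc i).cv (rfst rX0))
    have e : (fun k => (X i k).fst) = _ := funext (eX i)
    rw [e]; exact h
  have eq' : ∀ k, (q k).fst = (X0 k).fst - ∑ i, cv (c i) (fun k => (X i k).fst) k := by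
    intro k
    obtain ⟨r, hr, e⟩ := h4 k
    have e' : (q k).fst = (X0 k).fst - (WithLp.fstL 2 ℂ EE EE) (∑ i, r i) := by rw [e]; rfl
    rw [e', map_sum]
    congr 1
    refine Finset.sum_congr rfl fun i _ => ?_
    exact ((hr i).mapL (WithLp.fstL 2 ℂ EE EE)).tsum_eq.symm
  have rq : RD fun k => (q k).fst := by
    have h := (rfst rX0).sub (RD.sum (t := Finset.univ) fun i => (hc i).cv (rXi i))
    have e : (fun k => (q k).fst) = _ := funext eq'
    rw [e]; exact h
  set N : KK n → ℝ → ℝ → ℂ := fun k a b => J a b (q k).fst - inner ℂ (ω a b) (∑ i, κ i k • (X i k).fst) with hN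
  have key : ∀ k a b c d, a ≤ b → b ≤ 0 → c ≤ d → d ≤ 0 →
      ((d - c : ℝ) : ℂ) * N k a b = ((b - a : ℝ) : ℂ) * N k c d := by
    intro k a b c d hab hb hcd hd
    have hm := test_mem ‖k‖ hab hb hcd hd
    set g : E2 := WithLp.toLp 2 (((d - c : ℝ) : ℂ) • ind a b - ((b - a : ℝ) : ℂ) • ind c d,
      ((‖k‖:ℝ) : ℂ) • (((d - c : ℝ) : ℂ) • ω a b - ((b - a : ℝ) : ℂ) • ω c d)) with hg
    have hp : (VV ‖k‖).starProjection g = g := Submodule.starProjection_eq_self_iff.2 hm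
    have hq : QQ ‖k‖ g = 0 := by
      unfold QQ
      rw [Submodule.starProjection_orthogonal_val, hp, sub_self]
    have h := h5 k g hq
    simp only [PP_apply, TT_apply, hp, inner_smul_right] at h
    simp only [inner_inl] at h
    have h' := congrArg (starRingEnd ℂ) h
    rw [map_add, map_zero, map_sum] at h'
    simp only [map_mul, kq_conj, inner_conj_symm] at h'
    change inner ℂ (((d - c : ℝ) : ℂ) • ind a b - ((b - a : ℝ) : ℂ) • ind c d) (q k).fst + ∑ i, -kq i k * inner ℂ (((‖k‖:ℝ) : ℂ) • (((d - c : ℝ) : ℂ) • ω a b - ((b - a : ℝ) : ℂ) • ω c d)) (X i k).fst = 0 at h'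
    have e1 : ∀ i, -kq i k * inner ℂ (((‖k‖:ℝ) : ℂ) • (((d - c : ℝ) : ℂ) • ω a b - ((b - a : ℝ) : ℂ) • ω c d)) (X i k).fst
       = - ((d - c : ℝ) : ℂ) * inner ℂ (ω a b) (κ i k • (X i k).fst)
         + ((b - a : ℝ) : ℂ) * inner ℂ (ω c d) (κ i k • (X i k).fst) := by
      intro i
      rw [inner_smul_left, inner_sub_left, inner_smul_left, inner_smul_left, inner_smul_right,
        inner_smul_right, ← kq_mul]
      simp only [Complex.conj_ofReal]
      ring
    rw [Finset.sum_congr rfl fun i _ => e1 i, Finset.sum_add_distrib, ← Finset.mul_sum,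
      ← Finset.mul_sum, ← inner_sum, ← inner_sum, inner_sub_left, inner_smul_left, inner_smul_left] at h'
    simp only [Complex.conj_ofReal] at h'
    simp only [hN, J]
    linear_combination h'
  refine ⟨fun k => (X0 k).fst, fun k => (Y k).fst, fun k => (q k).fst, fun i k => (X i k).fst,
    fun k => N k (-1) 0, rfst rX0, rfst rY, rq, rXi, eX, eq', ?_, ?_⟩
  · intro k a b hab hb
    have hv := VV_mem _ _ ((VV ‖k‖).starProjection_apply_mem (f k)) a b hab hb
    have eY : (Y k).fst = ((VV ‖k‖).starProjection (f k)).snd + (‖k‖ : ℂ) • ψ k • ω (-1) 0 := by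
      rw [h2 k]; rfl
    have eX0 : (X0 k).fst = ((VV ‖k‖).starProjection (f k)).fst + ψ k • ind (-1) 0 := by
      rw [h1 k]; rfl
    rw [intervalIntegral.integral_sub (by simp) ((J_cont _).intervalIntegrable _ _), ← ω_inner,
      intervalIntegral.integral_const]
    beta_reduce
    rw [eY, eX0]
    have e1 := J_ω (a := -1) (b := 0) hab hb
    have e2 := ω_ind (a' := a) (b' := b) (a := -1) (b := 0) (by norm_num) le_rfl
    unfold J at *
    simp only [inner_add_right, inner_smul_right, e1, e2]
    have h3 := ZZ_symm a b (-1) 0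
    have h3' : (ZZ a b (-1) 0 : ℂ) + ZZ (-1) 0 a b = (b - a) := by
      rw [← Complex.ofReal_add, h3]; push_cast; ring
    rw [Complex.real_smul]
    push_cast
    linear_combination hv + ‖k‖ * ψ k * h3'
  · intro k a b hab hb
    rw [intervalIntegral.integral_add (by simp) ((J_cont _).intervalIntegrable _ _), ← ω_inner,
      intervalIntegral.integral_const, Complex.real_smul]
    have h := key k a b (-1) 0 hab hb (by norm_num) le_rfl
    norm_num at h
    push_cast
    rw [← h]
    simp only [hN]
    ring
end HS

namespace HS
set_option linter.unusedSectionVars false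

/-! ### Part F: pointwise regularity of the solution in z -/

section reg
variable {n : ℕ}

abbrev SF (n : ℕ) := KK n → ℝ → ℂ

structure Reg (w : SF n) : Prop where
  cont : ∀ k, Continuous (w k)
  bnd : ∀ s, ∃ B, ∀ z, bd s (B * (1 + |z|)) (fun k => w k z)

def cvF (c : KK n → ℂ) (w : SF n) : SF n := fun k z => cv c (fun m => w m z) k

theorem Reg.add {w v : SF n} (hw : Reg w) (hv : Reg v) : Reg (fun k z => w k z + v k z) := by
  refine ⟨fun k => (hw.cont k).add (hv.cont k), fun s => ?_⟩
  obtain ⟨B, hB⟩ := hw.bnd s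
  obtain ⟨B', hB'⟩ := hv.bnd s
  refine ⟨B + B', fun z => ?_⟩
  rw [add_mul]
  exact (hB z).add (hB' z)

theorem Reg.neg {w : SF n} (hw : Reg w) : Reg (fun k z => - w k z) := by
  refine ⟨fun k => (hw.cont k).neg, fun s => ?_⟩
  obtain ⟨B, hB⟩ := hw.bnd s
  exact ⟨B, fun z => (hB z).neg⟩

theorem Reg.sub {w v : SF n} (hw : Reg w) (hv : Reg v) : Reg (fun k z => w k z - v k z) := by
  simpa [sub_eq_add_neg] using hw.add hv.neg

theorem Reg.zero : Reg (fun (_ : KK n) (_ : ℝ) => (0:ℂ)) :=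
  ⟨fun _ => continuous_const, fun s => ⟨0, fun z k => by simp⟩⟩

theorem Reg.sum {ι : Type*} {t : Finset ι} {w : ι → SF n} (hw : ∀ i, Reg (w i)) :
    Reg (fun k z => ∑ i ∈ t, w i k z) := by
  induction t using Finset.induction_on with
  | empty => simpa using Reg.zero
  | insert i t hi ih => simp only [Finset.sum_insert hi]; exact (hw i).add ih

theorem Reg.mul {w : SF n} (hw : Reg w) {p : ℕ} {A : ℝ} {a : KK n → ℂ}
    (ha : ∀ k, ‖a k‖ ≤ A * (1 + ‖k‖) ^ p) (hA : 0 ≤ A) : Reg (fun k z => a k * w k z) := by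
  refine ⟨fun k => continuous_const.mul (hw.cont k), fun s => ?_⟩
  obtain ⟨B, hB⟩ := hw.bnd (p + s)
  refine ⟨A * B, fun z => ?_⟩
  rw [mul_assoc]
  exact bd.smul ha hA (hB z)

theorem Reg.bdd {w : SF n} (hw : Reg w) (R : ℝ) : ∃ B, ∀ z, |z| ≤ R → ∀ k, ‖w k z‖ ≤ B := by
  obtain ⟨B, hB⟩ := hw.bnd 0
  have hB0 : 0 ≤ B := by
    have := hB 0 0
    simp at this
    exact (norm_nonneg _).trans this
  refine ⟨B * (1 + R), fun z hz k => ((hB z).le k).trans ?_⟩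
  gcongr

theorem Reg.cvF_cont {c : KK n → ℂ} (hc : RD c) {w : SF n} (hw : Reg w) (k : KK n) :
    Continuous (cvF c w k) := by
  rw [continuous_iff_continuousAt]
  intro z0
  obtain ⟨B, hB⟩ := hw.bdd (|z0| + 1)
  have h : ContinuousOn (cvF c w k) (Metric.ball z0 1) := by
    unfold cvF cv
    refine continuousOn_tsum (u := fun m => ‖c m‖ * B) (fun m => ?_) (hc.summable_norm.mul_right B)
      (fun m z hz => ?_)
    · exact (continuous_const.mul (hw.cont (k - m))).continuousOn
    · rw [norm_smul]
      gcongr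
      apply hB
      rw [Metric.mem_ball, Real.dist_eq] at hz
      have := abs_sub_abs_le_abs_sub z z0
      linarith
  exact h.continuousAt (Metric.ball_mem_nhds _ one_pos)

theorem Reg.cvF {c : KK n → ℂ} (hc : RD c) {w : SF n} (hw : Reg w) : Reg (cvF c w) := by
  refine ⟨fun k => hw.cvF_cont hc k, fun s => ?_⟩
  obtain ⟨B, hB⟩ := hw.bnd s
  refine ⟨cM c s * B, fun z => ?_⟩
  rw [mul_assoc]
  exact cv_bd hc (hB z)

theorem cvF_integral {c : KK n → ℂ} (hc : RD c) {w : SF n} (hw : Reg w) (k : KK n) (a b : ℝ) :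
    ∫ z in a..b, HS.cvF c w k z = cv c (fun m => ∫ z in a..b, w m z) k := by
  obtain ⟨B, hB⟩ := hw.bdd (max |a| |b|)
  have hz : ∀ z ∈ Set.uIoc a b, |z| ≤ max |a| |b| := by
    intro z hz
    rw [Set.uIoc, Set.mem_Ioc] at hz
    rw [abs_le]
    constructor
    · have : -(max |a| |b|) ≤ min a b := by
        rw [le_min_iff]
        constructor
        · have := neg_abs_le a; have := le_max_left |a| |b|; linarith
        · have := neg_abs_le b; have := le_max_right |a| |b|; linarith
      linarith [hz.1]
    · exact hz.2.trans (max_le_max (le_abs_self _) (le_abs_self _))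
  have h := intervalIntegral.hasSum_integral_of_dominated_convergence (a := a) (b := b) (μ := volume)
    (F := fun m z => c m • w (k - m) z) (f := HS.cvF c w k) (fun m _ => ‖c m‖ * B)
    (fun m => (show Continuous (fun z => c m • w (k - m) z) from
      continuous_const.mul (hw.cont (k - m))).aestronglyMeasurable)
    (fun m => Filter.Eventually.of_forall fun z hz' => by
      rw [norm_smul]; gcongr; exact hB z (hz z hz') _)
    (Filter.Eventually.of_forall fun z _ => hc.summable_norm.mul_right B)
    (by simp)
    (Filter.Eventually.of_forall fun z hz' => cv_hasSum hc (hB z (hz z hz')) k)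
  unfold cv
  rw [← h.tsum_eq]
  refine tsum_congr fun m => ?_
  exact intervalIntegral.integral_smul _ _

structure DD (w v : SF n) : Prop where
  left : Reg w
  right : Reg v
  int : ∀ k a b, a ≤ b → b ≤ 0 → w k b - w k a = ∫ z in a..b, v k z

theorem DD.add {w v w' v' : SF n} (h : DD w v) (h' : DD w' v') :
    DD (fun k z => w k z + w' k z) (fun k z => v k z + v' k z) := by
  refine ⟨h.left.add h'.left, h.right.add h'.right, fun k a b hab hb => ?_⟩
  rw [intervalIntegral.integral_add ((h.right.cont k).intervalIntegrable _ _)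
    ((h'.right.cont k).intervalIntegrable _ _), ← h.int k a b hab hb, ← h'.int k a b hab hb]
  ring

theorem DD.neg {w v : SF n} (h : DD w v) :
    DD (fun k z => - w k z) (fun k z => - v k z) := by
  refine ⟨h.left.neg, h.right.neg, fun k a b hab hb => ?_⟩
  rw [intervalIntegral.integral_neg, ← h.int k a b hab hb]
  ring

theorem DD.sub {w v w' v' : SF n} (h : DD w v) (h' : DD w' v') :
    DD (fun k z => w k z - w' k z) (fun k z => v k z - v' k z) := by
  simpa [sub_eq_add_neg] using h.add h'.neg

theorem DD.sum {ι : Type*} {t : Finset ι} {w v : ι → SF n} (hw : ∀ i, DD (w i) (v i)) :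
    DD (fun k z => ∑ i ∈ t, w i k z) (fun k z => ∑ i ∈ t, v i k z) := by
  induction t using Finset.induction_on with
  | empty => simpa using ⟨Reg.zero, Reg.zero, fun k a b _ _ => by simp⟩
  | insert i t hi ih => simp only [Finset.sum_insert hi]; exact (hw i).add ih

theorem DD.mul {w v : SF n} (h : DD w v) {p : ℕ} {A : ℝ} {a : KK n → ℂ}
    (ha : ∀ k, ‖a k‖ ≤ A * (1 + ‖k‖) ^ p) (hA : 0 ≤ A) :
    DD (fun k z => a k * w k z) (fun k z => a k * v k z) := by
  refine ⟨h.left.mul ha hA, h.right.mul ha hA, fun k a b hab hb => ?_⟩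
  rw [intervalIntegral.integral_const_mul, ← h.int k a b hab hb]
  ring

theorem DD.cvF {c : KK n → ℂ} (hc : RD c) {w v : SF n} (h : DD w v) :
    DD (cvF c w) (cvF c v) := by
  refine ⟨h.left.cvF hc, h.right.cvF hc, fun k a b hab hb => ?_⟩
  rw [cvF_integral hc h.right]
  obtain ⟨B, hB⟩ := h.left.bdd |a|
  obtain ⟨B', hB'⟩ := h.left.bdd |b|
  have h1 := (cv_hasSum hc (hB' b le_rfl) k).sub (cv_hasSum hc (hB a le_rfl) k)
  unfold HS.cvF
  rw [← h1.tsum_eq]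
  unfold cv
  refine tsum_congr fun m => ?_
  beta_reduce
  rw [← h.int _ a b hab hb, smul_sub]

/-- the first order system -/
def opD (μ : KK n → ℂ) (c : Fin n → KK n → ℂ) (y q : SF n) : SF n :=
  cvF μ (fun k z => q k z + ∑ i, cvF (c i) (fun k z => kq i k * y k z) k z)
def opX (c : Fin n → KK n → ℂ) (y d : SF n) (i : Fin n) : SF n :=
  fun k z => kq i k * y k z - cvF (c i) d k z
def opQ (c : Fin n → KK n → ℂ) (y d : SF n) : SF n :=
  fun k z => - ∑ i, κ i k * opX c y d i k z
def opY (d : SF n) : SF n := fun k z => ((‖k‖:ℝ):ℂ) * d k z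

theorem pi2 : (0:ℝ) ≤ 2 * Real.pi := by have := Real.pi_pos; positivity

theorem opD_reg {μ : KK n → ℂ} (hμ : RD μ) {c : Fin n → KK n → ℂ} (hc : ∀ i, RD (c i)) {y q : SF n}
    (hy : Reg y) (hq : Reg q) : Reg (opD μ c y q) :=
  (hq.add (Reg.sum fun i => (hy.mul (kq_poly i) pi2).cvF (hc i))).cvF hμ

theorem opD_DD {μ : KK n → ℂ} (hμ : RD μ) {c : Fin n → KK n → ℂ} (hc : ∀ i, RD (c i)) {y q y' q' : SF n}
    (hy : DD y y') (hq : DD q q') : DD (opD μ c y q) (opD μ c y' q') :=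
  (hq.add (DD.sum fun i => (hy.mul (kq_poly i) pi2).cvF (hc i))).cvF hμ

theorem opX_DD {c : Fin n → KK n → ℂ} (hc : ∀ i, RD (c i)) {y d y' d' : SF n}
    (hy : DD y y') (hd : DD d d') (i : Fin n) : DD (opX c y d i) (opX c y' d' i) :=
  (hy.mul (kq_poly i) pi2).sub (hd.cvF (hc i))

theorem opX_reg {c : Fin n → KK n → ℂ} (hc : ∀ i, RD (c i)) {y d : SF n}
    (hy : Reg y) (hd : Reg d) (i : Fin n) : Reg (opX c y d i) :=
  (hy.mul (kq_poly i) pi2).sub (hd.cvF (hc i))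

theorem opQ_DD {c : Fin n → KK n → ℂ} (hc : ∀ i, RD (c i)) {y d y' d' : SF n}
    (hy : DD y y') (hd : DD d d') : DD (opQ c y d) (opQ c y' d') :=
  (DD.sum fun i => (opX_DD hc hy hd i).mul (κ_poly i) pi2).neg

theorem opQ_reg {c : Fin n → KK n → ℂ} (hc : ∀ i, RD (c i)) {y d : SF n}
    (hy : Reg y) (hd : Reg d) : Reg (opQ c y d) :=
  (Reg.sum fun i => (opX_reg hc hy hd i).mul (κ_poly i) pi2).neg

theorem opY_DD {d d' : SF n} (hd : DD d d') : DD (opY d) (opY d') := hd.mul lam_poly zero_le_one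
theorem opY_reg {d : SF n} (hd : Reg d) : Reg (opY d) := hd.mul lam_poly zero_le_one

def Wseq (μ : KK n → ℂ) (c : Fin n → KK n → ℂ) (y q : SF n) : ℕ → SF n × SF n
  | 0 => (y, q)
  | j + 1 => (opY (opD μ c (Wseq μ c y q j).1 (Wseq μ c y q j).2),
      opQ c (Wseq μ c y q j).1 (opD μ c (Wseq μ c y q j).1 (Wseq μ c y q j).2))

theorem Wseq_DD {μ : KK n → ℂ} (hμ : RD μ) {c : Fin n → KK n → ℂ} (hc : ∀ i, RD (c i)) {y q : SF n}
    (hy : DD y (opY (opD μ c y q))) (hq : DD q (opQ c y (opD μ c y q))) (j : ℕ) :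
    DD (Wseq μ c y q j).1 (Wseq μ c y q (j+1)).1 ∧ DD (Wseq μ c y q j).2 (Wseq μ c y q (j+1)).2 := by
  induction j with
  | zero => exact ⟨hy, hq⟩
  | succ j ih =>
    have hd := opD_DD hμ hc ih.1 ih.2
    exact ⟨opY_DD hd, opQ_DD hc ih.1 hd⟩

theorem Reg_J (f : KK n → EE) (hf : RD f) : Reg (fun k z => J z 0 (f k)) := by
  refine ⟨fun k => J_cont _, fun s => ?_⟩
  obtain ⟨B, hB0, hB⟩ := hf.nonneg_bound s
  refine ⟨B, fun z k => ?_⟩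
  rcases le_total 0 z with hz | hz
  · beta_reduce
    rw [J_pos _ hz, norm_zero, mul_zero]; positivity
  · have h1 := J_norm_le hz le_rfl (f k)
    have h2 : Real.sqrt (0 - z) ≤ 1 + |z| := by
      rw [Real.sqrt_le_left (by positivity), zero_sub]
      have := neg_le_abs z
      nlinarith [abs_nonneg z]
    calc (1 + ‖k‖) ^ s * ‖J z 0 (f k)‖ ≤ (1 + ‖k‖) ^ s * ((1 + |z|) * ‖f k‖) := by
          gcongr; exact h1.trans (by gcongr)
      _ = ((1 + ‖k‖) ^ s * ‖f k‖) * (1 + |z|) := by ring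
      _ ≤ _ := by gcongr; exact hB k

theorem Reg_const (f : KK n → ℂ) (hf : RD f) : Reg (fun k _ => f k) := by
  refine ⟨fun k => continuous_const, fun s => ?_⟩
  obtain ⟨B, hB0, hB⟩ := hf.nonneg_bound s
  refine ⟨B, fun z k => (hB k).trans ?_⟩
  nlinarith [abs_nonneg z]

theorem J_map_cv {c : KK n → ℂ} (hc : RD c) {y : KK n → EE} (hy : RD y) (a b : ℝ) (k : KK n) :
    J a b (cv c y k) = cv c (fun m => J a b (y m)) k := by
  obtain ⟨B, hB⟩ := hy.bdd
  have h := (cv_hasSum hc hB k).mapL (innerSL ℂ (ind a b))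
  have e : J a b (cv c y k) = innerSL ℂ (ind a b) (cv c y k) := rfl
  rw [e, ← h.tsum_eq]
  refine tsum_congr fun m => ?_
  rw [map_smul]
  rfl

/-- the regular solution in Fourier variables -/
theorem reg_solve (c : Fin n → KK n → ℂ) (hc : ∀ i, RD (c i))
    (hsym : ∀ i m, c i (-m) = starRingEnd ℂ (c i m)) (ψ : KK n → ℂ) (hψ : RD ψ)
    (μ : KK n → ℂ) (hμ : RD μ)
    (hinv : ∀ y : KK n → EE, RD y → cv μ (fun k => y k + ∑ i, cv (c i) (cv (c i) y) k) = y) :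
    ∃ (u q d : SF n) (g : ℕ → SF n) (Y X0 : KK n → EE),
      g 0 = u ∧ g 1 = d ∧ (∀ j, DD (g j) (g (j + 1))) ∧
      (∀ k, u k 0 = ψ k) ∧ d = opD μ c (opY u) q ∧ DD q (opQ c (opY u) d) ∧
      RD Y ∧ RD X0 ∧ (∀ k, Y k =ᵐ[μ0] opY u k) ∧ (∀ k, X0 k =ᵐ[μ0] d k) := by
  obtain ⟨X0, Y, q', X, r, rX0, rY, rq, rX, eX, eq', hY, hq⟩ := l2_solve c hc hsym ψ hψ
  set u : SF n := fun k z => ψ k - J z 0 (X0 k) with hu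
  have ru : Reg u := (Reg_const ψ hψ).sub (Reg_J X0 rX0)
  have rs : RD (fun k => ∑ i, κ i k • X i k) := RD.sum fun i => (rX i).smul (κ_poly i) pi2
  have rr : RD r := by
    have h1 : ∀ k, ‖r k‖ ≤ 1 * ‖(‖q' k‖ + ‖∑ i, κ i k • X i k‖ : ℝ)‖ := by
      intro k
      have h := hq k (-1) 0 (by norm_num) le_rfl
      rw [intervalIntegral.integral_add (by simp) ((J_cont _).intervalIntegrable _ _),
        intervalIntegral.integral_const] at h
      have e : r k = J (-1) 0 (q' k) - ∫ z in (-1:ℝ)..0, J z 0 (∑ i, κ i k • X i k) := by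
        rw [h]; simp
      rw [e, one_mul, Real.norm_of_nonneg (by positivity)]
      refine (norm_sub_le _ _).trans (add_le_add ?_ ?_)
      · have := J_norm_le (a := -1) (b := 0) (by norm_num) le_rfl (q' k)
        simpa using this
      · have := intervalIntegral.norm_integral_le_of_norm_le_const (a := -1) (b := 0)
          (f := fun z => J z 0 (∑ i, κ i k • X i k)) (C := ‖∑ i, κ i k • X i k‖) (by
            intro z hz
            rw [Set.uIoc_of_le (by norm_num)] at hz
            refine (J_norm_le hz.2 le_rfl _).trans ?_
            have : Real.sqrt (0 - z) ≤ 1 := by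
              rw [Real.sqrt_le_left zero_le_one]; linarith [hz.1]
            nlinarith [norm_nonneg (∑ i, κ i k • X i k)])
        simpa using this
    have h2 : RD (fun k => (‖q' k‖ + ‖∑ i, κ i k • X i k‖ : ℝ)) := by
      intro s
      obtain ⟨B, hB⟩ := rq s
      obtain ⟨B', hB'⟩ := rs s
      refine ⟨B + B', fun k => ?_⟩
      rw [Real.norm_of_nonneg (by positivity), mul_add]
      exact add_le_add (hB k) (hB' k)
    intro s
    obtain ⟨B, hB⟩ := h2 s
    refine ⟨B, fun k => le_trans ?_ (hB k)⟩
    have := h1 k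
    rw [one_mul] at this
    gcongr
  set q : SF n := fun k z => r k + J z 0 (∑ i, κ i k • X i k) with hqd
  have rqq : Reg q := (Reg_const r rr).add (Reg_J _ rs)
  set y : SF n := opY u with hy
  have ry : Reg y := opY_reg ru
  set d : SF n := opD μ c y q with hd
  have rd : Reg d := opD_reg hμ hc ry rqq
  have JY : ∀ k a b, a ≤ b → b ≤ 0 → J a b (Y k) = ∫ z in a..b, y k z := by
    intro k a b hab hb
    rw [hY k a b hab hb, ← intervalIntegral.integral_const_mul]
    rfl
  have Jq : ∀ k a b, a ≤ b → b ≤ 0 → J a b (q' k) = ∫ z in a..b, q k z := hq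
  have rCK : RD fun k => ∑ i, cv (c i) (fun k => kq i k • Y k) k :=
    RD.sum fun i => (hc i).cv (rY.smul (kq_poly i) pi2)
  have eX0 : X0 = cv μ (fun k => q' k + ∑ i, cv (c i) (fun k => kq i k • Y k) k) := by
    refine (hinv X0 rX0).symm.trans ?_
    congr 1
    funext k
    rw [eq' k, sub_add_eq_add_sub, add_sub_assoc, ← Finset.sum_sub_distrib]
    congr 1
    refine Finset.sum_congr rfl fun i _ => ?_
    obtain ⟨B1, hB1⟩ := (rY.smul (kq_poly i) pi2).bdd
    obtain ⟨B2, hB2⟩ := (rX i).bdd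
    have h := (cv_hasSum (hc i) hB1 k).sub (cv_hasSum (hc i) hB2 k)
    rw [← h.tsum_eq]
    conv_lhs => unfold cv
    refine tsum_congr fun m => ?_
    rw [← smul_sub, eX i, sub_sub_cancel]
    rfl
  have JX0 : ∀ k a b, a ≤ b → b ≤ 0 → J a b (X0 k) = ∫ z in a..b, d k z := by
    intro k a b hab hb
    rw [hd]
    unfold opD
    rw [cvF_integral hμ (rqq.add (Reg.sum fun i => (ry.mul (kq_poly i) pi2).cvF (hc i))), eX0,
      J_map_cv hμ (rq.add rCK)]
    congr 1
    funext m
    rw [intervalIntegral.integral_add ((rqq.cont m).intervalIntegrable _ _)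
      ((Reg.sum fun i => (ry.mul (kq_poly i) pi2).cvF (hc i)).cont m |>.intervalIntegrable _ _),
      intervalIntegral.integral_finset_sum (fun i _ =>
        (((ry.mul (kq_poly i) pi2).cvF (hc i)).cont m).intervalIntegrable _ _), ← Jq m a b hab hb]
    have e1 : J a b (q' m + ∑ i, cv (c i) (fun k => kq i k • Y k) m) =
        J a b (q' m) + ∑ i, J a b (cv (c i) (fun k => kq i k • Y k) m) := by
      unfold J; rw [inner_add_right, inner_sum]
    rw [e1]
    congr 1
    refine Finset.sum_congr rfl fun i _ => ?_
    rw [J_map_cv (hc i) (rY.smul (kq_poly i) pi2), cvF_integral (hc i) (ry.mul (kq_poly i) pi2)]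
    congr 1
    funext l
    rw [intervalIntegral.integral_const_mul, ← JY l a b hab hb]
    unfold J
    rw [inner_smul_right]
  have JX : ∀ i k a b, a ≤ b → b ≤ 0 → J a b (X i k) = ∫ z in a..b, opX c y d i k z := by
    intro i k a b hab hb
    unfold opX
    rw [intervalIntegral.integral_sub (((ry.mul (kq_poly i) pi2).cont k).intervalIntegrable _ _)
      (((rd.cvF (hc i)).cont k).intervalIntegrable _ _), cvF_integral (hc i) rd, eX i k]
    have e1 : J a b (kq i k • Y k - cv (c i) X0 k) = kq i k * J a b (Y k) - J a b (cv (c i) X0 k) := by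
      unfold J; rw [inner_sub_right, inner_smul_right]
    rw [e1, J_map_cv (hc i) rX0, intervalIntegral.integral_const_mul, ← JY k a b hab hb]
    congr 2
    funext m
    exact JX0 m a b hab hb
  have Du : DD u d := by
    refine ⟨ru, rd, fun k a b hab hb => ?_⟩
    rw [← JX0 k a b hab hb]
    simp only [hu]; rw [← J_add hab hb (X0 k)]; ring
  have Dy : DD y (opY d) := opY_DD Du
  have Dq : DD q (opQ c y d) := by
    refine ⟨rqq, opQ_reg hc ry rd, fun k a b hab hb => ?_⟩
    unfold opQ
    rw [intervalIntegral.integral_neg, intervalIntegral.integral_finset_sum (fun i _ =>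
        (((opX_reg hc ry rd i).mul (κ_poly i) pi2).cont k).intervalIntegrable _ _)]
    have e1 := J_add hab hb (∑ i, κ i k • X i k)
    have e2 : J a b (∑ i, κ i k • X i k) = ∑ i, κ i k * J a b (X i k) := by
      unfold J; simp only [inner_sum, inner_smul_right]
    have e3 : ∀ i, ∫ z in a..b, κ i k * opX c y d i k z = κ i k * J a b (X i k) := by
      intro i
      rw [intervalIntegral.integral_const_mul, JX i k a b hab hb]
    rw [Finset.sum_congr rfl fun i _ => e3 i, ← e2]
    simp only [hqd]
    rw [← e1]; ring
  have hW := Wseq_DD hμ hc Dy Dq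
  set g : ℕ → SF n := fun j => Nat.casesOn j u (fun j => opD μ c (Wseq μ c y q j).1 (Wseq μ c y q j).2) with hg
  refine ⟨u, q, d, g, Y, X0, rfl, rfl, ?_, ?_, rfl, Dq, rY, rX0, ?_, ?_⟩
  · intro j
    cases j with
    | zero => exact Du
    | succ j => exact opD_DD hμ hc (hW j).1 (hW j).2
  · intro k
    simp only [hu]; rw [J_pos _ le_rfl, sub_zero]
  · exact fun k => ae_of_J _ _ (ry.cont k) (JY k)
  · exact fun k => ae_of_J _ _ (rd.cont k) (JX0 k)
end reg
end HS

namespace HS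
set_option linter.unusedSectionVars false

/-! ### Part G: Seeley extension -/

def sc : ℕ → ℝ
  | 0 => 1
  | j + 1 => -2 * sc j / (2 ^ (j + 1) - 1)

theorem two_pow_sub_pos (j : ℕ) : (0:ℝ) < 2 ^ (j + 1) - 1 := by
  have : (1:ℝ) < 2 ^ (j + 1) := one_lt_pow₀ (by norm_num) (by omega)
  linarith

theorem sc_succ (j : ℕ) : sc (j + 1) * (2 ^ (j + 1) - 1) = -2 * sc j := by
  rw [sc, div_mul_cancel₀ _ (two_pow_sub_pos j).ne']

theorem sc_ne (j : ℕ) : sc j ≠ 0 := by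
  induction j with
  | zero => simp [sc]
  | succ j ih => rw [sc]; exact div_ne_zero (mul_ne_zero (by norm_num) ih) (two_pow_sub_pos j).ne'

theorem sc_summable (R : ℝ) (hR : 0 < R) : Summable fun j => |sc j| * R ^ j := by
  apply summable_of_ratio_test_tendsto_lt_one (l := 0) (by norm_num)
  · exact Filter.Eventually.of_forall fun j => mul_ne_zero (abs_ne_zero.2 (sc_ne j)) (pow_ne_zero _ hR.ne')
  · have e : ∀ j : ℕ, ‖|sc (j+1)| * R ^ (j+1)‖ / ‖|sc j| * R ^ j‖ = (2 * R) * (2 ^ (j + 1) - 1)⁻¹ := by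
      intro j
      have h1 := abs_pos.2 (sc_ne j)
      have h2 := two_pow_sub_pos j
      rw [Real.norm_of_nonneg (by positivity), Real.norm_of_nonneg (by positivity), sc, abs_div,
        abs_mul, abs_of_pos h2]
      rw [show |(-2:ℝ)| = 2 by norm_num]
      field_simp
      rw [pow_succ]
    simp only [e]
    rw [show (0:ℝ) = 2 * R * 0 by ring]
    apply Filter.Tendsto.const_mul
    apply Filter.Tendsto.inv_tendsto_atTop
    apply Filter.tendsto_atTop_add_const_right
    exact (tendsto_pow_atTop_atTop_of_one_lt (by norm_num : (1:ℝ) < 2)).comp (Filter.tendsto_add_atTop_nat 1)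

theorem sc_summable' (x : ℝ) (hx : 0 < x) : Summable fun j => sc j * x ^ j := by
  apply Summable.of_norm
  refine (sc_summable x hx).congr fun j => ?_
  rw [norm_mul, Real.norm_eq_abs, Real.norm_of_nonneg (by positivity)]

def sF (x : ℝ) : ℝ := ∑' j, sc j * x ^ j

theorem sF_double (x : ℝ) (hx : 0 < x) : sF (2 * x) = (1 - 2 * x) * sF x := by
  have h1 := sc_summable' x hx
  have h2 := sc_summable' (2 * x) (by positivity)
  have h3 : sF (2 * x) - sF x = ∑' j, sc j * (2 ^ j - 1) * x ^ j := by
    unfold sF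
    rw [← h2.tsum_sub h1]
    exact tsum_congr fun j => by rw [mul_pow]; ring
  have h4 : Summable fun j => sc j * (2 ^ j - 1) * x ^ j := (h2.sub h1).congr fun j => by
    rw [mul_pow]; ring
  rw [h4.tsum_eq_zero_add] at h3
  have h5 : ∑' j, sc (j+1) * (2 ^ (j+1) - 1) * x ^ (j+1) = -2 * x * sF x := by
    unfold sF
    rw [← tsum_mul_left]
    exact tsum_congr fun j => by rw [sc_succ]; ring
  rw [h5] at h3
  norm_num at h3
  linarith

theorem sF_zero (m : ℕ) : sF (2 ^ m) = 0 := by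
  induction m with
  | zero =>
    have := sF_double (1/2) (by norm_num)
    norm_num at this
    simpa using this
  | succ m ih => rw [pow_succ, mul_comm, sF_double _ (by positivity), ih, mul_zero]

def sM (m : ℕ) : ℝ := ∑' j, sc j * (2 ^ m) ^ j / (1 + 2 ^ j)

theorem sM_summable (m : ℕ) : Summable fun j => |sc j| * (2 ^ m) ^ j / (1 + 2 ^ j) := by
  refine Summable.of_nonneg_of_le (fun j => by positivity) (fun j => ?_) (sc_summable (2 ^ m) (by positivity))
  apply div_le_self (by positivity)
  have : (0:ℝ) < 2 ^ j := by positivity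
  linarith

theorem sM_summable' (m : ℕ) : Summable fun j => sc j * (2 ^ m) ^ j / (1 + 2 ^ j) := by
  apply Summable.of_norm
  refine (sM_summable m).congr fun j => ?_
  rw [norm_div, norm_mul, Real.norm_eq_abs (sc j), Real.norm_of_nonneg (by positivity),
    Real.norm_of_nonneg (by positivity)]

theorem sM_succ (m : ℕ) : sM (m + 1) = - sM m := by
  have : sM m + sM (m + 1) = sF (2 ^ m) := by
    unfold sM sF
    rw [← (sM_summable' m).tsum_add (sM_summable' (m+1))]
    refine tsum_congr fun j => ?_
    have : (1:ℝ) + 2 ^ j ≠ 0 := by positivity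
    rw [← add_div, div_eq_iff this, pow_succ, mul_pow]
    ring
  rw [sF_zero] at this
  linarith

theorem sc_tail (j : ℕ) : |sc (j + 4)| ≤ 16 / 315 * (1 / 2) ^ j := by
  induction j with
  | zero => norm_num [sc, abs_div]
  | succ j ih =>
    rw [show j + 1 + 4 = (j + 4) + 1 by ring, sc, abs_div, abs_mul, abs_of_pos (two_pow_sub_pos _)]
    rw [show |(-2:ℝ)| = 2 by norm_num, div_le_iff₀ (two_pow_sub_pos _), pow_succ]
    have h5 : (32:ℝ) ≤ 2 ^ (j + 4 + 1) := by
      have : (1:ℝ) ≤ 2 ^ j := one_le_pow₀ (by norm_num)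
      rw [show j + 4 + 1 = j + 5 by ring, pow_add]; linarith
    have h6 : (0:ℝ) < 16 / 315 * (1 / 2) ^ j := by positivity
    nlinarith

theorem sM_ne : sM 0 ≠ 0 := by
  have h := sM_summable' 0
  have h1 := h.sum_add_tsum_nat_add 4
  have h2 : |∑' j, sc (j+4) * (2 ^ 0) ^ (j+4) / (1 + 2 ^ (j+4))| ≤ 16 / 315 / 17 * 2 := by
    have hg : HasSum (fun j : ℕ => 16 / 315 / 17 * (1 / 2 : ℝ) ^ j) (16 / 315 / 17 * 2) :=
      hasSum_geometric_two.mul_left _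
    have := tsum_of_norm_bounded hg (f := fun j => sc (j+4) * (2 ^ 0) ^ (j+4) / (1 + 2 ^ (j+4))) (fun j => by
      rw [pow_zero, one_pow, mul_one, norm_div, Real.norm_eq_abs, Real.norm_of_nonneg (by positivity)]
      have h3 := sc_tail j
      have h4 : (17:ℝ) ≤ 1 + 2 ^ (j + 4) := by
        have : (1:ℝ) ≤ 2 ^ j := one_le_pow₀ (by norm_num)
        rw [pow_add]; linarith
      calc |sc (j + 4)| / (1 + 2 ^ (j + 4)) ≤ (16 / 315 * (1 / 2) ^ j) / 17 := by gcongr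
        _ = _ := by ring)
    simpa using this
  intro h0
  unfold sM at h0
  rw [h0] at h1
  have h5 : ∑ i ∈ Finset.range 4, sc i * (2 ^ 0) ^ i / (1 + 2 ^ i) > 0.05 := by
    simp only [Finset.sum_range_succ, Finset.sum_range_zero, sc]
    norm_num
  rw [abs_le] at h2
  norm_num at h2 h5
  norm_num at h1
  linarith [h2.1]

def sa (j : ℕ) : ℝ := sc j / (1 + 2 ^ j) / sM 0

theorem sM_eq (m : ℕ) : sM m = (-1) ^ m * sM 0 := by
  induction m with
  | zero => simp
  | succ m ih => rw [sM_succ, ih, pow_succ]; ring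

theorem sa_summable (m : ℕ) : Summable fun j => |sa j| * (2 ^ m) ^ j := by
  refine ((sM_summable m).div_const |sM 0|).congr fun j => ?_
  unfold sa
  rw [abs_div, abs_div, abs_of_pos (show (0:ℝ) < 1 + 2 ^ j by positivity)]
  ring

theorem sa_hasSum (m : ℕ) : HasSum (fun j => sa j * (-(2:ℝ) ^ j) ^ m) 1 := by
  have h := ((sM_summable' m).hasSum.div_const (sM 0)).mul_left ((-1) ^ m)
  have e : (-1) ^ m * ((∑' j, sc j * (2 ^ m) ^ j / (1 + 2 ^ j)) / sM 0) = 1 := by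
    change (-1) ^ m * (sM m / sM 0) = 1
    rw [sM_eq, mul_div_assoc, div_self sM_ne, mul_one, ← mul_pow]; norm_num
  rw [e] at h
  have e2 : (fun j => sa j * (-(2:ℝ) ^ j) ^ m) =
      fun j => (-1) ^ m * (sc j * (2 ^ m) ^ j / (1 + 2 ^ j) / sM 0) := by
    funext j
    unfold sa
    rw [neg_pow, ← pow_mul, ← pow_mul, mul_comm j m]
    ring
  rw [e2]
  exact h

def sP (j : ℕ) (f : ℝ → ℂ) (z : ℝ) : ℂ := ∑' i : ℕ, ((sa i * (-(2:ℝ) ^ i) ^ j : ℝ) : ℂ) * f (-2 ^ i * z)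

def sB (j i : ℕ) : ℝ := |sa i| * (2 ^ (j + 1)) ^ i

theorem sP_term (j : ℕ) (f : ℝ → ℂ) {B : ℝ} (hf : ∀ z, ‖f z‖ ≤ B * (1 + |z|)) (z : ℝ) (i : ℕ) :
    ‖((sa i * (-(2:ℝ) ^ i) ^ j : ℝ) : ℂ) * f (-2 ^ i * z)‖ ≤ sB j i * (B * (1 + |z|)) := by
  have hB : 0 ≤ B := by have := (norm_nonneg _).trans (hf 0); simpa using this
  have h2 : (1:ℝ) ≤ 2 ^ i := one_le_pow₀ (by norm_num)
  have h1 : ‖((sa i * (-(2:ℝ) ^ i) ^ j : ℝ) : ℂ)‖ = |sa i| * (2 ^ j) ^ i := by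
    rw [Complex.norm_real, norm_mul, norm_pow, norm_neg, Real.norm_eq_abs,
      Real.norm_of_nonneg (by positivity), ← pow_mul, ← pow_mul, mul_comm i j]
  rw [norm_mul, h1]
  calc |sa i| * (2 ^ j) ^ i * ‖f (-2 ^ i * z)‖ ≤ |sa i| * (2 ^ j) ^ i * (B * (1 + |-2 ^ i * z|)) := by
        gcongr; exact hf _
    _ = |sa i| * (2 ^ j) ^ i * (B * (1 + 2 ^ i * |z|)) := by
        rw [abs_mul, abs_neg, abs_of_pos (by positivity : (0:ℝ) < 2 ^ i)]
    _ ≤ |sa i| * (2 ^ j) ^ i * (B * (2 ^ i * (1 + |z|))) := by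
        gcongr; nlinarith [abs_nonneg z]
    _ = _ := by unfold sB; rw [pow_succ, mul_pow]; ring

theorem sP_norm (j : ℕ) (f : ℝ → ℂ) {B : ℝ} (hf : ∀ z, ‖f z‖ ≤ B * (1 + |z|)) (z : ℝ) :
    ‖sP j f z‖ ≤ (∑' i, sB j i) * (B * (1 + |z|)) :=
  tsum_of_norm_bounded ((sa_summable (j+1)).hasSum.mul_right _) (sP_term j f hf z)

theorem sP_summable (j : ℕ) (f : ℝ → ℂ) {B : ℝ} (hf : ∀ z, ‖f z‖ ≤ B * (1 + |z|)) (z : ℝ) :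
    Summable fun i : ℕ => ((sa i * (-(2:ℝ) ^ i) ^ j : ℝ) : ℂ) * f (-2 ^ i * z) :=
  Summable.of_norm_bounded ((sa_summable (j+1)).mul_right (B * (1 + |z|))) (sP_term j f hf z)

theorem sP_cont (j : ℕ) (f : ℝ → ℂ) (hc : Continuous f) {B : ℝ} (hf : ∀ z, ‖f z‖ ≤ B * (1 + |z|)) :
    Continuous (sP j f) := by
  have hB : 0 ≤ B := by have := (norm_nonneg _).trans (hf 0); simpa using this
  rw [continuous_iff_continuousAt]
  intro z
  have : ContinuousOn (sP j f) (Metric.ball 0 (|z| + 1)) := by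
    refine continuousOn_tsum (u := fun i => sB j i * (B * (1 + (|z| + 1)))) (fun i => ?_)
      ((sa_summable (j+1)).mul_right _) fun i x hx => ?_
    · exact (continuous_const.mul (hc.comp (continuous_const.mul continuous_id))).continuousOn
    · refine (sP_term j f hf x i).trans ?_
      have : 0 ≤ sB j i := by unfold sB; positivity
      have hx' : |x| ≤ |z| + 1 := by simpa using (mem_ball_zero_iff.1 hx).le
      gcongr
  exact this.continuousAt (Metric.isOpen_ball.mem_nhds (by simp))

theorem sP_zero (j : ℕ) (f : ℝ → ℂ) : sP j f 0 = f 0 := by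
  unfold sP
  simp only [mul_zero]
  rw [tsum_mul_right]
  have := (Complex.ofRealCLM.hasSum (sa_hasSum j)).tsum_eq
  simp only [Complex.ofRealCLM_apply] at this
  rw [this]; simp

theorem sP_int (j : ℕ) (f f' : ℝ → ℂ) (hc' : Continuous f') {B B' : ℝ}
    (hf : ∀ z, ‖f z‖ ≤ B * (1 + |z|)) (hf' : ∀ z, ‖f' z‖ ≤ B' * (1 + |z|))
    (hInn : ∀ a b, a ≤ b → b ≤ 0 → f b - f a = ∫ z in a..b, f' z) (b : ℝ) (hb : 0 ≤ b) :
    ∫ z in (0:ℝ)..b, sP (j+1) f' z = sP j f b - f 0 := by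
  have hB' : 0 ≤ B' := by have := (norm_nonneg _).trans (hf' 0); simpa using this
  have h1 := intervalIntegral.hasSum_integral_of_dominated_convergence (a := 0) (b := b) (μ := volume)
    (F := fun (i:ℕ) z => ((sa i * (-(2:ℝ) ^ i) ^ (j+1) : ℝ) : ℂ) * f' (-2 ^ i * z)) (f := sP (j+1) f')
    (fun i _ => sB (j+1) i * (B' * (1 + b))) (fun i => by
      apply Continuous.aestronglyMeasurable
      exact continuous_const.mul (hc'.comp (continuous_const.mul continuous_id)))
    (fun i => Filter.Eventually.of_forall fun z hz => by
      refine (sP_term (j+1) f' hf' z i).trans ?_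
      have : 0 ≤ sB (j+1) i := by unfold sB; positivity
      rw [Set.uIoc_of_le hb] at hz
      have hx' : |z| ≤ b := by rw [abs_of_pos hz.1]; exact hz.2
      gcongr)
    (Filter.Eventually.of_forall fun z hz => (sa_summable (j+2)).mul_right _)
    (by simp)
    (Filter.Eventually.of_forall fun z hz => (sP_summable (j+1) f' hf' z).hasSum)
  rw [← h1.tsum_eq, ← sP_zero j f]
  unfold sP
  rw [← (sP_summable j f hf b).tsum_sub (sP_summable j f hf 0)]
  refine tsum_congr fun i => ?_
  have h2 : (0:ℝ) < 2 ^ i := by positivity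
  rw [intervalIntegral.integral_const_mul, ← mul_sub, intervalIntegral.integral_comp_mul_left _ (by simp),
    mul_zero, intervalIntegral.integral_symm, ← hInn _ _ (by nlinarith) le_rfl]
  have h3 : (2:ℂ)^i ≠ 0 := pow_ne_zero _ (by norm_num)
  rw [Complex.real_smul, pow_succ]
  push_cast
  field_simp
  ring

theorem seeley {n : ℕ} (g : ℕ → SF n) (hg : ∀ j, DD (g j) (g (j+1))) :
    ∃ G : ℕ → SF n, (∀ j, Reg (G j)) ∧ (∀ j k z, z ≤ 0 → G j k z = g j k z) ∧
      ∀ j k z, HasDerivAt (G j k) (G (j+1) k z) z := by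
  let G : ℕ → SF n := fun j k z => g j k (min z 0) - g j k 0 + sP j (g j k) (max z 0)
  have hbd : ∀ j k, ∃ B, ∀ z, ‖g j k z‖ ≤ B * (1 + |z|) := fun j k => by
    obtain ⟨B, hB⟩ := (hg j).left.bnd 0
    exact ⟨B, fun z => (hB z).le k⟩
  have hreg : ∀ j, Reg (G j) := by
    intro j
    constructor
    · intro k
      obtain ⟨B, hB⟩ := hbd j k
      have hc := (hg j).left.cont k
      have := sP_cont j _ hc hB
      fun_prop
    · intro s
      obtain ⟨B, hB⟩ := (hg j).left.bnd s
      have hB0 : 0 ≤ B := by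
        have := (by positivity : 0 ≤ (1 + ‖(0:KK n)‖) ^ s * ‖g j 0 0‖).trans (hB 0 0)
        simpa using this
      have hS : 0 ≤ ∑' i, sB j i := tsum_nonneg fun i => by unfold sB; positivity
      refine ⟨B + B + (∑' i, sB j i) * B, fun z k => ?_⟩
      have hw : (0:ℝ) < (1 + ‖k‖) ^ s := by positivity
      have hb : ∀ z, ‖g j k z‖ ≤ (B / (1 + ‖k‖) ^ s) * (1 + |z|) := fun z => by
        rw [div_mul_eq_mul_div, le_div_iff₀ hw, mul_comm]; exact hB z k
      have h1 := hb (min z 0)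
      have h2 := hb 0
      have h3 := sP_norm j _ hb (max z 0)
      have hm1 : |min z 0| ≤ |z| := by
        rcases le_total z 0 with h | h <;> simp [h]
      have hm2 : |max z 0| ≤ |z| := by
        rcases le_total z 0 with h | h <;> simp [h]
      set b := B / (1 + ‖k‖) ^ s with hbdef
      have hb0 : 0 ≤ b := by positivity
      have hbB : (1 + ‖k‖) ^ s * b = B := by rw [hbdef]; field_simp
      calc (1 + ‖k‖) ^ s * ‖G j k z‖ ≤ (1 + ‖k‖) ^ s * (b * (1 + |z|) + b * (1 + |z|) + (∑' i, sB j i) * (b * (1 + |z|))) := by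
            gcongr
            refine (norm_add_le _ _).trans (add_le_add ((norm_sub_le _ _).trans (add_le_add ?_ ?_)) ?_)
            · refine h1.trans ?_; gcongr
            · refine h2.trans ?_; rw [abs_zero]; gcongr; exact abs_nonneg z
            · refine h3.trans ?_; gcongr
        _ = ((1 + ‖k‖) ^ s * b) * (1 + |z|) * (2 + ∑' i, sB j i) := by ring
        _ = _ := by rw [hbB]; ring
  have hneg : ∀ j k z, z ≤ 0 → G j k z = g j k z := by
    intro j k z hz
    simp only [G]
    rw [min_eq_left hz, max_eq_right hz, sP_zero]; ring
  have hpos : ∀ j k z, 0 ≤ z → G j k z = sP j (g j k) z := by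
    intro j k z hz
    simp only [G]
    rw [min_eq_right hz, max_eq_left hz]; ring
  refine ⟨G, hreg, hneg, fun j k z => ?_⟩
  have key : ∀ b, G j k b = g j k 0 + ∫ z in (0:ℝ)..b, G (j+1) k z := by
    intro b
    rcases le_total b 0 with hb | hb
    · rw [hneg _ _ _ hb, intervalIntegral.integral_symm,
        intervalIntegral.integral_congr (g := g (j+1) k), ← (hg j).int k b 0 hb le_rfl]
      · ring
      · intro x hx
        rw [Set.uIcc_of_le hb] at hx
        exact hneg _ _ _ hx.2
    · obtain ⟨B, hB⟩ := hbd j k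
      obtain ⟨B', hB'⟩ := hbd (j+1) k
      rw [hpos _ _ _ hb, intervalIntegral.integral_congr (g := sP (j+1) (g (j+1) k)),
        sP_int j _ _ ((hg (j+1)).left.cont k) hB hB' ((hg j).int k) b hb]
      · ring
      · intro x hx
        rw [Set.uIcc_of_le hb] at hx
        exact hpos _ _ _ hx.1
  rw [show G j k = fun b => g j k 0 + ∫ z in (0:ℝ)..b, G (j+1) k z from funext key]
  exact (((hreg (j+1)).cont k).integral_hasStrictDerivAt 0 z).hasDerivAt.const_add _
end HS

namespace HS
set_option linter.unusedSectionVars false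

/-! ### Part H: Fourier series -/

variable {n : ℕ}

def eA (k : KK n) : (Fin n → ℝ) →L[ℝ] ℂ := ∑ i, (ContinuousLinearMap.proj (R := ℝ) (φ := fun _ : Fin n => ℝ) i).smulRight (κ i k)

theorem eA_apply (k : KK n) (x : Fin n → ℝ) : eA k x = ∑ i, (x i : ℂ) * κ i k := by
  simp [eA, ContinuousLinearMap.sum_apply]

def ee (k : KK n) (x : Fin n → ℝ) : ℂ := Complex.exp (eA k x)

theorem eA_add (k m : KK n) : eA (k + m) = eA k + eA m := by
  ext x
  simp only [eA_apply, ContinuousLinearMap.add_apply, ← Finset.sum_add_distrib, κ, Pi.add_apply]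
  refine Finset.sum_congr rfl fun i _ => ?_
  push_cast; ring

theorem eA_zero : eA (0 : KK n) = 0 := by
  ext x; simp [eA_apply, κ]

theorem ee_add (k m : KK n) (x) : ee (k + m) x = ee k x * ee m x := by
  rw [ee, eA_add, ContinuousLinearMap.add_apply, Complex.exp_add]; rfl

theorem ee_zero (x : Fin n → ℝ) : ee 0 x = 1 := by simp [ee, eA_zero]

theorem eA_conj (k : KK n) (x) : starRingEnd ℂ (eA k x) = eA (-k) x := by
  simp only [eA_apply, map_sum, map_mul, Complex.conj_ofReal]
  refine Finset.sum_congr rfl fun i _ => ?_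
  simp only [κ, map_mul, map_ofNat, Complex.conj_ofReal, Complex.conj_I, map_intCast, Pi.neg_apply]
  push_cast; ring

theorem ee_conj (k : KK n) (x) : starRingEnd ℂ (ee k x) = ee (-k) x := by
  rw [ee, ← Complex.exp_conj, eA_conj, ee]

theorem ee_norm (k : KK n) (x) : ‖ee k x‖ = 1 := by
  rw [ee, Complex.norm_exp]
  have : (eA k x).re = 0 := by
    rw [eA_apply, Complex.re_sum]
    exact Finset.sum_eq_zero fun i _ => by simp [κ]
  rw [this, Real.exp_zero]

theorem ee_hasFDerivAt (k : KK n) (x) : HasFDerivAt (ee k) (ee k x • eA k) x :=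
  (eA k).hasFDerivAt.cexp

theorem ee_contDiff (k : KK n) : ContDiff ℝ (⊤ : ℕ∞) (ee k) := (eA k).contDiff.cexp

theorem eA_single (k : KK n) (i : Fin n) : eA k (Pi.single i 1) = κ i k := by
  rw [eA_apply, Finset.sum_eq_single i] <;> simp +contextual [Pi.single_apply]

def CPer (a : (Fin n → ℝ) → ℂ) : Prop := ∀ (x : Fin n → ℝ) (k : KK n), a (x + fun i => (k i : ℝ)) = a x

theorem ee_per (k : KK n) : CPer (ee k) := by
  intro x m
  rw [ee, map_add, Complex.exp_add, ← ee]
  have : Complex.exp (eA k fun i => (m i : ℝ)) = 1 := by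
    rw [Complex.exp_eq_one_iff]
    refine ⟨∑ i, m i * k i, ?_⟩
    rw [eA_apply]; push_cast
    rw [Finset.sum_mul]
    refine Finset.sum_congr rfl fun i _ => ?_
    simp only [κ]; push_cast; ring
  rw [this, mul_one]

def cb (n : ℕ) : Set (Fin n → ℝ) := Set.Icc 0 1

theorem cb_compact : IsCompact (cb n) := isCompact_Icc

theorem int_pd (a : (Fin n → ℝ) → ℂ) (ha : ContDiff ℝ 1 a) (hp : CPer a) (i : Fin n) :
    ∫ x in cb n, fderiv ℝ a x (Pi.single i 1) = 0 := by
  obtain ⟨m, rfl⟩ : ∃ m, n = m + 1 := ⟨n - 1, by have := i.2; omega⟩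
  have hd : Differentiable ℝ a := ha.differentiable (by norm_num)
  have h := integral_divergence_of_hasFDerivAt_off_countable' (E := ℂ) (n := m) 0 1 zero_le_one
    (fun j => if j = i then a else 0) (fun j => if j = i then fderiv ℝ a else 0) ∅ Set.countable_empty
    (fun j => by
      by_cases hj : j = i
      · simp only [hj, if_true]; exact ha.continuous.continuousOn
      · simp only [hj, if_false]; exact continuousOn_const)
    (fun x _ j => by
      by_cases hj : j = i
      · simp only [hj, if_true]; exact (hd x).hasFDerivAt
      · simp only [hj, if_false]; exact hasFDerivAt_const (0:ℂ) x)
    (by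
      apply ContinuousOn.integrableOn_Icc
      apply Continuous.continuousOn
      refine continuous_finset_sum _ fun j _ => ?_
      by_cases hj : j = i
      · simp only [hj, if_true]; exact (ha.continuous_fderiv (by norm_num)).clm_apply continuous_const
      · simp only [hj, if_false]; exact continuous_const)
  have e1 : ∀ x, ∑ j, (if j = i then fderiv ℝ a else 0) x (Pi.single j 1) = fderiv ℝ a x (Pi.single i 1) := by
    intro x
    rw [Finset.sum_eq_single i]
    · simp
    · intro j _ hj; simp [hj]
    · simp
  simp only [e1] at h
  rw [cb, h]
  refine Finset.sum_eq_zero fun j _ => ?_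
  by_cases hj : j = i
  · subst hj
    rw [sub_eq_zero]
    refine integral_congr_ae (Filter.Eventually.of_forall fun y => ?_)
    simp only [if_true]
    have := hp (j.insertNth ((0 : Fin (m+1) → ℝ) j) y) (Pi.single j 1)
    rw [← this]
    congr 1
    funext l
    rcases Fin.eq_self_or_eq_succAbove j l with rfl | ⟨l', rfl⟩
    · simp
    · simp
  · simp [hj]


theorem ee_cont (k : KK n) : Continuous (ee k) := (ee_contDiff k).continuous

def fc (a : (Fin n → ℝ) → ℂ) (k : KK n) : ℂ := ∫ x in cb n, ee (-k) x * a x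

def SS (y : KK n → ℂ) (x : Fin n → ℝ) : ℂ := ∑' k, y k * ee k x

def cpd (a : (Fin n → ℝ) → ℂ) (i : Fin n) (x : Fin n → ℝ) : ℂ := fderiv ℝ a x (Pi.single i 1)

theorem cpd_smooth {a : (Fin n → ℝ) → ℂ} (ha : ContDiff ℝ (⊤ : ℕ∞) a) (i : Fin n) :
    ContDiff ℝ (⊤ : ℕ∞) (cpd a i) :=
  (ha.fderiv_right (m := (⊤ : ℕ∞)) (by simp)).clm_apply contDiff_const

theorem cpd_per {a : (Fin n → ℝ) → ℂ} (hp : CPer a) (i : Fin n) : CPer (cpd a i) := by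
  intro x k
  unfold cpd
  have : (fun y => a (y + fun i => (k i : ℝ))) = a := funext fun y => hp y k
  rw [← fderiv_comp_add_right, this]

theorem fc_cpd {a : (Fin n → ℝ) → ℂ} (ha : ContDiff ℝ (⊤ : ℕ∞) a) (hp : CPer a) (i : Fin n) (k : KK n) :
    fc (cpd a i) k = κ i k * fc a k := by
  have hd : Differentiable ℝ a := ha.differentiable (by simp)
  have h := int_pd (fun x => ee (-k) x * a x) (((ee_contDiff (-k)).mul ha).of_le (by simp))
    (fun x m => by simp only [ee_per (-k) x m, hp x m]) i
  have e : ∀ x, fderiv ℝ (fun x => ee (-k) x * a x) x (Pi.single i 1)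
      = ee (-k) x * cpd a i x - κ i k * (ee (-k) x * a x) := by
    intro x
    have hm : HasFDerivAt (fun x => ee (-k) x * a x) _ x := (ee_hasFDerivAt (-k) x).mul (hd x).hasFDerivAt
    rw [hm.fderiv]
    simp only [ContinuousLinearMap.add_apply, ContinuousLinearMap.smul_apply, eA_single, cpd, smul_eq_mul]
    have : κ i (-k) = - κ i k := by simp [κ]
    rw [this]; ring
  simp only [e] at h
  have hc1 : Continuous (cpd a i) := (cpd_smooth ha i).continuous
  have hc2 := ha.continuous
  have hc3 := ee_cont (-k)
  rw [integral_sub, integral_const_mul, sub_eq_zero] at h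
  · exact h
  · exact Continuous.integrableOn_Icc (by fun_prop)
  · exact Continuous.integrableOn_Icc (by fun_prop)

theorem per_bdd {a : (Fin n → ℝ) → ℂ} (ha : Continuous a) (hp : CPer a) : ∃ C, ∀ x, ‖a x‖ ≤ C := by
  obtain ⟨C, hC⟩ := (cb_compact (n := n)).exists_bound_of_continuousOn ha.continuousOn
  refine ⟨C, fun x => ?_⟩
  have := hp x (fun i => -⌊x i⌋)
  rw [← this]
  apply hC
  constructor
  · intro i
    have := Int.fract_nonneg (x i)
    simp only [Int.fract] at this
    simp only [Pi.add_apply, Int.cast_neg, Pi.zero_apply]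
    linarith
  · intro i
    have := (Int.fract_lt_one (x i)).le
    simp only [Int.fract] at this
    simp only [Pi.add_apply, Int.cast_neg, Pi.one_apply]
    linarith

theorem cb_vol : volume (cb n) = 1 := by simp [cb, Real.volume_Icc_pi]

theorem fc_norm_le {a : (Fin n → ℝ) → ℂ} {C : ℝ} (hC : ∀ x ∈ cb n, ‖a x‖ ≤ C) (k : KK n) : ‖fc a k‖ ≤ C := by
  have h := norm_setIntegral_le_of_norm_le_const (μ := volume) (s := cb n) (f := fun x => ee (-k) x * a x) (C := C)
    (by rw [cb_vol]; simp) (fun x hx => by rw [norm_mul, ee_norm, one_mul]; exact hC x hx)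
  simpa [fc, measureReal_def, cb_vol] using h

theorem norm_le_sum (k : KK n) : ‖k‖ ≤ ∑ i, ‖κ i k‖ := by
  rw [pi_norm_le_iff_of_nonneg (Finset.sum_nonneg fun i _ => norm_nonneg _)]
  intro i
  refine le_trans ?_ (Finset.single_le_sum (f := fun i => ‖κ i k‖) (fun i _ => norm_nonneg _) (Finset.mem_univ i))
  rw [κ_norm, Int.norm_eq_abs]
  have := Real.pi_gt_three
  nlinarith [abs_nonneg (k i : ℝ)]

theorem fc_RD {a : (Fin n → ℝ) → ℂ} (ha : ContDiff ℝ (⊤ : ℕ∞) a) (hp : CPer a) : RD (fc a) := by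
  intro s
  induction s generalizing a with
  | zero =>
    obtain ⟨C, hC⟩ := per_bdd ha.continuous hp
    exact ⟨C, fun k => by simpa using fc_norm_le (fun x _ => hC x) k⟩
  | succ s ih =>
    obtain ⟨C, hC⟩ := ih ha hp
    choose D hD using fun i => ih (cpd_smooth ha i) (cpd_per hp i)
    refine ⟨C + ∑ i, D i, fun k => ?_⟩
    have h1 := hC k
    have h2 : ∑ i, (1 + ‖k‖) ^ s * ‖fc (cpd a i) k‖ ≤ ∑ i, D i := Finset.sum_le_sum fun i _ => hD i k
    simp only [fc_cpd ha hp, norm_mul] at h2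
    have h3 := norm_le_sum k
    calc (1 + ‖k‖) ^ (s + 1) * ‖fc a k‖ = (1 + ‖k‖) ^ s * ‖fc a k‖ + (1 + ‖k‖) ^ s * (‖k‖ * ‖fc a k‖) := by ring
      _ ≤ (1 + ‖k‖) ^ s * ‖fc a k‖ + (1 + ‖k‖) ^ s * ((∑ i, ‖κ i k‖) * ‖fc a k‖) := by gcongr
      _ = (1 + ‖k‖) ^ s * ‖fc a k‖ + ∑ i, (1 + ‖k‖) ^ s * (‖κ i k‖ * ‖fc a k‖) := by
        rw [Finset.sum_mul, Finset.mul_sum]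
      _ ≤ _ := add_le_add h1 h2

theorem fc_conj (a : (Fin n → ℝ) → ℝ) (k : KK n) :
    fc (fun x => (a x : ℂ)) (-k) = starRingEnd ℂ (fc (fun x => (a x : ℂ)) k) := by
  unfold fc
  rw [← integral_conj]
  simp only [map_mul, ee_conj, Complex.conj_ofReal]

open UnitAddTorus in
theorem ee_mFourier (k : KK n) (x : Fin n → ℝ) : mFourier k (fun i => (x i : UnitAddCircle)) = ee k x := by
  simp only [mFourier, ContinuousMap.coe_mk, ee, eA_apply, Complex.exp_sum, fourier_coe_apply]
  refine Finset.prod_congr rfl fun i _ => ?_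
  congr 1
  simp only [κ]; push_cast; ring

theorem Icc_Ioc : (cb n) =ᵐ[volume] {x : Fin n → ℝ | ∀ i, x i ∈ Set.Ioc ((0 : Fin n → ℝ) i) ((0 : Fin n → ℝ) i + 1)} := by
  have := (Measure.univ_pi_Ioc_ae_eq_Icc (μ := fun _ : Fin n => (volume : Measure ℝ)) (f := 0) (g := 1)).symm
  rw [← volume_pi] at this
  refine this.trans (Filter.EventuallyEq.of_eq ?_)
  ext x
  constructor
  · intro h i
    simpa using h i (Set.mem_univ i)
  · intro h i _
    simpa using h i

open UnitAddTorus in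
theorem inversion {a : (Fin n → ℝ) → ℂ} (ha : ContDiff ℝ (⊤ : ℕ∞) a) (hp : CPer a) (x : Fin n → ℝ) :
    HasSum (fun k => fc a k * ee k x) (a x) := by
  let π : (Fin n → ℝ) → UnitAddTorus (Fin n) := fun x i => (x i : UnitAddCircle)
  have hπ : IsOpenQuotientMap π := IsOpenQuotientMap.piMap fun _ => QuotientAddGroup.isOpenQuotientMap_mk
  let f0 : UnitAddTorus (Fin n) → ℂ := fun t => a (Function.surjInv hπ.surjective t)
  have hf0 : ∀ x, f0 (π x) = a x := by
    intro x
    have h1 := Function.surjInv_eq hπ.surjective (π x)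
    set y := Function.surjInv hπ.surjective (π x) with hy
    have h2 : ∀ i, ∃ m : ℤ, y i + m = x i := by
      intro i
      have := congrFun h1 i
      simp only [π] at this
      obtain ⟨m, hm⟩ := AddSubgroup.mem_zmultiples_iff.1 ((QuotientAddGroup.eq).1 this)
      refine ⟨m, ?_⟩
      simp at hm; linarith
    choose m hm using h2
    have h3 := hp y m
    rw [show (y + fun i => (m i : ℝ)) = x from funext hm] at h3
    exact h3.symm
  have hcont : Continuous f0 := by
    rw [← hπ.continuous_comp_iff]
    have : f0 ∘ π = a := funext hf0
    rw [this]; exact ha.continuous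
  let f : C(UnitAddTorus (Fin n), ℂ) := ⟨f0, hcont⟩
  have hco : mFourierCoeff f = fc a := by
    funext k
    rw [mFourierCoeff_eq_integral f k 0, fc, setIntegral_congr_set Icc_Ioc]
    refine integral_congr_ae (Filter.Eventually.of_forall fun x => ?_)
    change mFourier (-k) (fun i => (x i : UnitAddCircle)) • f0 (π x) = _
    rw [ee_mFourier, hf0, smul_eq_mul]
  have hs : Summable (mFourierCoeff f) := by
    rw [hco]; exact (fc_RD ha hp).summable_norm.of_norm
  have := hasSum_mFourier_series_apply_of_summable hs (π x)
  rw [hco] at this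
  change HasSum (fun i => fc a i • mFourier i (π x)) (f0 (π x)) at this
  rw [hf0] at this
  refine this.congr_fun ?_
  intro k
  rw [smul_eq_mul, ← ee_mFourier]

theorem SS_fc {a : (Fin n → ℝ) → ℂ} (ha : ContDiff ℝ (⊤ : ℕ∞) a) (hp : CPer a) : SS (fc a) = a :=
  funext fun x => (inversion ha hp x).tsum_eq

theorem int_ee (k : KK n) (hk : k ≠ 0) : ∫ x in cb n, ee k x = 0 := by
  obtain ⟨i, hi⟩ := Function.ne_iff.1 hk
  have h := int_pd (ee k) ((ee_contDiff k).of_le (by simp)) (ee_per k) i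
  simp only [(ee_hasFDerivAt k _).fderiv, ContinuousLinearMap.smul_apply, eA_single, smul_eq_mul] at h
  rw [integral_mul_const, mul_eq_zero] at h
  refine h.resolve_right ?_
  apply norm_ne_zero_iff.1
  rw [κ_norm]
  have := Real.pi_pos
  have : |(k i : ℝ)| ≠ 0 := by simpa using hi
  positivity

theorem SS_summable {y : KK n → ℂ} (hy : Summable fun k => ‖y k‖) (x) : Summable fun k => y k * ee k x :=
  Summable.of_norm_bounded hy fun k => by rw [norm_mul, ee_norm, mul_one]

theorem fc_SS {y : KK n → ℂ} (hy : RD y) : fc (SS y) = y := by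
  funext m
  have hs := hy.summable_norm
  have h1 : ∀ x, HasSum (fun k => y k * ee (k - m) x) (ee (-m) x * SS y x) := by
    intro x
    refine ((SS_summable hs x).hasSum.mul_left (ee (-m) x)).congr_fun fun k => ?_
    rw [sub_eq_add_neg, ee_add]; ring
  have h2 := hasSum_integral_of_dominated_convergence (μ := volume.restrict (cb n))
    (F := fun k x => y k * ee (k - m) x) (f := fun x => ee (-m) x * SS y x) (fun k _ => ‖y k‖)
    (fun k => (continuous_const.mul (ee_cont _)).aestronglyMeasurable)
    (fun k => Filter.Eventually.of_forall fun x => by rw [norm_mul, ee_norm, mul_one])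
    (Filter.Eventually.of_forall fun x => hs)
    (by
      apply (integrable_const_iff (μ := volume.restrict (cb n))).2
      right
      exact ⟨by simp [cb_vol]⟩)
    (Filter.Eventually.of_forall h1)
  unfold fc
  rw [← h2.tsum_eq, tsum_eq_single m]
  · simp only [sub_self, ee_zero, mul_one]
    simp [measureReal_def, cb_vol]
  · intro k hk
    rw [integral_const_mul, int_ee _ (sub_ne_zero.2 hk), mul_zero]

theorem SS_cv {c y : KK n → ℂ} (hc : RD c) (hy : RD y) (x) : SS (cv c y) x = SS c x * SS y x := by
  have h1 : Summable fun k => ‖c k * ee k x‖ := by simpa [ee_norm] using hc.summable_norm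
  have h2 : Summable fun k => ‖y k * ee k x‖ := by simpa [ee_norm] using hy.summable_norm
  unfold SS
  rw [tsum_mul_tsum_of_summable_norm h1 h2]
  have h3 := summable_mul_of_summable_norm h1 h2
  let σ : KK n × KK n ≃ KK n × KK n :=
    ⟨fun p => (p.2, p.1 - p.2), fun p => (p.1 + p.2, p.1), fun p => by simp, fun p => by simp⟩
  rw [← σ.tsum_eq]
  have h4 : Summable fun p : KK n × KK n => c (σ p).1 * ee (σ p).1 x * (y (σ p).2 * ee (σ p).2 x) :=
    (σ.summable_iff).2 h3
  rw [h4.tsum_prod]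
  refine tsum_congr fun k => ?_
  unfold cv
  rw [← tsum_mul_right]
  refine tsum_congr fun m => ?_
  simp only [σ, Equiv.coe_fn_mk, smul_eq_mul]
  rw [show ee k x = ee m x * ee (k - m) x by rw [← ee_add]; congr 1; abel]
  ring

theorem SS_add {c y : KK n → ℂ} (hc : RD c) (hy : RD y) (x) : SS (fun k => c k + y k) x = SS c x + SS y x := by
  unfold SS
  rw [← (SS_summable hc.summable_norm x).tsum_add (SS_summable hy.summable_norm x)]
  exact tsum_congr fun k => by ring

theorem SS_neg (c : KK n → ℂ) (x) : SS (fun k => - c k) x = - SS c x := by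
  unfold SS
  rw [← tsum_neg]
  exact tsum_congr fun k => by ring

theorem SS_sub {c y : KK n → ℂ} (hc : RD c) (hy : RD y) (x) : SS (fun k => c k - y k) x = SS c x - SS y x := by
  unfold SS
  rw [← (SS_summable hc.summable_norm x).tsum_sub (SS_summable hy.summable_norm x)]
  exact tsum_congr fun k => by ring

theorem SS_sum {ι : Type*} {t : Finset ι} {y : ι → KK n → ℂ} (hy : ∀ i, RD (y i)) (x) :
    SS (fun k => ∑ i ∈ t, y i k) x = ∑ i ∈ t, SS (y i) x := by
  unfold SS
  rw [← Summable.tsum_finsetSum fun i _ => SS_summable (hy i).summable_norm x]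
  exact tsum_congr fun k => by rw [Finset.sum_mul]

/-- the inverse multiplier identity -/
theorem hinv_of (c : Fin n → KK n → ℂ) (hc : ∀ i, RD (c i)) (μ : KK n → ℂ) (hμ : RD μ)
    (h : ∀ x, SS μ x * (1 + ∑ i, SS (c i) x * SS (c i) x) = 1) (y : KK n → EE) (hy : RD y) :
    cv μ (fun k => y k + ∑ i, cv (c i) (cv (c i) y) k) = y := by
  have hL : ∀ (L : EE →L[ℂ] ℂ) (c : KK n → ℂ) (y : KK n → EE), RD c → RD y → ∀ k,
      L (cv c y k) = cv c (fun k => L (y k)) k := by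
    intro L c y hc hy k
    obtain ⟨B, hB⟩ := hy.bdd
    have := L.hasSum (cv_hasSum hc hB k)
    rw [← this.tsum_eq]
    exact tsum_congr fun m => by simp
  have hLR : ∀ (L : EE →L[ℂ] ℂ) (y : KK n → EE), RD y → RD (fun k => L (y k)) := by
    intro L y hy s
    obtain ⟨C, hC⟩ := hy s
    refine ⟨‖L‖ * C, fun k => ?_⟩
    calc (1 + ‖k‖) ^ s * ‖L (y k)‖ ≤ (1 + ‖k‖) ^ s * (‖L‖ * ‖y k‖) := by gcongr; exact L.le_opNorm _
      _ = ‖L‖ * ((1 + ‖k‖) ^ s * ‖y k‖) := by ring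
      _ ≤ _ := by gcongr; exact hC k
  have hcc : ∀ i, RD (cv (c i) (cv (c i) y)) := fun i => (hc i).cv ((hc i).cv hy)
  have hsum : RD (fun k => ∑ i, cv (c i) (cv (c i) y) k) := RD.sum hcc
  funext k
  apply ext_inner_left ℂ
  intro v
  let L : EE →L[ℂ] ℂ := innerSL ℂ v
  change L _ = L _
  rw [hL L _ _ hμ (hy.add hsum)]
  have hyL := hLR L y hy
  set w : KK n → ℂ := fun k => L (y k) with hw
  have e1 : (fun k => L (y k + ∑ i, cv (c i) (cv (c i) y) k)) = fun k => w k + ∑ i, cv (c i) (cv (c i) w) k := by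
    funext k
    rw [map_add, map_sum]
    congr 1
    refine Finset.sum_congr rfl fun i _ => ?_
    rw [hL L _ _ (hc i) ((hc i).cv hy)]
    congr 1
    funext m
    rw [hL L _ _ (hc i) hy]
  rw [e1]
  have hcw : ∀ i, RD (cv (c i) (cv (c i) w)) := fun i => (hc i).cv ((hc i).cv hyL)
  have hs2 : RD (fun k => ∑ i, cv (c i) (cv (c i) w) k) := RD.sum hcw
  have hR := hyL.add hs2
  have e2 : SS (cv μ (fun k => w k + ∑ i, cv (c i) (cv (c i) w) k)) = SS w := by
    funext x
    rw [SS_cv hμ hR, SS_add hyL hs2, SS_sum hcw]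
    have : ∀ i, SS (cv (c i) (cv (c i) w)) x = SS (c i) x * SS (c i) x * SS w x := fun i => by
      rw [SS_cv (hc i) ((hc i).cv hyL), SS_cv (hc i) hyL]; ring
    simp only [this]
    rw [← Finset.sum_mul]
    linear_combination (SS w x) * h x
  have := congrArg fc e2
  rw [fc_SS (hμ.cv hR), fc_SS hyL] at this
  exact congrFun this k

end HS

namespace HS
set_option linter.unusedSectionVars false

/-! ### Part I: smoothness of the Fourier series in (x,z) -/

variable {n : ℕ}

def S2 (w : SF n) (p : (Fin n → ℝ) × ℝ) : ℂ := SS (fun k => w k p.2) p.1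

theorem Reg.RD {w : SF n} (hw : Reg w) (z : ℝ) : RD (fun k => w k z) := by
  intro s
  obtain ⟨B, hB⟩ := hw.bnd s
  exact ⟨_, hB z⟩

theorem Reg.loc {w : SF n} (hw : Reg w) (R : ℝ) :
    ∃ u : KK n → ℝ, Summable u ∧ ∀ z, |z| ≤ R → ∀ k, ‖w k z‖ ≤ u k := by
  obtain ⟨B, hB⟩ := hw.bnd (2 * n)
  have hB0 : 0 ≤ B := by
    have := (by positivity : 0 ≤ (1 + ‖(0:KK n)‖) ^ (2 * n) * ‖w 0 0‖).trans (hB 0 0)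
    simpa using this
  refine ⟨fun k => B * (1 + R) * ((1 + ‖k‖) ^ (2*n))⁻¹, (summable_base n).mul_left _, fun z hz k => ?_⟩
  simp only []
  rw [← div_eq_mul_inv, le_div_iff₀ (by positivity), mul_comm]
  refine (hB z k).trans ?_
  gcongr

structure Sm (w : ℕ → SF n) : Prop where
  reg : ∀ j, Reg (w j)
  der : ∀ j k z, HasDerivAt (w j k) (w (j+1) k z) z

theorem Sm.shift {w : ℕ → SF n} (h : Sm w) : Sm (fun j => w (j+1)) :=
  ⟨fun j => h.reg (j+1), fun j => h.der (j+1)⟩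

def mulF (a : KK n → ℂ) (w : SF n) : SF n := fun k z => a k * w k z

theorem Sm.mul {w : ℕ → SF n} (h : Sm w) (i : Fin n) : Sm (fun j => mulF (κ i) (w j)) :=
  ⟨fun j => (h.reg j).mul (κ_poly i) pi2, fun j k z => (h.der j k z).const_mul _⟩

theorem Reg.κ {w : SF n} (h : Reg w) (i : Fin n) : Reg (mulF (κ i) w) := h.mul (κ_poly i) pi2

def dz (n : ℕ) : (Fin n → ℝ) × ℝ →L[ℝ] ℂ := Complex.ofRealCLM.comp (ContinuousLinearMap.snd ℝ (Fin n → ℝ) ℝ)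
def dx (i : Fin n) : (Fin n → ℝ) × ℝ →L[ℝ] ℂ := Complex.ofRealCLM.comp
  ((ContinuousLinearMap.proj (R := ℝ) (φ := fun _ : Fin n => ℝ) i).comp (ContinuousLinearMap.fst ℝ (Fin n → ℝ) ℝ))

theorem dz_apply (v : (Fin n → ℝ) × ℝ) : dz n v = (v.2 : ℂ) := rfl
theorem dx_apply (i : Fin n) (v : (Fin n → ℝ) × ℝ) : dx i v = (v.1 i : ℂ) := rfl

theorem S2_hasFDerivAt {w w' : SF n} (hw : Reg w) (hw' : Reg w')
    (hd : ∀ k z, HasDerivAt (w k) (w' k z) z) (p : (Fin n → ℝ) × ℝ) :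
    HasFDerivAt (S2 w) (S2 w' p • dz n + ∑ i, S2 (mulF (κ i) w) p • dx i) p := by
  set R := |p.2| + 1 with hR
  obtain ⟨u, hu, hub⟩ := hw'.loc R
  choose v hv hvb using fun i => (hw.κ i).loc R
  have hV : Summable fun k => u k * ‖dz n‖ + ∑ i, v i k * ‖dx (n := n) i‖ :=
    (hu.mul_right _).add (summable_sum fun i _ => (hv i).mul_right _)
  let s : Set ((Fin n → ℝ) × ℝ) := Set.univ ×ˢ Metric.ball 0 R
  have key := hasFDerivAt_tsum_of_isPreconnected (𝕜 := ℝ) (s := s)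
    (f := fun k (q : (Fin n → ℝ) × ℝ) => w k q.2 * ee k q.1)
    (f' := fun k q => (w' k q.2 * ee k q.1) • dz n + ∑ i, (mulF (κ i) w k q.2 * ee k q.1) • dx i)
    (x₀ := p) (x := p) hV
    (isOpen_univ.prod Metric.isOpen_ball) (isPreconnected_univ.prod (convex_ball _ _).isPreconnected)
    (fun k q _ => by
      have h1 : HasFDerivAt (fun q : (Fin n → ℝ) × ℝ => w k q.2) _ q :=
        (hd k q.2).hasFDerivAt.comp q (hasFDerivAt_snd (𝕜 := ℝ) (p := q))
      have h2 : HasFDerivAt (fun q : (Fin n → ℝ) × ℝ => ee k q.1) _ q :=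
        (ee_hasFDerivAt k q.1).comp q (hasFDerivAt_fst (𝕜 := ℝ) (p := q))
      have h3 : HasFDerivAt (fun q : (Fin n → ℝ) × ℝ => w k q.2 * ee k q.1) _ q := h1.mul h2
      refine h3.congr_fderiv ?_
      ext v
      · simp [dz_apply, dx_apply, eA_apply, mulF, ContinuousLinearMap.sum_apply]
        simp only [Finset.mul_sum]
        exact Finset.sum_congr rfl fun i _ => by ring
      · simp [dz_apply, dx_apply, eA_apply, mulF, ContinuousLinearMap.sum_apply]
        ring)
    (fun k q hq => by
      have hq2 : |q.2| ≤ R := by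
        have := (mem_ball_zero_iff.1 hq.2).le
        simpa using this
      refine (norm_add_le _ _).trans (add_le_add ?_ ((norm_sum_le _ _).trans (Finset.sum_le_sum fun i _ => ?_)))
      · rw [norm_smul, norm_mul, ee_norm, mul_one]
        gcongr; exact hub _ hq2 k
      · rw [norm_smul, norm_mul, ee_norm, mul_one]
        gcongr; exact hvb i _ hq2 k)
    ⟨Set.mem_univ _, by simp [hR]⟩
    (SS_summable (hw.RD p.2).summable_norm p.1)
    ⟨Set.mem_univ _, by simp [hR]⟩
  refine key.congr_fderiv ?_
  apply HasSum.tsum_eq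
  apply HasSum.add
  · exact (SS_summable (hw'.RD p.2).summable_norm p.1).hasSum.smul_const _
  · exact hasSum_sum fun i _ => (SS_summable ((hw.κ i).RD p.2).summable_norm p.1).hasSum.smul_const _

theorem S2_contDiff {w : ℕ → SF n} (hw : Sm w) (N : ℕ) : ContDiff ℝ N (S2 (w 0)) := by
  induction N generalizing w with
  | zero =>
    have : Differentiable ℝ (S2 (w 0)) := fun p =>
      (S2_hasFDerivAt (hw.reg 0) (hw.reg 1) (hw.der 0) p).differentiableAt
    exact contDiff_zero.2 this.continuous
  | succ N ih =>
    push_cast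
    rw [contDiff_succ_iff_fderiv]
    have h := fun p => S2_hasFDerivAt (hw.reg 0) (hw.reg 1) (hw.der 0) p
    refine ⟨fun p => (h p).differentiableAt, by simp, ?_⟩
    rw [show fderiv ℝ (S2 (w 0)) = fun p => S2 (w 1) p • dz n + ∑ i, S2 (mulF (κ i) (w 0)) p • dx i from
      funext fun p => (h p).fderiv]
    refine ContDiff.add ((ih hw.shift).smul contDiff_const) ?_
    exact ContDiff.sum fun i _ => (ih (hw.mul i)).smul contDiff_const

theorem S2_smooth {w : ℕ → SF n} (hw : Sm w) : ContDiff ℝ (⊤ : ℕ∞) (S2 (w 0)) :=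
  contDiff_infty.2 fun N => S2_contDiff hw N

theorem SS_hasFDerivAt {y : KK n → ℂ} (hy : RD y) (x : Fin n → ℝ) (i : Fin n) :
    ∃ L : (Fin n → ℝ) →L[ℝ] ℂ, HasFDerivAt (SS y) L x ∧ ∀ i, L (Pi.single i 1) = SS (fun k => κ i k * y k) x := by
  have h := S2_hasFDerivAt (Reg_const y hy) (Reg.zero (n := n)) (fun k z => hasDerivAt_const z (y k)) (x, 0)
  have h1 : HasFDerivAt (fun x : Fin n → ℝ => (x, (0:ℝ))) (ContinuousLinearMap.inl ℝ _ _) x :=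
    hasFDerivAt_prodMk_left x 0
  have h2 := h.comp x h1
  refine ⟨_, h2, fun j => ?_⟩
  simp only [ContinuousLinearMap.comp_apply, ContinuousLinearMap.add_apply, ContinuousLinearMap.smul_apply,
    ContinuousLinearMap.sum_apply, dz_apply, dx_apply, ContinuousLinearMap.inl_apply]
  rw [Finset.sum_eq_single j]
  · simp [S2, mulF]
  · intro l _ hl; simp [Pi.single_apply, hl]
  · simp

theorem DD.hasDeriv {w v : SF n} (h : DD w v) (k : KK n) {z : ℝ} (hz : z < 0) : HasDerivAt (w k) (v k z) z := by
  have h1 : HasDerivAt (fun b => w k (z - 1) + ∫ s in (z-1)..b, v k s) (v k z) z :=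
    ((h.right.cont k).integral_hasStrictDerivAt (z-1) z).hasDerivAt.const_add _
  refine h1.congr_of_eventuallyEq ?_
  filter_upwards [Ioo_mem_nhds (show z - 1 < z by linarith) hz] with b hb
  rw [← h.int k (z-1) b hb.1.le hb.2.le]; ring

theorem DD.SS_hasDeriv {w v : SF n} (h : DD w v) (x : Fin n → ℝ) {z : ℝ} (hz : z < 0) :
    HasDerivAt (fun z => S2 w (x, z)) (S2 v (x, z)) z := by
  obtain ⟨u, hu, hub⟩ := h.right.loc (|z| + 1)
  have hz' : z ∈ Set.Ioo (z - 1) 0 := ⟨by linarith, hz⟩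
  refine hasDerivAt_tsum_of_isPreconnected (t := Set.Ioo (z-1) 0) (g := fun k z => w k z * ee k x)
    (g' := fun k z => v k z * ee k x) hu isOpen_Ioo isPreconnected_Ioo
    (fun k q hq => (h.hasDeriv k hq.2).mul_const _) (fun k q hq => ?_) hz'
    (SS_summable (h.left.RD z).summable_norm x) hz'
  rw [norm_mul, ee_norm, mul_one]
  apply hub
  rw [abs_of_neg hq.2, abs_of_neg hz]; linarith [hq.1]

end HS

namespace HS
set_option linter.unusedSectionVars false

variable {n : ℕ}

theorem EE_lint (f : EE) : ∫⁻ z, ENNReal.ofReal (‖f z‖ ^ 2) ∂μ0 = ENNReal.ofReal (‖f‖ ^ 2) := by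
  have h1 : Integrable (fun z => ‖f z‖ ^ 2) μ0 := (Lp.memLp f).integrable_norm_pow (by norm_num)
  rw [← ofReal_integral_eq_lintegral_ofReal h1 (Filter.Eventually.of_forall fun z => by positivity)]
  congr 1
  have h2 : inner ℂ f f = ∫ z, inner ℂ (f z) (f z) ∂μ0 := L2.inner_def f f
  simp only [inner_self_eq_norm_sq_to_K] at h2
  have h3 : ∫ z, ((‖f z‖ : ℂ)) ^ 2 ∂μ0 = ((∫ z, ‖f z‖ ^ 2 ∂μ0 : ℝ) : ℂ) := by
    rw [← integral_complex_ofReal]; push_cast; rfl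
  have h4 : ((‖f‖ : ℂ)) ^ 2 = ((∫ z, ‖f z‖ ^ 2 ∂μ0 : ℝ) : ℂ) := by rw [← h3]; exact h2
  exact_mod_cast h4.symm

theorem tsum_sq_le (a w : KK n → ℝ) (ha : ∀ k, 0 ≤ a k) (hw : ∀ k, 0 < w k) (h1 : Summable fun k => (w k)⁻¹)
    (h2 : Summable fun k => w k * a k ^ 2) :
    (∑' k, a k) ^ 2 ≤ (∑' k, (w k)⁻¹) * ∑' k, w k * a k ^ 2 := by
  have hs : ∀ s : Finset (KK n), ∑ k ∈ s, a k ≤ Real.sqrt ((∑' k, (w k)⁻¹) * ∑' k, w k * a k ^ 2) := by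
    intro s
    apply Real.le_sqrt_of_sq_le
    have hc := Finset.sum_sq_le_sum_mul_sum_of_sq_eq_mul s (r := a) (f := fun k => (w k)⁻¹) (g := fun k => w k * a k ^ 2)
      (fun k _ => (inv_pos.2 (hw k)).le) (fun k _ => mul_nonneg (hw k).le (sq_nonneg _))
      (fun k _ => by have := (hw k).ne'; field_simp)
    refine hc.trans ?_
    have e1 := h1.sum_le_tsum s (fun k _ => (inv_pos.2 (hw k)).le)
    have e2 := h2.sum_le_tsum s (fun k _ => mul_nonneg (hw k).le (sq_nonneg _))
    exact mul_le_mul e1 e2 (Finset.sum_nonneg fun k _ => mul_nonneg (hw k).le (sq_nonneg _))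
      (tsum_nonneg fun k => (inv_pos.2 (hw k)).le)
  have h0 : 0 ≤ (∑' k, (w k)⁻¹) * ∑' k, w k * a k ^ 2 :=
    mul_nonneg (tsum_nonneg fun k => (inv_pos.2 (hw k)).le) (tsum_nonneg fun k => mul_nonneg (hw k).le (sq_nonneg _))
  have := Real.tsum_le_of_sum_le ha hs
  calc (∑' k, a k) ^ 2 ≤ Real.sqrt ((∑' k, (w k)⁻¹) * ∑' k, w k * a k ^ 2) ^ 2 := by
        apply pow_le_pow_left₀ (tsum_nonneg ha) this
    _ = _ := Real.sq_sqrt h0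

theorem l2bound (d : SF n) (hd : Reg d) (X : KK n → EE) (hX : RD X) (hae : ∀ k, X k =ᵐ[μ0] d k) :
    ∃ Γ : ℝ → ℝ, Integrable Γ μ0 ∧ ∀ z, (∑' k, ‖d k z‖) ^ 2 ≤ Γ z := by
  let w : KK n → ℝ := fun k => (1 + ‖k‖) ^ (2 * n)
  have hw : ∀ k, 0 < w k := fun k => by positivity
  have hsum : ∀ z, Summable fun k => w k * ‖d k z‖ ^ 2 := by
    intro z
    obtain ⟨C, hC⟩ := (hd.RD z).nonneg_bound (2 * n)
    refine Summable.of_nonneg_of_le (fun k => by positivity) (fun k => ?_) ((hd.RD z).summable_norm.mul_left C)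
    rw [pow_two, ← mul_assoc]
    gcongr
    exact hC.2 k
  refine ⟨fun z => (∑' k, (w k)⁻¹) * (∑' k, ENNReal.ofReal (w k * ‖d k z‖ ^ 2)).toReal, ?_, fun z => ?_⟩
  · apply Integrable.const_mul
    apply integrable_toReal_of_lintegral_ne_top
    · apply Measurable.aemeasurable
      refine Measurable.ennreal_tsum fun k => ?_
      have := hd.cont k
      exact ENNReal.measurable_ofReal.comp (by fun_prop : Continuous fun z => w k * ‖d k z‖ ^ 2).measurable
    · rw [lintegral_tsum]
      · have e : ∀ k, ∫⁻ z, ENNReal.ofReal (w k * ‖d k z‖ ^ 2) ∂μ0 = ENNReal.ofReal (w k * ‖X k‖ ^ 2) := by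
          intro k
          simp_rw [ENNReal.ofReal_mul (hw k).le]
          rw [lintegral_const_mul' _ _ ENNReal.ofReal_ne_top, ← EE_lint]
          congr 1
          refine lintegral_congr_ae ?_
          filter_upwards [hae k] with z hz
          rw [hz]
        simp_rw [e]
        obtain ⟨C, hC⟩ := hX.nonneg_bound (2 * n)
        have : Summable fun k => w k * ‖X k‖ ^ 2 := by
          refine Summable.of_nonneg_of_le (fun k => by positivity) (fun k => ?_) (hX.summable_norm.mul_left C)
          rw [pow_two, ← mul_assoc]
          gcongr
          exact hC.2 k
        rw [← ENNReal.ofReal_tsum_of_nonneg (fun k => by positivity) this]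
        exact ENNReal.ofReal_ne_top
      · intro k
        have := hd.cont k
        exact (ENNReal.measurable_ofReal.comp (by fun_prop : Continuous fun z => w k * ‖d k z‖ ^ 2).measurable).aemeasurable
  · beta_reduce
    rw [← ENNReal.ofReal_tsum_of_nonneg (fun k => by positivity) (hsum z),
      ENNReal.toReal_ofReal (tsum_nonneg fun k => by positivity)]
    exact tsum_sq_le (fun k => ‖d k z‖) w (fun k => norm_nonneg _) hw (summable_base n) (hsum z)

/-- shear -/
def sh (h : (Fin n → ℝ) → ℝ) (p : (Fin n → ℝ) × ℝ) : (Fin n → ℝ) × ℝ := (p.1, p.2 - h p.1)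

theorem sh_mp (h : (Fin n → ℝ) → ℝ) (hh : Continuous h) : MeasurePreserving (sh h) volume volume := by
  refine MeasurePreserving.skew_product (f := id) (g := fun x y => y - h x) (MeasurePreserving.id _) ?_ ?_
  · have : Continuous fun p : (Fin n → ℝ) × ℝ => p.2 - h p.1 := by fun_prop
    exact this.measurable
  · exact Filter.Eventually.of_forall fun x => (measurePreserving_sub_right volume (h x)).map_eq

theorem sh_emb (h : (Fin n → ℝ) → ℝ) (hh : Continuous h) : MeasurableEmbedding (sh h) := by
  let e : (Fin n → ℝ) × ℝ ≃ₜ (Fin n → ℝ) × ℝ :=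
    { toFun := sh h
      invFun := fun p => (p.1, p.2 + h p.1)
      left_inv := fun p => by simp [sh]
      right_inv := fun p => by simp [sh]
      continuous_toFun := by unfold sh; fun_prop
      continuous_invFun := by fun_prop }
  exact e.measurableEmbedding

theorem cell_meas : MeasurableSet (cell n) := MeasurableSet.univ_pi fun _ => measurableSet_Ico

theorem cell_ae : cell n =ᵐ[volume] cb n := by
  have := (Measure.univ_pi_Ico_ae_eq_Icc (μ := fun _ : Fin n => (volume : Measure ℝ)) (f := 0) (g := 1))
  rw [← volume_pi] at this
  exact this

theorem cell_vol : volume (cell n) = 1 := by rw [measure_congr cell_ae, cb_vol]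

theorem gamma_int (h : (Fin n → ℝ) → ℝ) (hh : Continuous h) (Γ : ℝ → ℝ) (hΓ : Integrable Γ μ0) :
    IntegrableOn (fun p : (Fin n → ℝ) × ℝ => Γ (p.2 - h p.1)) (fluidCell n h) := by
  have h1 : IntegrableOn (fun p : (Fin n → ℝ) × ℝ => Γ p.2) (cell n ×ˢ Set.Iic 0) := by
    unfold IntegrableOn
    rw [Measure.volume_eq_prod, ← Measure.prod_restrict]
    haveI : IsFiniteMeasure ((volume : Measure (Fin n → ℝ)).restrict (cell n)) := ⟨by simp [cell_vol]⟩
    exact hΓ.comp_snd _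
  have h2 := (sh_mp h hh).integrableOn_comp_preimage (sh_emb h hh) (f := fun p : (Fin n → ℝ) × ℝ => Γ p.2)
    (s := cell n ×ˢ Set.Iic 0)
  have h3 := h2.2 h1
  refine h3.mono_set ?_
  intro p hp
  exact ⟨hp.1, by have := hp.2; simp only [sh, Set.mem_Iic]; linarith⟩

theorem fluid_meas (h : (Fin n → ℝ) → ℝ) (hh : Continuous h) : MeasurableSet (fluidCell n h) :=
  (cell_meas.preimage measurable_fst).inter (measurableSet_lt measurable_snd (hh.measurable.comp measurable_fst))

end HS

namespace HS
set_option linter.unusedSectionVars false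

variable {n : ℕ}

theorem pdE_sh {h : (Fin n → ℝ) → ℝ} (hh : Differentiable ℝ h) {K : (Fin n → ℝ) × ℝ → ℂ} (hK : Differentiable ℝ K)
    (v p : (Fin n → ℝ) × ℝ) :
    pdE n (fun p => (K (sh h p)).re) v p = (fderiv ℝ K (sh h p) (v.1, v.2 - fderiv ℝ h p.1 v.1)).re := by
  have h1 : HasFDerivAt (sh h) ((ContinuousLinearMap.fst ℝ (Fin n → ℝ) ℝ).prod
      (ContinuousLinearMap.snd ℝ (Fin n → ℝ) ℝ - (fderiv ℝ h p.1).comp (ContinuousLinearMap.fst ℝ (Fin n → ℝ) ℝ))) p :=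
    hasFDerivAt_fst.prodMk (hasFDerivAt_snd.sub ((hh p.1).hasFDerivAt.comp p hasFDerivAt_fst))
  have h2 := (Complex.reCLM.hasFDerivAt (x := K (sh h p))).comp p ((hK (sh h p)).hasFDerivAt.comp p h1)
  have h3 : HasFDerivAt (fun p => (K (sh h p)).re) _ p := h2
  rw [pdE, h3.fderiv]
  simp

theorem CPer_of {a : (Fin n → ℝ) → ℝ} (ha : ZPeriodic n a) : CPer (fun x => (a x : ℂ)) := fun x k => by
  simp only [ha x k]

theorem cont_of {a : (Fin n → ℝ) → ℝ} (ha : ContDiff ℝ (⊤ : ℕ∞) a) : ContDiff ℝ (⊤ : ℕ∞) (fun x => (a x : ℂ)) :=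
  Complex.ofRealCLM.contDiff.comp ha

theorem pdX_smooth {a : (Fin n → ℝ) → ℝ} (ha : ContDiff ℝ (⊤ : ℕ∞) a) (i : Fin n) :
    ContDiff ℝ (⊤ : ℕ∞) (pdX n a i) :=
  (ha.fderiv_right (m := (⊤ : ℕ∞)) (by simp)).clm_apply contDiff_const

theorem pdX_per {a : (Fin n → ℝ) → ℝ} (hp : ZPeriodic n a) (i : Fin n) : ZPeriodic n (pdX n a i) := by
  intro x k
  unfold pdX
  have : (fun y => a (y + fun i => (k i : ℝ))) = a := funext fun y => hp y k
  rw [← fderiv_comp_add_right, this]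

theorem SS_congr {y w : KK n → ℂ} (h : ∀ k, y k = w k) (x) : SS y x = SS w x := by
  rw [show y = w from funext h]

theorem SS_norm {y : KK n → ℂ} (hy : RD y) (x) : ‖SS y x‖ ≤ ∑' k, ‖y k‖ :=
  tsum_of_norm_bounded hy.summable_norm.hasSum fun k => by rw [norm_mul, ee_norm, mul_one]

theorem S2_X (c : Fin n → KK n → ℂ) (hc : ∀ i, RD (c i)) {u d : SF n} (hu : Reg u) (hd : Reg d) (i : Fin n)
    (p : (Fin n → ℝ) × ℝ) :
    S2 (opX c (opY u) d i) p = S2 (mulF (κ i) u) p - SS (c i) p.1 * S2 d p := by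
  unfold S2
  rw [← SS_cv (hc i) (hd.RD p.2), ← SS_sub ((hu.κ i).RD p.2) ((hc i).cv (hd.RD p.2))]
  refine SS_congr (fun k => ?_) _
  simp only [opX, opY, mulF, cvF]
  rw [← mul_assoc, kq_mul]

theorem S2_D (c : Fin n → KK n → ℂ) (hc : ∀ i, RD (c i)) (μ : KK n → ℂ) (hμ : RD μ)
    {u q : SF n} (hu : Reg u) (hq : Reg q) (p : (Fin n → ℝ) × ℝ) :
    S2 (opD μ c (opY u) q) p = SS μ p.1 * (S2 q p + ∑ i, SS (c i) p.1 * S2 (mulF (κ i) u) p) := by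
  have e : ∀ i, (fun k z => kq i k * opY u k z) = mulF (κ i) u := fun i => by
    funext k z
    simp only [opY, mulF]
    rw [← mul_assoc, kq_mul]
  have hR : ∀ i, RD (cv (c i) (fun m => mulF (κ i) u m p.2)) := fun i => (hc i).cv ((hu.κ i).RD p.2)
  have e' : ∀ i m, kq i m * opY u m p.2 = mulF (κ i) u m p.2 := fun i m => congrFun (congrFun (e i) m) p.2
  unfold S2 opD
  simp only [cvF, e']
  rw [SS_cv hμ ((hq.RD p.2).add (RD.sum hR)), SS_add (hq.RD p.2) (RD.sum hR), SS_sum hR]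
  simp only [SS_cv (hc _) ((hu.κ _).RD p.2)]

theorem S2_Q (c : Fin n → KK n → ℂ) (hc : ∀ i, RD (c i)) {u d : SF n} (hu : Reg u) (hd : Reg d)
    (p : (Fin n → ℝ) × ℝ) :
    S2 (opQ c (opY u) d) p = - ∑ i, SS (fun k => κ i k * opX c (opY u) d i k p.2) p.1 := by
  have hR : ∀ i, RD (fun k => κ i k * opX c (opY u) d i k p.2) := fun i =>
    ((opX_reg hc (opY_reg hu) hd i).κ i).RD p.2
  unfold S2 opQ
  rw [SS_neg, SS_sum hR]

theorem exists_ext (h ψ : (Fin n → ℝ) → ℝ) (hh : ContDiff ℝ (⊤ : ℕ∞) h) (hhp : ZPeriodic n h)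
    (hψ : ContDiff ℝ (⊤ : ℕ∞) ψ) (hψp : ZPeriodic n ψ) : ∃ φ, IsHarmonicExt n h ψ φ := by
  have hdh : Differentiable ℝ h := hh.differentiable (by simp)
  let c : Fin n → KK n → ℂ := fun i => fc (fun x => ((pdX n h i x : ℝ) : ℂ))
  have hc : ∀ i, RD (c i) := fun i => fc_RD (cont_of (pdX_smooth hh i)) (CPer_of (pdX_per hhp i))
  have hSc : ∀ i x, SS (c i) x = ((pdX n h i x : ℝ) : ℂ) := fun i x => by
    rw [SS_fc (cont_of (pdX_smooth hh i)) (CPer_of (pdX_per hhp i))]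
  let m : (Fin n → ℝ) → ℝ := fun x => 1 + ∑ i, pdX n h i x * pdX n h i x
  have hm0 : ∀ x, 0 < m x := fun x =>
    add_pos_of_pos_of_nonneg one_pos (Finset.sum_nonneg fun i _ => mul_self_nonneg _)
  have hm : ContDiff ℝ (⊤ : ℕ∞) m :=
    contDiff_const.add (ContDiff.sum fun i _ => (pdX_smooth hh i).mul (pdX_smooth hh i))
  have hmi : ContDiff ℝ (⊤ : ℕ∞) (fun x => (m x)⁻¹) := hm.inv fun x => (hm0 x).ne'
  have hmp : ZPeriodic n (fun x => (m x)⁻¹) := fun x k => by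
    simp only [m, pdX_per hhp _ x k]
  let μ : KK n → ℂ := fc (fun x => (((m x)⁻¹ : ℝ) : ℂ))
  have hμ : RD μ := fc_RD (cont_of hmi) (CPer_of hmp)
  have hSμ : ∀ x, SS μ x = (((m x)⁻¹ : ℝ) : ℂ) := fun x => by
    rw [SS_fc (cont_of hmi) (CPer_of hmp)]
  have hmul : ∀ x, SS μ x * (1 + ∑ i, SS (c i) x * SS (c i) x) = 1 := by
    intro x
    simp only [hSμ, hSc]
    have : (1 : ℂ) + ∑ i, ((pdX n h i x : ℝ) : ℂ) * ((pdX n h i x : ℝ) : ℂ) = ((m x : ℝ) : ℂ) := by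
      simp only [m]; push_cast; rfl
    rw [this, ← Complex.ofReal_mul, inv_mul_cancel₀ (hm0 x).ne', Complex.ofReal_one]
  obtain ⟨u, q, d, g, Y, X0, hg0, hg1, hgD, hu0, hdop, hqD, hY, hX0, hYae, hX0ae⟩ :=
    reg_solve c hc (fun i m => fc_conj _ _) (fc (fun x => (ψ x : ℂ))) (fc_RD (cont_of hψ) (CPer_of hψp))
      μ hμ (hinv_of c hc μ hμ hmul)
  obtain ⟨G, hGreg, hGneg, hGder⟩ := seeley g hgD
  have hSm : Sm G := ⟨hGreg, hGder⟩
  have hu : Reg u := hg0 ▸ (hgD 0).left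
  have hd : Reg d := hg1 ▸ (hgD 1).left
  have hq : Reg q := hqD.left
  have hU : ContDiff ℝ (⊤ : ℕ∞) (S2 (G 0)) := S2_smooth hSm
  have hUZ : ContDiff ℝ (⊤ : ℕ∞) (S2 (G 1)) := S2_smooth hSm.shift
  have hUI : ∀ i, ContDiff ℝ (⊤ : ℕ∞) (S2 (mulF (κ i) (G 0))) := fun i => S2_smooth (hSm.mul i)
  have hsh : ContDiff ℝ (⊤ : ℕ∞) (sh h) :=
    contDiff_fst.prodMk (contDiff_snd.sub (hh.comp contDiff_fst))
  let Xf : Fin n → (Fin n → ℝ) × ℝ → ℂ := fun i p =>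
    S2 (mulF (κ i) (G 0)) p - ((pdX n h i p.1 : ℝ) : ℂ) * S2 (G 1) p
  have hXf : ∀ i, ContDiff ℝ (⊤ : ℕ∞) (Xf i) := fun i =>
    (hUI i).sub (((cont_of (pdX_smooth hh i)).comp contDiff_fst).mul hUZ)
  let φ : (Fin n → ℝ) × ℝ → ℝ := fun p => (S2 (G 0) (sh h p)).re
  have hUd : ∀ p, fderiv ℝ (S2 (G 0)) p = S2 (G 1) p • dz n + ∑ i, S2 (mulF (κ i) (G 0)) p • dx i := fun p =>
    (S2_hasFDerivAt (hGreg 0) (hGreg 1) (hGder 0) p).fderiv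
  have hφy : pdE n φ (eY n) = fun p => (S2 (G 1) (sh h p)).re := by
    funext p
    rw [pdE_sh hdh (hU.differentiable (by simp)), hUd]
    simp [eY, dz_apply, dx_apply, ContinuousLinearMap.sum_apply]
  have hφx : ∀ i, pdE n φ (eX n i) = fun p => (Xf i (sh h p)).re := by
    intro i
    funext p
    rw [pdE_sh hdh (hU.differentiable (by simp)), hUd]
    congr 1
    simp only [eX, ContinuousLinearMap.add_apply, ContinuousLinearMap.smul_apply,
      ContinuousLinearMap.sum_apply, dz_apply, dx_apply]
    rw [Finset.sum_eq_single i]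
    · simp [Xf, sh, pdX]; ring
    · intro l _ hl; simp [Pi.single_apply, hl]
    · simp
  have e0 : ∀ p : (Fin n → ℝ) × ℝ, p.2 ≤ 0 → ∀ i, S2 (mulF (κ i) (G 0)) p = S2 (mulF (κ i) u) p := by
    intro p hp i
    exact SS_congr (fun k => by simp only [mulF, hGneg 0 k _ hp, hg0]) _
  have e1 : ∀ p : (Fin n → ℝ) × ℝ, p.2 ≤ 0 → S2 (G 1) p = S2 d p := by
    intro p hp
    exact SS_congr (fun k => by rw [hGneg 1 k _ hp, hg1]) _
  have eX' : ∀ i, ∀ p : (Fin n → ℝ) × ℝ, p.2 ≤ 0 → Xf i p = S2 (opX c (opY u) d i) p := by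
    intro i p hp
    rw [S2_X c hc hu hd, hSc]
    simp only [Xf]
    rw [e0 p hp, e1 p hp]
  have eQ : ∀ p : (Fin n → ℝ) × ℝ, p.2 ≤ 0 → S2 (G 1) p - ∑ i, ((pdX n h i p.1 : ℝ) : ℂ) * Xf i p = S2 q p := by
    intro p hp
    have h1 := S2_D c hc μ hμ hu hq p
    rw [← hdop] at h1
    have h2 := hmul p.1
    simp only [hSc] at h1 h2
    simp only [Xf]
    simp only [e0 p hp, e1 p hp, mul_sub, Finset.sum_sub_distrib]
    have h3 : ∑ i, ((pdX n h i p.1 : ℝ) : ℂ) * (((pdX n h i p.1 : ℝ) : ℂ) * S2 d p)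
      = (∑ i, ((pdX n h i p.1 : ℝ) : ℂ) * ((pdX n h i p.1 : ℝ) : ℂ)) * S2 d p := by
      rw [Finset.sum_mul]; exact Finset.sum_congr rfl fun i _ => by ring
    rw [h3]
    set A := ∑ i, ((pdX n h i p.1 : ℝ) : ℂ) * S2 (mulF (κ i) u) p
    set M := ∑ i, ((pdX n h i p.1 : ℝ) : ℂ) * ((pdX n h i p.1 : ℝ) : ℂ)
    rw [h1]
    linear_combination (S2 q p + A) * h2
  refine ⟨φ, ?_, ?_, ?_, ?_, ?_⟩
  · exact Complex.reCLM.contDiff.comp (hU.comp hsh)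
  · intro x y k
    simp only [φ, sh, hhp x k]
    congr 1
    unfold S2 SS
    exact tsum_congr fun l => by simp only [ee_per l x k]
  · intro p hp
    have hz : (sh h p).2 < 0 := by simp only [sh]; linarith
    unfold lapE
    simp only [hφy, hφx]
    rw [pdE_sh hdh (hUZ.differentiable (by simp))]
    have : ∀ i, pdE n (fun p => (Xf i (sh h p)).re) (eX n i) p =
      (fderiv ℝ (Xf i) (sh h p) (Pi.single i 1, 0) - ((pdX n h i p.1 : ℝ) : ℂ) * fderiv ℝ (Xf i) (sh h p) (0, 1)).re := by
      intro i
      rw [pdE_sh hdh ((hXf i).differentiable (by simp))]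
      congr 1
      have : ((eX n i).1, (eX n i).2 - fderiv ℝ h p.1 (eX n i).1) =
        ((Pi.single i 1, 0) : (Fin n → ℝ) × ℝ) - (pdX n h i p.1) • ((0, 1) : (Fin n → ℝ) × ℝ) := by
        simp [eX, pdX]
      rw [this, map_sub, map_smul, Complex.real_smul]
    simp only [this]
    rw [← Complex.re_sum, ← Complex.add_re]
    set x := p.1
    set z := (sh h p).2 with hzdef
    have hpz : sh h p = (x, z) := rfl
    rw [hpz]
    have hxi : ∀ i, fderiv ℝ (Xf i) (x, z) (Pi.single i 1, 0) = SS (fun k => κ i k * opX c (opY u) d i k z) x := by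
      intro i
      obtain ⟨L, hL, hLi⟩ := SS_hasFDerivAt ((opX_reg hc (opY_reg hu) hd i).RD z) x i
      have h1 : HasFDerivAt (fun x : Fin n → ℝ => (x, z)) (ContinuousLinearMap.inl ℝ _ _) x :=
        hasFDerivAt_prodMk_left x z
      have h2 := ((hXf i).differentiable (by simp) (x, z)).hasFDerivAt.comp x h1
      have h3 : (Xf i ∘ fun x : Fin n → ℝ => (x, z)) = SS (fun k => opX c (opY u) d i k z) := by
        funext x'
        exact eX' i (x', z) hz.le
      rw [h3] at h2
      have h4 := h2.unique hL
      rw [← hLi i, ← h4]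
      simp
    have hzi : ∀ K : (Fin n → ℝ) × ℝ → ℂ, Differentiable ℝ K → HasDerivAt (fun z => K (x, z)) (fderiv ℝ K (x, z) (0, 1)) z := by
      intro K hK
      have h1 : HasDerivAt (fun z : ℝ => (x, z)) ((0, 1) : (Fin n → ℝ) × ℝ) z :=
        (hasDerivAt_const z x).prodMk (hasDerivAt_id z)
      exact (hK (x, z)).hasFDerivAt.comp_hasDerivAt z h1
    have hq1 : HasDerivAt (fun z => S2 (G 1) (x, z) - ∑ i, ((pdX n h i x : ℝ) : ℂ) * Xf i (x, z))
        (fderiv ℝ (S2 (G 1)) (x, z) (0, 1) - ∑ i, ((pdX n h i x : ℝ) : ℂ) * fderiv ℝ (Xf i) (x, z) (0, 1)) z :=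
      (hzi _ (hUZ.differentiable (by simp))).sub
        (HasDerivAt.fun_sum fun i _ => (hzi _ ((hXf i).differentiable (by simp))).const_mul _)
    have hq2 := hqD.SS_hasDeriv x hz
    have hq3 := hq2.congr_of_eventuallyEq
      (f₁ := fun z => S2 (G 1) (x, z) - ∑ i, ((pdX n h i x : ℝ) : ℂ) * Xf i (x, z)) (by
        filter_upwards [Iio_mem_nhds hz] with b hb
        exact eQ (x, b) (le_of_lt hb))
    have hq4 := hq1.unique hq3
    rw [S2_Q c hc hu hd] at hq4
    have hfin : ∑ i, (fderiv ℝ (Xf i) (x, z) (Pi.single i 1, 0) - ((pdX n h i x : ℝ) : ℂ) * fderiv ℝ (Xf i) (x, z) (0, 1))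
        + fderiv ℝ (S2 (G 1)) (x, z) ((eY n).1, (eY n).2 - fderiv ℝ h x (eY n).1) = 0 := by
      rw [Finset.sum_sub_distrib]
      simp only [hxi]
      have : ((eY n).1, (eY n).2 - fderiv ℝ h x (eY n).1) = ((0, 1) : (Fin n → ℝ) × ℝ) := by simp [eY]
      rw [this]
      linear_combination hq4
    rw [hfin]; simp
  · intro x
    simp only [φ, sh, sub_self]
    have : S2 (G 0) (x, 0) = (ψ x : ℂ) := by
      rw [← congrFun (SS_fc (cont_of hψ) (CPer_of hψp)) x]
      exact SS_congr (fun k => by rw [hGneg 0 k _ le_rfl, hg0, hu0]) _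
    rw [this, Complex.ofReal_re]
  · obtain ⟨Γ1, hΓ1, hb1⟩ := l2bound d hd X0 hX0 hX0ae
    obtain ⟨Γ2, hΓ2, hb2⟩ := l2bound (opY u) (opY_reg hu) Y hY hYae
    choose M hM using fun i => per_bdd (cont_of (pdX_smooth hh i)).continuous (CPer_of (pdX_per hhp i))
    have hI1 := gamma_int h hh.continuous Γ1 hΓ1
    have hI2 := gamma_int h hh.continuous Γ2 hΓ2
    have hI := (hI1.const_mul ((∑ i, 2 * M i ^ 2) + 1)).add (hI2.const_mul (∑ i : Fin n, 2 * (2 * Real.pi) ^ 2))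
    refine hI.mono' ?_ ?_
    · apply Continuous.aestronglyMeasurable
      unfold gradSqE
      simp only [hφy, hφx]
      have h1 := hsh.continuous
      have h2 := hUZ.continuous
      have h3 := fun i => (hXf i).continuous
      have h4 := Complex.continuous_re
      refine (continuous_finset_sum _ fun i _ => ?_).add ?_
      · exact (h4.comp ((h3 i).comp h1)).pow 2
      · exact (h4.comp (h2.comp h1)).pow 2
    · filter_upwards [ae_restrict_mem (fluid_meas h hh.continuous)] with p hp
      have hz : (sh h p).2 ≤ 0 := by have := hp.2; simp only [sh]; linarith
      rw [Real.norm_of_nonneg (by unfold gradSqE; positivity)]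
      unfold gradSqE
      simp only [hφy, hφx]
      have hzz : (sh h p).2 = p.2 - h p.1 := rfl
      have b1 : ‖S2 (G 1) (sh h p)‖ ^ 2 ≤ Γ1 (p.2 - h p.1) := by
        rw [e1 _ hz]
        refine le_trans ?_ (hb1 _)
        gcongr
        exact SS_norm (hd.RD _) _
      have b2 : ∀ i, ‖S2 (mulF (κ i) (G 0)) (sh h p)‖ ≤ 2 * Real.pi * ∑' k, ‖opY u k (p.2 - h p.1)‖ := by
        intro i
        rw [e0 _ hz]
        refine (SS_norm ((hu.κ i).RD _) _).trans ?_
        rw [← tsum_mul_left, hzz]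
        refine Summable.tsum_le_tsum (fun k => ?_) ((hu.κ i).RD _).summable_norm
          (((opY_reg hu).RD _).summable_norm.mul_left _)
        rw [mulF, ← kq_mul, mul_assoc, norm_mul]
        exact mul_le_mul_of_nonneg_right (kq_norm_le i k) (norm_nonneg _)
      have b3 : ∀ i, ((Xf i (sh h p)).re) ^ 2 ≤ 2 * M i ^ 2 * Γ1 (p.2 - h p.1) + 2 * (2 * Real.pi) ^ 2 * Γ2 (p.2 - h p.1) := by
        intro i
        have c1 : |(Xf i (sh h p)).re| ≤ ‖S2 (mulF (κ i) (G 0)) (sh h p)‖ + M i * ‖S2 (G 1) (sh h p)‖ := by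
          refine (Complex.abs_re_le_norm _).trans ((norm_sub_le _ _).trans ?_)
          rw [norm_mul]
          gcongr
          exact hM i _
        have c2 : ((Xf i (sh h p)).re) ^ 2 ≤ (‖S2 (mulF (κ i) (G 0)) (sh h p)‖ + M i * ‖S2 (G 1) (sh h p)‖) ^ 2 := by
          rw [← sq_abs]
          gcongr
        have c3 : ‖S2 (mulF (κ i) (G 0)) (sh h p)‖ ^ 2 ≤ (2 * Real.pi) ^ 2 * Γ2 (p.2 - h p.1) := by
          calc _ ≤ (2 * Real.pi * ∑' k, ‖opY u k (p.2 - h p.1)‖) ^ 2 := by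
                gcongr; exact b2 i
            _ = (2 * Real.pi) ^ 2 * (∑' k, ‖opY u k (p.2 - h p.1)‖) ^ 2 := by ring
            _ ≤ _ := by gcongr; exact hb2 _
        have c4 : M i ^ 2 * ‖S2 (G 1) (sh h p)‖ ^ 2 ≤ M i ^ 2 * Γ1 (p.2 - h p.1) := by gcongr
        nlinarith [sq_nonneg (‖S2 (mulF (κ i) (G 0)) (sh h p)‖ - M i * ‖S2 (G 1) (sh h p)‖)]
      have b4 : ((S2 (G 1) (sh h p)).re) ^ 2 ≤ Γ1 (p.2 - h p.1) := by
        refine le_trans ?_ b1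
        rw [← sq_abs]
        gcongr
        exact Complex.abs_re_le_norm _
      have b5 := Finset.sum_le_sum fun i (_ : i ∈ Finset.univ) => b3 i
      rw [Finset.sum_add_distrib, ← Finset.sum_mul, ← Finset.sum_mul] at b5
      simp only [Pi.add_apply]
      linarith

end HS

namespace HS
set_option linter.unusedSectionVars false
variable {n : ℕ}

theorem pdE_smooth {φ : (Fin n → ℝ) × ℝ → ℝ} (hφ : ContDiff ℝ (⊤ : ℕ∞) φ) (v) :
    ContDiff ℝ (⊤ : ℕ∞) (pdE n φ v) :=
  (hφ.fderiv_right (m := (⊤ : ℕ∞)) (by simp)).clm_apply contDiff_const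

theorem pdE_per {φ : (Fin n → ℝ) × ℝ → ℝ} (hp : ZPeriodicE n φ) (v) : ZPeriodicE n (pdE n φ v) := by
  intro x y k
  unfold pdE
  have : (fun q : (Fin n → ℝ) × ℝ => φ (q + ((fun i => (k i : ℝ)), 0))) = φ := by
    funext q
    have := hp q.1 q.2 k
    rw [← this]
    congr 1
    ext <;> simp
  have h2 : ((x + fun i => (k i : ℝ), y) : (Fin n → ℝ) × ℝ) = (x, y) + ((fun i => (k i : ℝ)), 0) := by
    ext <;> simp
  rw [h2, ← fderiv_comp_add_right, this]

/-- Fourier coefficient of a horizontal slice. -/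
def Wf (φ : (Fin n → ℝ) × ℝ → ℝ) (k : KK n) (y : ℝ) : ℂ := fc (fun x => ((φ (x, y) : ℝ) : ℂ)) k

theorem slice_smooth {φ : (Fin n → ℝ) × ℝ → ℝ} (hφ : ContDiff ℝ (⊤ : ℕ∞) φ) (y : ℝ) :
    ContDiff ℝ (⊤ : ℕ∞) (fun x => φ (x, y)) := hφ.comp (contDiff_id.prodMk contDiff_const)

theorem slice_per {φ : (Fin n → ℝ) × ℝ → ℝ} (hφ : ZPeriodicE n φ) (y : ℝ) :
    ZPeriodic n (fun x => φ (x, y)) := fun x k => hφ x y k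

theorem slice_deriv {φ : (Fin n → ℝ) × ℝ → ℝ} (hφ : ContDiff ℝ (⊤ : ℕ∞) φ) (x : Fin n → ℝ) (y : ℝ) :
    HasDerivAt (fun s => φ (x, s)) (pdE n φ (eY n) (x, y)) y := by
  have h1 : HasFDerivAt φ (fderiv ℝ φ (x, y)) (x, y) := (hφ.differentiable (by simp) (x, y)).hasFDerivAt
  have h2 : HasDerivAt (fun s : ℝ => (x, s)) ((0 : Fin n → ℝ), (1 : ℝ)) y :=
    (hasDerivAt_const y x).prodMk (hasDerivAt_id y)
  exact h1.comp_hasDerivAt y h2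

theorem Wf_deriv {φ : (Fin n → ℝ) × ℝ → ℝ} (hφ : ContDiff ℝ (⊤ : ℕ∞) φ) (k : KK n) (y : ℝ) :
    HasDerivAt (Wf φ k) (Wf (pdE n φ (eY n)) k y) y := by
  have hs := pdE_smooth hφ (eY n)
  obtain ⟨C, hC⟩ := ((cb_compact (n := n)).prod (isCompact_Icc (a := y - 1) (b := y + 1))).exists_bound_of_continuousOn
    hs.continuous.continuousOn
  have hcont : ∀ {f : (Fin n → ℝ) × ℝ → ℝ}, Continuous f → ∀ s,
      Continuous fun x => ee (-k) x * ((f (x, s) : ℝ) : ℂ) := fun hf s =>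
    (ee_contDiff (-k)).continuous.mul (Complex.continuous_ofReal.comp (hf.comp (by fun_prop)))
  have key := hasDerivAt_integral_of_dominated_loc_of_deriv_le (μ := volume.restrict (cb n)) (𝕜 := ℝ)
    (F := fun s x => ee (-k) x * ((φ (x, s) : ℝ) : ℂ))
    (F' := fun s x => ee (-k) x * ((pdE n φ (eY n) (x, s) : ℝ) : ℂ)) (x₀ := y) (s := Set.Icc (y - 1) (y + 1))
    (bound := fun _ => C) (Icc_mem_nhds (by linarith) (by linarith))
    (Filter.Eventually.of_forall fun s => (hcont hφ.continuous s).aestronglyMeasurable)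
    ((hcont hφ.continuous y).continuousOn.integrableOn_compact cb_compact)
    (hcont hs.continuous y).aestronglyMeasurable
    (by
      filter_upwards [ae_restrict_mem (cb_compact (n := n)).measurableSet] with x hx s hs'
      rw [norm_mul, ee_norm, one_mul, Complex.norm_real]
      exact hC (x, s) ⟨hx, hs'⟩)
    (by
      have : IsFiniteMeasure (volume.restrict (cb n)) := ⟨by simp [cb_vol]⟩
      exact integrable_const C)
    (Filter.Eventually.of_forall fun x s _ => by
      exact ((slice_deriv hφ x s).ofReal_comp).const_mul _)
  exact key.2

theorem Wf_X {φ : (Fin n → ℝ) × ℝ → ℝ} (hφ : ContDiff ℝ (⊤ : ℕ∞) φ) (hp : ZPeriodicE n φ) (k : KK n) (y : ℝ)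
    (i : Fin n) : Wf (pdE n φ (eX n i)) k y = κ i k * Wf φ k y := by
  unfold Wf
  rw [← fc_cpd (cont_of (slice_smooth hφ y)) (CPer_of (slice_per hp y)) i k]
  congr 1
  funext x
  have h1 : HasFDerivAt φ (fderiv ℝ φ (x, y)) (x, y) := (hφ.differentiable (by simp) (x, y)).hasFDerivAt
  have h2 : HasFDerivAt (fun x : Fin n → ℝ => (x, y)) (ContinuousLinearMap.inl ℝ (Fin n → ℝ) ℝ) x :=
    hasFDerivAt_prodMk_left x y
  have h3 : HasFDerivAt (fun x => ((φ (x, y) : ℝ) : ℂ)) _ x :=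
    Complex.ofRealCLM.hasFDerivAt.comp x (h1.comp x h2)
  unfold cpd
  rw [h3.fderiv]
  simp [pdE, eX]

theorem fc_sq {a : (Fin n → ℝ) → ℝ} (ha : Continuous a) (k : KK n) :
    ‖fc (fun x => (a x : ℂ)) k‖ ^ 2 ≤ ∫ x in cb n, (a x) ^ 2 := by
  have I : ∀ {f : (Fin n → ℝ) → ℝ}, Continuous f → Integrable f (volume.restrict (cb n)) := fun hf =>
    hf.continuousOn.integrableOn_compact cb_compact
  set t := ∫ x in cb n, |a x| with ht
  have h1 : ‖fc (fun x => (a x : ℂ)) k‖ ≤ t := by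
    refine (norm_integral_le_integral_norm _).trans (le_of_eq ?_)
    refine integral_congr_ae (Filter.Eventually.of_forall fun x => ?_)
    simp [ee_norm]
  have h2 : 0 ≤ ∫ x in cb n, (|a x| - t) ^ 2 := integral_nonneg fun x => sq_nonneg _
  have h3 : ∫ x in cb n, (|a x| - t) ^ 2 = (∫ x in cb n, (a x) ^ 2) - 2 * t * t + t ^ 2 := by
    have : ∀ x, (|a x| - t) ^ 2 = (a x ^ 2 - (2 * t) * |a x|) + t ^ 2 := fun x => by
      rw [← sq_abs (a x)]; ring
    simp only [this]
    rw [integral_add (I (by fun_prop)) (I continuous_const), integral_sub (I (by fun_prop)) (I (by fun_prop)),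
      integral_const_mul]
    simp [measureReal_def, cb_vol]
    exact Or.inl rfl
  have h4 : ‖fc (fun x => (a x : ℂ)) k‖ ^ 2 ≤ t ^ 2 := pow_le_pow_left₀ (norm_nonneg _) h1 2
  linarith [h2, h3, h4]

end HS

namespace HS
set_option linter.unusedSectionVars false
variable {n : ℕ}

theorem const_left {f : ℝ → ℂ} {b : ℝ} (hf : ∀ y < b, HasDerivAt f 0 y) {y z : ℝ} (hy : y < b) (hz : z < b) :
    f y = f z :=
  (convex_Iio b).is_const_of_fderivWithin_eq_zero (𝕜 := ℝ)
    (fun x hx => (hf x hx).differentiableAt.differentiableWithinAt)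
    (fun x hx => by
      rw [fderivWithin_of_isOpen isOpen_Iio hx]
      have := (hf x hx).hasFDerivAt.fderiv
      rw [this]; ext; simp) hy hz

theorem ode_bound {W W1 W2 : ℝ → ℂ} {b y0 l : ℝ} {g : ℝ → ℝ} (hl : 0 ≤ l) (hb : y0 < b)
    (h1 : ∀ y, HasDerivAt W (W1 y) y) (h2 : ∀ y, HasDerivAt W1 (W2 y) y)
    (hode : ∀ y < b, W2 y = (l : ℂ) ^ 2 * W y) (hg : IntegrableOn g (Set.Iic y0))
    (hgb : ∀ y ≤ y0, ‖W1 y‖ ^ 2 + l ^ 2 * ‖W y‖ ^ 2 ≤ g y) {y : ℝ} (hy : y ≤ y0) : ‖W y‖ ≤ ‖W y0‖ := by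
  have hE : ∀ (s : ℝ) (y : ℝ), HasDerivAt (fun y : ℝ => ((Real.exp (s * y) : ℝ) : ℂ))
      ((s : ℂ) * ((Real.exp (s * y) : ℝ) : ℂ)) y := fun s y => by
    have h : HasDerivAt (fun y : ℝ => Real.exp (s * y)) (Real.exp (s * y) * (s * 1)) y :=
      ((hasDerivAt_id y).const_mul s).exp
    convert h.ofReal_comp using 1
    push_cast; ring
  have c1 : ∀ y < b, HasDerivAt (fun y : ℝ => ((Real.exp (l * y) : ℝ) : ℂ) * (W1 y - l * W y)) 0 y := fun y hy => by
    refine ((hE l y).mul ((h2 y).sub ((h1 y).const_mul (l : ℂ)))).congr_deriv ?_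
    rw [hode y hy]; simp only [Pi.sub_apply]; ring
  have v0 : ∀ z < b, W1 z - l * W z = 0 := by
    by_contra! hcon
    obtain ⟨z, hz, hne⟩ := hcon
    let V := Real.exp (l * z) * ‖W1 z - l * W z‖
    have hV : 0 < V := mul_pos (Real.exp_pos _) (norm_pos_iff.2 hne)
    have hVy : ∀ y < b, Real.exp (l * y) * ‖W1 y - l * W y‖ = V := fun y hy => by
      have := congrArg norm (const_left c1 hy hz)
      simpa only [norm_mul, Complex.norm_real, V, Real.norm_of_nonneg (Real.exp_pos _).le] using this
    let δ := V / Real.exp (l * y0)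
    have hδ : 0 < δ := div_pos hV (Real.exp_pos _)
    have hlow : ∀ y ≤ y0, δ ^ 2 / 2 ≤ g y := fun y hy => by
      have e1 : δ ≤ ‖W1 y - l * W y‖ := by
        rw [div_le_iff₀ (Real.exp_pos _), ← hVy y (hy.trans_lt hb), mul_comm]
        exact mul_le_mul_of_nonneg_left (Real.exp_le_exp.2 (mul_le_mul_of_nonneg_left hy hl)) (norm_nonneg _)
      have e2 : ‖W1 y - l * W y‖ ≤ ‖W1 y‖ + l * ‖W y‖ := by
        refine (norm_sub_le _ _).trans (le_of_eq ?_)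
        rw [norm_mul, Complex.norm_real, Real.norm_of_nonneg hl]
      have e3 : δ ^ 2 ≤ (‖W1 y‖ + l * ‖W y‖) ^ 2 := pow_le_pow_left₀ hδ.le (e1.trans e2) 2
      nlinarith [hgb y hy, sq_nonneg (‖W1 y‖ - l * ‖W y‖)]
    have : IntegrableOn (fun _ : ℝ => δ ^ 2 / 2) (Set.Iic y0) := by
      refine Integrable.mono hg aestronglyMeasurable_const ?_
      filter_upwards [ae_restrict_mem measurableSet_Iic] with y hy
      rw [Real.norm_of_nonneg (by positivity)]
      exact (hlow y hy).trans (le_abs_self _)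
    rw [integrableOn_const_iff] at this
    rcases this with h | h
    · have : 0 < δ ^ 2 / 2 := by positivity
      simp at h
      exact hδ.ne' h
    · simp at h
  have c2 : ∀ y < b, HasDerivAt (fun y : ℝ => ((Real.exp (-l * y) : ℝ) : ℂ) * W y) 0 y := fun y hy => by
    refine ((hE (-l) y).mul (h1 y)).congr_deriv ?_
    have : W1 y = l * W y := sub_eq_zero.1 (v0 y hy)
    rw [this]; push_cast; ring
  have := congrArg norm (const_left c2 (hy.trans_lt hb) hb)
  simp only [norm_mul, Complex.norm_real, Real.norm_of_nonneg (Real.exp_pos _).le] at this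
  have h3 : Real.exp (-l * y0) ≤ Real.exp (-l * y) := Real.exp_le_exp.2 (by nlinarith)
  have h4 : Real.exp (-l * y) * ‖W y‖ ≤ Real.exp (-l * y) * ‖W y0‖ := by
    rw [this]; exact mul_le_mul_of_nonneg_right h3 (norm_nonneg _)
  exact le_of_mul_le_mul_left h4 (Real.exp_pos _)

theorem κ_sq (i : Fin n) (k : KK n) : κ i k * κ i k = -((‖κ i k‖ ^ 2 : ℝ) : ℂ) := by
  rw [κ_norm, mul_pow, sq_abs]
  unfold κ
  push_cast
  linear_combination (4 * (Real.pi : ℂ) ^ 2 * (k i : ℂ) ^ 2) * Complex.I_sq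

theorem per_abs {h : (Fin n → ℝ) → ℝ} (hh : Continuous h) (hp : ZPeriodic n h) : ∃ M, ∀ x, |h x| ≤ M := by
  obtain ⟨C, hC⟩ := per_bdd (Complex.continuous_ofReal.comp hh) (CPer_of hp)
  exact ⟨C, fun x => by simpa using hC x⟩

theorem Wf_bound {h ψ : (Fin n → ℝ) → ℝ} {φ : (Fin n → ℝ) × ℝ → ℝ} (hh : Continuous h) (H : IsHarmonicExt n h ψ φ)
    {M : ℝ} (hM : ∀ x, |h x| ≤ M) (k : KK n) {y : ℝ} (hy : y ≤ -M - 1) : ‖Wf φ k y‖ ≤ ‖Wf φ k (-M - 1)‖ := by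
  have hlow : ∀ x, -M ≤ h x := fun x => (abs_le.1 (hM x)).1
  have cg : Continuous (gradSqE n φ) := by
    have : ∀ v, Continuous (pdE n φ v) := fun v => (pdE_smooth H.smooth v).continuous
    unfold gradSqE
    fun_prop
  let l := Real.sqrt (∑ i, ‖κ i k‖ ^ 2)
  have hl2 : l ^ 2 = ∑ i, ‖κ i k‖ ^ 2 := Real.sq_sqrt (Finset.sum_nonneg fun i _ => sq_nonneg _)
  have I : ∀ {f : (Fin n → ℝ) → ℝ}, Continuous f → Integrable f (volume.restrict (cb n)) := fun hf =>
    hf.continuousOn.integrableOn_compact cb_compact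
  have sc : ∀ {f : (Fin n → ℝ) × ℝ → ℝ} (y), Continuous f → Continuous fun x => f (x, y) := fun y hf =>
    hf.comp (by fun_prop)
  refine ode_bound (b := -M) (l := l) (W := Wf φ k) (W1 := Wf (pdE n φ (eY n)) k)
    (W2 := Wf (pdE n (pdE n φ (eY n)) (eY n)) k) (g := fun y => ∫ x in cb n, gradSqE n φ (x, y))
    (Real.sqrt_nonneg _) (by linarith)
    (Wf_deriv H.smooth k) (Wf_deriv (pdE_smooth H.smooth _) k) ?_ ?_ ?_ hy
  · intro y hy
    have e1 : ∀ i, Wf (pdE n (pdE n φ (eX n i)) (eX n i)) k y = κ i k * κ i k * Wf φ k y := fun i => by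
      rw [Wf_X (pdE_smooth H.smooth _) (pdE_per H.periodic _), Wf_X H.smooth H.periodic, mul_assoc]
    have e2 : (∑ i, Wf (pdE n (pdE n φ (eX n i)) (eX n i)) k y) + Wf (pdE n (pdE n φ (eY n)) (eY n)) k y = 0 := by
      have hc : ∀ v w, Continuous fun x => ee (-k) x * ((pdE n (pdE n φ v) w (x, y) : ℝ) : ℂ) := fun v w =>
        (ee_contDiff (-k)).continuous.mul (Complex.continuous_ofReal.comp
          (sc y (pdE_smooth (pdE_smooth H.smooth v) w).continuous))
      have hi : ∀ v w, Integrable (fun x => ee (-k) x * ((pdE n (pdE n φ v) w (x, y) : ℝ) : ℂ))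
        (volume.restrict (cb n)) := fun v w => (hc v w).continuousOn.integrableOn_compact cb_compact
      unfold Wf fc
      rw [← integral_finset_sum _ (fun i _ => hi _ _), ← integral_add (integrable_finset_sum _ fun i _ => hi _ _) (hi _ _)]
      rw [← integral_zero (Fin n → ℝ) ℂ (μ := volume.restrict (cb n))]
      refine integral_congr_ae (Filter.Eventually.of_forall fun x => ?_)
      have := H.harmonic (x, y) (hy.trans_le (hlow x))
      unfold lapE at this
      simp only
      rw [← Finset.mul_sum, ← mul_add, ← Complex.ofReal_sum, ← Complex.ofReal_add, this]
      simp
    simp only [e1, ← Finset.sum_mul, κ_sq, Finset.sum_neg_distrib, ← Complex.ofReal_sum, ← hl2] at e2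
    push_cast at e2
    linear_combination e2
  · have s1 : IntegrableOn (gradSqE n φ) (cell n ×ˢ Set.Iic (-M - 1)) := by
      refine H.gradL2.mono_set ?_
      rintro ⟨x, y⟩ ⟨hx, hy⟩
      refine ⟨hx, ?_⟩
      have := hlow x
      simp only [Set.mem_Iic] at hy ⊢
      linarith
    rw [IntegrableOn, Measure.volume_eq_prod, ← Measure.prod_restrict, Measure.restrict_congr_set cell_ae] at s1
    exact s1.integral_prod_right
  · intro y _
    have hp : ∀ v, Continuous fun x => pdE n φ v (x, y) := fun v => sc y (pdE_smooth H.smooth v).continuous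
    have e0 : ∫ x in cb n, gradSqE n φ (x, y) =
        (∑ i, ∫ x in cb n, (pdE n φ (eX n i) (x, y)) ^ 2) + ∫ x in cb n, (pdE n φ (eY n) (x, y)) ^ 2 := by
      have hi : ∀ v, Integrable (fun x => pdE n φ v (x, y) ^ 2) (volume.restrict (cb n)) := fun v => I ((hp v).pow 2)
      unfold gradSqE
      rw [integral_add (integrable_finset_sum _ fun i _ => hi _) (hi _), integral_finset_sum _ fun i _ => hi _]
    have e1 : ∀ i, ‖κ i k‖ ^ 2 * ‖Wf φ k y‖ ^ 2 ≤ ∫ x in cb n, (pdE n φ (eX n i) (x, y)) ^ 2 := fun i => by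
      rw [← mul_pow, ← norm_mul, ← Wf_X H.smooth H.periodic]
      exact fc_sq (hp _) k
    rw [e0, hl2, Finset.sum_mul, add_comm]
    exact add_le_add (Finset.sum_le_sum fun i _ => e1 i) (fc_sq (hp _) k)

theorem ext_bdd {h ψ : (Fin n → ℝ) → ℝ} {φ : (Fin n → ℝ) × ℝ → ℝ} (hh : Continuous h) (hhp : ZPeriodic n h)
    (H : IsHarmonicExt n h ψ φ) : ∃ C, ∀ p : (Fin n → ℝ) × ℝ, p.2 ≤ h p.1 → |φ p| ≤ C := by
  obtain ⟨M, hM⟩ := per_abs hh hhp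
  obtain ⟨C, hC⟩ := ((cb_compact (n := n)).prod (isCompact_Icc (a := -M - 1) (b := M))).exists_bound_of_continuousOn
    H.smooth.continuous.continuousOn
  have hs := fun y => cont_of (slice_smooth H.smooth y)
  have hp := fun y => CPer_of (slice_per H.periodic y)
  have hR : RD (fun k => Wf φ k (-M - 1)) := fc_RD (hs _) (hp _)
  refine ⟨max C (∑' k, ‖Wf φ k (-M - 1)‖), fun p hp' => ?_⟩
  rcases le_total p.2 (-M - 1) with hy | hy
  · refine le_max_of_le_right ?_
    have := inversion (hs p.2) (hp p.2) p.1
    have e : ‖((φ (p.1, p.2) : ℝ) : ℂ)‖ ≤ ∑' k, ‖Wf φ k (-M - 1)‖ := by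
      rw [← this.tsum_eq]
      refine tsum_of_norm_bounded hR.summable_norm.hasSum fun k => ?_
      rw [norm_mul, ee_norm, mul_one]
      exact Wf_bound hh H hM k hy
    simpa using e
  · refine le_max_of_le_left ?_
    have h1 := H.periodic p.1 p.2 (fun i => -⌊p.1 i⌋)
    have h2 := hC ((p.1 + fun i => ((-⌊p.1 i⌋ : ℤ) : ℝ)), p.2) ⟨?_, hy, hp'.trans ((le_abs_self _).trans (hM _))⟩
    · rw [h1] at h2
      exact h2
    · refine ⟨fun i => ?_, fun i => ?_⟩
      · simp only [Pi.add_apply, Pi.zero_apply]; push_cast; linarith [Int.floor_le (p.1 i)]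
      · simp only [Pi.add_apply, Pi.one_apply]; push_cast; linarith [Int.lt_floor_add_one (p.1 i)]
end HS

namespace HS
set_option linter.unusedSectionVars false
variable {n : ℕ}

abbrev SmE (f : (Fin n → ℝ) × ℝ → ℝ) : Prop := ContDiff ℝ (⊤ : ℕ∞) f

theorem SmE.da {f : (Fin n → ℝ) × ℝ → ℝ} (hf : SmE f) (p) : DifferentiableAt ℝ f p :=
  hf.differentiable (by simp) p

theorem pdE_add {f g : (Fin n → ℝ) × ℝ → ℝ} (hf : SmE f) (hg : SmE g) (v) :
    pdE n (fun p => f p + g p) v = fun p => pdE n f v p + pdE n g v p := by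
  funext p
  unfold pdE
  have h : HasFDerivAt (fun p => f p + g p) _ p := (SmE.da hf p).hasFDerivAt.add (SmE.da hg p).hasFDerivAt
  rw [h.fderiv]; rfl

theorem pdE_cmul {f : (Fin n → ℝ) × ℝ → ℝ} (hf : SmE f) (c : ℝ) (v) :
    pdE n (fun p => c * f p) v = fun p => c * pdE n f v p := by
  funext p
  unfold pdE
  have h : HasFDerivAt (fun p => c * f p) _ p := (SmE.da hf p).hasFDerivAt.const_mul c
  rw [h.fderiv]; rfl

theorem pdE_exp {f : (Fin n → ℝ) × ℝ → ℝ} (hf : SmE f) (v) :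
    pdE n (fun p => Real.exp (f p)) v = fun p => Real.exp (f p) * pdE n f v p := by
  funext p
  unfold pdE
  have h : HasFDerivAt (fun p => Real.exp (f p)) _ p := (SmE.da hf p).hasFDerivAt.exp
  rw [h.fderiv]; rfl

theorem pdE_mul {f g : (Fin n → ℝ) × ℝ → ℝ} (hf : SmE f) (hg : SmE g) (v) :
    pdE n (fun p => f p * g p) v = fun p => f p * pdE n g v p + g p * pdE n f v p := by
  funext p
  unfold pdE
  have h : HasFDerivAt (fun p => f p * g p) _ p := (SmE.da hf p).hasFDerivAt.mul (SmE.da hg p).hasFDerivAt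
  rw [h.fderiv]; rfl

theorem lapE_add {f g : (Fin n → ℝ) × ℝ → ℝ} (hf : SmE f) (hg : SmE g) (p) :
    lapE n (fun p => f p + g p) p = lapE n f p + lapE n g p := by
  unfold lapE
  simp only [pdE_add hf hg, pdE_add (pdE_smooth hf _) (pdE_smooth hg _), Finset.sum_add_distrib]
  ring

theorem lapE_cmul {f : (Fin n → ℝ) × ℝ → ℝ} (hf : SmE f) (c : ℝ) (p) :
    lapE n (fun p => c * f p) p = c * lapE n f p := by
  unfold lapE
  simp only [pdE_cmul hf, pdE_cmul (pdE_smooth hf _), ← Finset.mul_sum]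
  ring

theorem lapE_exp {f : (Fin n → ℝ) × ℝ → ℝ} (hf : SmE f) (p) :
    lapE n (fun p => Real.exp (f p)) p = Real.exp (f p) * (lapE n f p + gradSqE n f p) := by
  have he : SmE (fun p => Real.exp (f p)) := hf.exp
  unfold lapE gradSqE
  simp only [pdE_exp hf, pdE_mul he (pdE_smooth hf _), Finset.sum_add_distrib, mul_add, Finset.mul_sum]
  have : ∀ v, pdE n f v p * (Real.exp (f p) * pdE n f v p) = Real.exp (f p) * pdE n f v p ^ 2 := fun v => by ring
  simp only [this]
  ring

def ell (n : ℕ) (M : ℝ) (p : (Fin n → ℝ) × ℝ) : ℝ := p.2 - M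

theorem ell_smooth (M : ℝ) : SmE (ell n M) := contDiff_snd.sub contDiff_const

theorem pdE_ell (M : ℝ) (v) : pdE n (ell n M) v = fun _ => v.2 := by
  funext p
  unfold pdE
  have h : HasFDerivAt (ell n M) _ p := (hasFDerivAt_snd (𝕜 := ℝ) (p := p)).sub_const M
  rw [h.fderiv]; rfl

theorem lapE_ell (M : ℝ) (p) : lapE n (ell n M) p = 0 := by
  unfold lapE
  simp only [pdE_ell]
  simp [pdE]

theorem gradSqE_ell (M : ℝ) (p) : gradSqE n (ell n M) p = 1 := by
  unfold gradSqE
  simp [pdE_ell, eX, eY]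

theorem gradSqE_nonneg (f : (Fin n → ℝ) × ℝ → ℝ) (p) : 0 ≤ gradSqE n f p :=
  add_nonneg (Finset.sum_nonneg fun i _ => sq_nonneg _) (sq_nonneg _)

theorem line_deriv {f : (Fin n → ℝ) × ℝ → ℝ} (hf : SmE f) (q v) (s : ℝ) :
    HasDerivAt (fun s : ℝ => f (q + s • v)) (pdE n f v (q + s • v)) s := by
  have h2 : HasDerivAt (fun s : ℝ => q + s • v) v s := by
    simpa using ((hasDerivAt_id s).smul_const v).const_add q
  exact (SmE.da hf _).hasFDerivAt.comp_hasDerivAt s h2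

theorem second_test {f : (Fin n → ℝ) × ℝ → ℝ} (hf : SmE f) {q} (hq : IsLocalMax f q) (v) :
    pdE n (pdE n f v) v q ≤ 0 := by
  by_contra! hpos
  let g : ℝ → ℝ := fun s => f (q + s • v)
  have hd : deriv g = fun s => pdE n f v (q + s • v) := funext fun s => (line_deriv hf q v s).deriv
  have hdd : deriv (deriv g) = fun s => pdE n (pdE n f v) v (q + s • v) := by
    rw [hd]; exact funext fun s => (line_deriv (pdE_smooth hf v) q v s).deriv
  have hc : Continuous fun s : ℝ => q + s • v := by fun_prop
  have hmax : IsLocalMax g 0 := by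
    have ht : Filter.Tendsto (fun s : ℝ => q + s • v) (nhds 0) (nhds q) := by
      simpa using hc.tendsto 0
    have := ht.eventually hq
    filter_upwards [this] with s hs
    simpa [g] using hs
  have hmin : IsLocalMin g 0 := isLocalMin_of_deriv_deriv_pos (by rw [hdd]; simpa using hpos) hmax.deriv_eq_zero
    (line_deriv hf q v 0).continuousAt
  have hconst : g =ᶠ[nhds 0] fun _ => g 0 := by
    filter_upwards [hmax, hmin] with s h1 h2 using le_antisymm h1 h2
  have h0 : deriv (deriv g) 0 = 0 := by
    rw [hconst.deriv.deriv_eq]; simp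
  rw [hdd] at h0
  simp at h0
  linarith

theorem max_princ {h : (Fin n → ℝ) → ℝ} (hh : Continuous h) (hhp : ZPeriodic n h)
    {w : (Fin n → ℝ) × ℝ → ℝ} (hw : SmE w) (hp : ZPeriodicE n w)
    (hlap : ∀ p : (Fin n → ℝ) × ℝ, p.2 < h p.1 → 0 ≤ lapE n w p)
    (hbd : ∀ x, w (x, h x) ≤ 0) {C : ℝ} (hC : ∀ p : (Fin n → ℝ) × ℝ, p.2 ≤ h p.1 → w p ≤ C)
    (p : (Fin n → ℝ) × ℝ) (hpΩ : p.2 ≤ h p.1) : w p ≤ 0 := by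
  by_contra! hpos
  obtain ⟨M, hM⟩ := per_abs hh hhp
  have hM' : ∀ x, h x ≤ M := fun x => (le_abs_self _).trans (hM x)
  set η := w p with hη
  let δ := η / 4
  have hδ : 0 < δ := by positivity
  let ε := η / 4 / (1 + (M - p.2))
  have hMp : 0 ≤ M - p.2 := by linarith [hM' p.1]
  have hε : 0 < ε := by positivity
  have hεp : ε * (M - p.2) ≤ η / 4 := by
    have h1 : ε * (1 + (M - p.2)) = η / 4 := div_mul_cancel₀ _ (by positivity)
    nlinarith
  let v : (Fin n → ℝ) × ℝ → ℝ := fun p => w p + (ε * ell n M p + δ * Real.exp (ell n M p))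
  have se : SmE (fun p => Real.exp (ell n M p)) := (ell_smooth M).exp
  have s1 : SmE (fun p => ε * ell n M p) := contDiff_const.mul (ell_smooth M)
  have s2 : SmE (fun p => δ * Real.exp (ell n M p)) := contDiff_const.mul se
  have hv : SmE v := hw.add (s1.add s2)
  have hvl : ∀ p, lapE n v p = lapE n w p + δ * Real.exp (ell n M p) := fun p => by
    simp only [v]
    rw [lapE_add hw (s1.add s2), lapE_add s1 s2, lapE_cmul (ell_smooth M), lapE_cmul se,
      lapE_exp (ell_smooth M), lapE_ell, gradSqE_ell]
    ring
  have hvp : ZPeriodicE n v := fun x y k => by simp only [v, hp x y k, ell]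
  have hup : ∀ q : (Fin n → ℝ) × ℝ, q.2 ≤ h q.1 → v q ≤ w q + ε * (q.2 - M) + δ := fun q hq => by
    have : Real.exp (ell n M q) ≤ 1 := Real.exp_le_one_iff.2 (by unfold ell; linarith [hM' q.1])
    simp only [v, ell] at this ⊢
    nlinarith
  have hvp0 : δ < v p := by
    have := mul_pos hδ (Real.exp_pos (ell n M p))
    simp only [v, ell, ← hη] at this ⊢
    have : δ = η / 4 := rfl
    nlinarith
  let L := min p.2 (M - |C| / ε)
  have hL : ∀ q : (Fin n → ℝ) × ℝ, q.2 ≤ h q.1 → q.2 ≤ L → v q ≤ δ := fun q hq hql => by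
    have h1 := hup q hq
    have h2 := hC q hq
    have h3 : q.2 - M ≤ -(|C| / ε) := by have := hql.trans (min_le_right _ _); linarith
    have h4 : ε * (q.2 - M) ≤ -|C| := by
      have := mul_le_mul_of_nonneg_left h3 hε.le
      have h5 : ε * -(|C| / ε) = -|C| := by field_simp
      linarith
    linarith [le_abs_self C]
  let K : Set ((Fin n → ℝ) × ℝ) := (cb n ×ˢ Set.Icc L M) ∩ {q | q.2 ≤ h q.1}
  have hK : IsCompact K := ((cb_compact (n := n)).prod isCompact_Icc).inter_right
    (isClosed_le continuous_snd (hh.comp continuous_fst))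
  let tr : (Fin n → ℝ) × ℝ → (Fin n → ℝ) × ℝ := fun q => ((q.1 + fun i => ((-⌊q.1 i⌋ : ℤ) : ℝ)), q.2)
  have htr : ∀ q : (Fin n → ℝ) × ℝ, q.2 ≤ h q.1 → L ≤ q.2 → tr q ∈ K := fun q hq hl => by
    refine ⟨⟨⟨fun i => ?_, fun i => ?_⟩, hl, hq.trans (hM' _)⟩, ?_⟩
    · simp only [tr, Pi.add_apply, Pi.zero_apply]; push_cast; linarith [Int.floor_le (q.1 i)]
    · simp only [tr, Pi.add_apply, Pi.one_apply]; push_cast; linarith [Int.lt_floor_add_one (q.1 i)]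
    · simp only [tr, Set.mem_setOf_eq, hhp q.1]; exact hq
  have hvtr : ∀ q, v (tr q) = v q := fun q => hvp q.1 q.2 _
  obtain ⟨q, hqK, hqmax⟩ := hK.exists_isMaxOn ⟨tr p, htr p hpΩ (min_le_left _ _)⟩ hv.continuous.continuousOn
  have hqp : δ < v q := by
    refine hvp0.trans_le ?_
    rw [← hvtr p]; exact hqmax (htr p hpΩ (min_le_left _ _))
  have hglob : ∀ r : (Fin n → ℝ) × ℝ, r.2 ≤ h r.1 → v r ≤ v q := fun r hr => by
    rcases le_total r.2 L with hl | hl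
    · exact (hL r hr hl).trans hqp.le
    · rw [← hvtr r]; exact hqmax (htr r hr hl)
  have hInn : q.2 < h q.1 := by
    refine lt_of_le_of_ne hqK.2 fun heq => ?_
    have h1 := hup q hqK.2
    have h2 := hbd q.1
    rw [← heq] at h2
    have h3 : ε * (q.2 - M) ≤ 0 := mul_nonpos_of_nonneg_of_nonpos hε.le (by linarith [hM' q.1, hqK.2])
    have h4 : w q ≤ 0 := h2
    linarith
  have hloc : IsLocalMax v q := by
    have : ∀ᶠ r in nhds q, r.2 < h r.1 :=
      (isOpen_lt continuous_snd (hh.comp continuous_fst)).mem_nhds hInn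
    filter_upwards [this] with r hr using hglob r (le_of_lt hr)
  have hneg : lapE n v q ≤ 0 :=
    add_nonpos (Finset.sum_nonpos fun i _ => second_test hv hloc _) (second_test hv hloc _)
  have := hvl q
  have h1 := hlap q hInn
  have h2 := mul_pos hδ (Real.exp_pos (ell n M q))
  linarith

theorem bdry {h : (Fin n → ℝ) → ℝ} (hh : ContDiff ℝ (⊤ : ℕ∞) h) {w : (Fin n → ℝ) × ℝ → ℝ} (hw : SmE w)
    (hneg : ∀ p : (Fin n → ℝ) × ℝ, p.2 ≤ h p.1 → w p ≤ 0) (h0 : ∀ x, w (x, h x) = 0) (x : Fin n → ℝ) :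
    0 ≤ pdE n w (eY n) (x, h x) - ∑ i, pdX n h i x * pdE n w (eX n i) (x, h x) := by
  have hy : 0 ≤ pdE n w (eY n) (x, h x) := by
    have hd := (slice_deriv hw x (h x)).hasDerivWithinAt (s := Set.Iio (h x))
    have ht := (hasDerivWithinAt_iff_tendsto_slope' (by simp)).1 hd
    refine ge_of_tendsto ht ?_
    · filter_upwards [self_mem_nhdsWithin] with s hs
      have hs' : s < h x := hs
      simp only [slope_def_field, h0]
      exact div_nonneg_of_nonpos (by linarith [hneg (x, s) hs'.le]) (by linarith)
  have ht : ∀ i, pdE n w (eX n i) (x, h x) = - (pdX n h i x * pdE n w (eY n) (x, h x)) := fun i => by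
    have h1 : HasFDerivAt (fun x => w (x, h x)) _ x :=
      (SmE.da hw (x, h x)).hasFDerivAt.comp x
        ((hasFDerivAt_id x).prodMk (hh.differentiable (by simp) x).hasFDerivAt)
    have h2 : HasFDerivAt (fun x => w (x, h x)) (0 : (Fin n → ℝ) →L[ℝ] ℝ) x := by
      simp only [h0]; exact hasFDerivAt_const _ _
    have h3 := congrArg (fun L : (Fin n → ℝ) →L[ℝ] ℝ => L (Pi.single i 1)) (h1.unique h2)
    have h4 : fderiv ℝ w (x, h x) ((Pi.single i 1 : Fin n → ℝ), pdX n h i x) = 0 := h3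
    have h5 : ((Pi.single i 1 : Fin n → ℝ), pdX n h i x) = eX n i + pdX n h i x • eY n := by
      ext <;> simp [eX, eY]
    rw [h5, map_add, map_smul, smul_eq_mul] at h4
    unfold pdE at *
    linarith
  simp only [ht]
  have : ∀ i, pdX n h i x * -(pdX n h i x * pdE n w (eY n) (x, h x)) =
      -((pdX n h i x) ^ 2 * pdE n w (eY n) (x, h x)) := fun i => by ring
  simp only [this, Finset.sum_neg_distrib, sub_neg_eq_add]
  exact add_nonneg hy (Finset.sum_nonneg fun i _ => mul_nonneg (sq_nonneg _) hy)

theorem main_ineq {h a : (Fin n → ℝ) → ℝ} (hh : ContDiff ℝ (⊤ : ℕ∞) h) (hhp : ZPeriodic n h)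
    (ha : ContDiff ℝ (⊤ : ℕ∞) a) (hap : ZPeriodic n a) (hpos : ∀ x, 0 < a x) (x : Fin n → ℝ) :
    DtN n h a x ≤ a x * DtN n h (fun z => Real.log (a z)) x := by
  have H1 := exists_ext h a hh hhp ha hap
  have H2 := exists_ext h (fun z => Real.log (a z)) hh hhp (ha.log fun x => (hpos x).ne')
    (fun x k => by simp only [hap x k])
  unfold DtN
  rw [dif_pos H1, dif_pos H2]
  have E1 := H1.choose_spec
  have E2 := H2.choose_spec
  set A := H1.choose
  set Φ := H2.choose
  obtain ⟨C1, hC1⟩ := ext_bdd hh.continuous hhp E1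
  obtain ⟨C2, hC2⟩ := ext_bdd hh.continuous hhp E2
  have sΦ : SmE (fun p => Real.exp (Φ p)) := E2.smooth.exp
  have sA : SmE (fun p => (-1) * A p) := contDiff_const.mul E1.smooth
  let w : (Fin n → ℝ) × ℝ → ℝ := fun p => Real.exp (Φ p) + (-1) * A p
  have sw : SmE w := sΦ.add sA
  have w0 : ∀ x, w (x, h x) = 0 := fun x => by
    simp only [w, E1.boundary, E2.boundary, Real.exp_log (hpos x)]; ring
  have hwneg := max_princ hh.continuous hhp sw
    (fun x y k => by simp only [w, E1.periodic x y k, E2.periodic x y k])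
    (fun p hp => by
      simp only [w]
      rw [lapE_add sΦ sA, lapE_cmul E1.smooth, lapE_exp E2.smooth, E1.harmonic p hp, E2.harmonic p hp]
      have := mul_nonneg (Real.exp_pos (Φ p)).le (gradSqE_nonneg Φ p)
      linarith)
    (fun x => (w0 x).le) (C := Real.exp C2 + C1)
    (fun p hp => by
      have h1 := (abs_le.1 (hC1 p hp)).1
      have h2 := Real.exp_le_exp.2 ((le_abs_self _).trans (hC2 p hp))
      simp only [w]; linarith)
  have hb := bdry hh sw hwneg w0 x
  simp only [w, pdE_add sΦ sA, pdE_cmul E1.smooth, pdE_exp E2.smooth, E2.boundary, Real.exp_log (hpos x)] at hb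
  have e : ∀ i, pdX n h i x * (a x * pdE n Φ (eX n i) (x, h x) + -1 * pdE n A (eX n i) (x, h x)) =
      a x * (pdX n h i x * pdE n Φ (eX n i) (x, h x)) - pdX n h i x * pdE n A (eX n i) (x, h x) := fun i => by ring
  simp only [e, Finset.sum_sub_distrib, ← Finset.mul_sum] at hb
  linarith

theorem final (n : ℕ) (T : ℝ) (h : ℝ → (Fin n → ℝ) → ℝ) (hsol : IsHeleShawSol n T h) (c₀ : ℝ) (hc₀ : 0 < c₀)
    (ha : ∀ t ∈ Set.Icc 0 T, ∀ x, c₀ ≤ HSa n h t x) (t : ℝ) (ht : t ∈ Set.Icc 0 T) (x : Fin n → ℝ) :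
    DtN n (h t) (fun z => HSa n h t z) x ≤ HSa n h t x * DtN n (h t) (fun z => Real.log (HSa n h t z)) x := by
  have hh : ContDiff ℝ (⊤ : ℕ∞) (h t) := hsol.smooth.comp (contDiff_const.prodMk contDiff_id)
  have H := hsol.extension t ht
  have E := H.choose_spec
  have hB : (fun z => HSa n h t z) = fun z => 1 - pdE n H.choose (eY n) (z, h t z) := by
    funext z
    unfold HSa HSB Bop
    rw [dif_pos H]
  refine main_ineq (a := fun z => HSa n h t z) hh (hsol.periodic t) ?_ ?_ (fun x => hc₀.trans_le (ha t ht x)) x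
  · rw [hB]
    exact contDiff_const.sub ((pdE_smooth E.smooth _).comp (contDiff_id.prodMk hh))
  · rw [hB]
    intro z k
    simp only [hsol.periodic t z k, pdE_per E.periodic (eY n) z _ k]
end HS

/-- if a is bounded below by a positive constant, then pointwise
G(h)a ≤ a G(h)(log a). -/
theorem heleShaw_log_a_inequality (n : ℕ) (hn : 1 ≤ n) (T : ℝ) (hT : 0 ≤ T)
    (h : ℝ → (Fin n → ℝ) → ℝ) (hsol : IsHeleShawSol n T h)
    (c₀ : ℝ) (hc₀ : 0 < c₀) (ha : ∀ t ∈ Set.Icc 0 T, ∀ x, c₀ ≤ HSa n h t x) :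
    ∀ t ∈ Set.Icc 0 T, ∀ x,
      DtN n (h t) (fun z => HSa n h t z) x
        ≤ HSa n h t x * DtN n (h t) (fun z => Real.log (HSa n h t z)) x := by
  exact fun t ht x => HS.final n T h hsol c₀ hc₀ ha t ht x

end
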